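/- Let L be a countable arithmetically definable first-order language and let T be a complete arithmetically definable L-theory with no finite models. If T is D₁-categorical for some nonzero arithmetic degree D₁, then T is D₂-categorical for every nonzero arithmetic degree D₂. -/

import Mathlib

open FirstOrder FirstOrder.Language

namespace ArMorley

/-! ## Arithmetical sets and arithmetic reducibility -/

/-- Function symbols of the language of arithmetic: `0`, `1`, `+`, `·`. -/
inductive ArFunc : ℕ → Type
  | zero : ArFunc 0
  | one : ArFunc 0
  | add : ArFunc 2
  | mul : ArFunc 2

/-- Relation symbols: `<` and a unary oracle predicate. -/
inductive ArRel : ℕ → Type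
  | lt : ArRel 2
  | mem : ArRel 1

/-- The language `(+, ·, 0, 1, <, Y)` of arithmetic with a unary oracle predicate. -/
def arithLang : FirstOrder.Language := ⟨ArFunc, ArRel⟩

/-- The standard structure on `ℕ`, with the oracle predicate interpreted by `Y`. -/
def arithStructure (Y : Set ℕ) : arithLang.Structure ℕ where
  funMap := fun {n} f =>
    match f with
    | ArFunc.zero => fun _ => 0
    | ArFunc.one => fun _ => 1
    | ArFunc.add => fun v => v 0 + v 1
    | ArFunc.mul => fun v => v 0 * v 1
  RelMap := fun {n} r =>
    match r with
    | ArRel.lt => fun v => v 0 < v 1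
    | ArRel.mem => fun v => v 0 ∈ Y

/-- `X ≤_ar Y` : `X` is definable without parameters in `(ℕ, +, ·, 0, 1, <, Y)`. -/
def ArReducible (X Y : Set ℕ) : Prop :=
  letI := arithStructure Y
  ∃ φ : arithLang.Formula (Fin 1), X = { n : ℕ | φ.Realize (fun _ => n) }

/-- `X` is arithmetical: definable without parameters in `(ℕ, +, ·, 0, 1, <)`. -/
def IsArithmetical (X : Set ℕ) : Prop := ArReducible X ∅

/-- `X` and `Y` have the same arithmetic degree. -/
def ArEquiv (X Y : Set ℕ) : Prop := ArReducible X Y ∧ ArReducible Y X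

/-! ## Coding conventions -/

/-- Code of a list of naturals. -/
def listCode (l : List ℕ) : ℕ := Encodable.encode l

/-- Code of a finite tuple of naturals. -/
def tupleCode {n : ℕ} (v : Fin n → ℕ) : ℕ := listCode (List.ofFn v)

/-- The subset of `ℕ` corresponding to a set of elements of a coded domain. -/
def subCode {A : Set ℕ} (S : Set ↥A) : Set ℕ := Subtype.val '' S

/-- Code of a set of `n`-tuples from a coded domain as a subset of `ℕ`. -/
def tupleSetCode {A : Set ℕ} {n : ℕ} (X : Set (Fin n → ↥A)) : Set ℕ :=
  { c : ℕ | ∃ v ∈ X, c = tupleCode (fun i => ((v i : ℕ))) }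

/-- Code of the graph of a function between coded domains. -/
def graphCode {A B : Set ℕ} (f : ↥A → ↥B) : Set ℕ :=
  { c : ℕ | ∃ a : ↥A, c = Nat.pair (a : ℕ) ((f a : ℕ)) }

/-! ## Gödel coded languages -/

/-- A fixed Gödel coding of the symbols of a countable first-order language. -/
structure GoedelCoding (L : FirstOrder.Language) where
  encFun : ∀ n, L.Functions n → ℕ
  encFun_inj : ∀ n, Function.Injective (encFun n)
  encRel : ∀ n, L.Relations n → ℕ
  encRel_inj : ∀ n, Function.Injective (encRel n)

variable {L : FirstOrder.Language}

/-- The set of codes of the symbols of `L`. -/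
def symbolCodes (g : GoedelCoding L) : Set ℕ :=
  { c | (∃ (n : ℕ) (f : L.Functions n), c = Nat.pair 0 (Nat.pair n (g.encFun n f))) ∨
        (∃ (n : ℕ) (R : L.Relations n), c = Nat.pair 1 (Nat.pair n (g.encRel n R))) }

/-- `L` is an arithmetically definable language. -/
def ArithLang (g : GoedelCoding L) : Prop := IsArithmetical (symbolCodes g)

/-- Code of a term, with a given coding of the variables. -/
def termCode (g : GoedelCoding L) {α : Type} (encα : α → ℕ) (t : L.Term α) : ℕ :=
  listCode (t.listEncode.map (Sum.elim (fun a => Nat.pair 0 (encα a))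
    (fun p => Nat.pair 1 (Nat.pair p.1 (g.encFun p.1 p.2)))))

/-- Code of a (bounded) formula, with a given coding of free variables. -/
def formulaCode (g : GoedelCoding L) {α : Type} (encα : α → ℕ) {n : ℕ}
    (φ : L.BoundedFormula α n) : ℕ :=
  listCode (φ.listEncode.map (Sum.elim
    (fun p => Nat.pair 0 (Nat.pair p.1
      (termCode g (Sum.elim (fun a => Nat.pair 0 (encα a)) (fun i => Nat.pair 1 i.1)) p.2)))
    (Sum.elim
      (fun q => Nat.pair 1 (Nat.pair q.1 (g.encRel q.1 q.2)))
      (fun m => Nat.pair 2 m))))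

/-- Code of a sentence. -/
def sentenceCode (g : GoedelCoding L) (φ : L.Sentence) : ℕ :=
  formulaCode g (fun a : Empty => a.elim) φ

/-- The set of codes of the axioms of a theory. -/
def theoryCode (g : GoedelCoding L) (T : L.Theory) : Set ℕ :=
  { c | ∃ φ ∈ T, c = sentenceCode g φ }

/-- `T` is an arithmetically definable theory. -/
def ArithTheory (g : GoedelCoding L) (T : L.Theory) : Prop := IsArithmetical (theoryCode g T)

/-! ## Coded structures -/

/-- A coded `L`-structure: an `L`-structure whose domain is a subset of `ℕ`
with infinite complement. -/
structure CodedStructure (L : FirstOrder.Language) where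
  carrier : Set ℕ
  compl_infinite : (carrierᶜ : Set ℕ).Infinite
  struc : L.Structure ↥carrier

/-- A coded structure is a model of `T`. -/
def CodedStructure.Models (M : CodedStructure L) (T : L.Theory) : Prop :=
  ∀ φ ∈ T, @Sentence.Realize L ↥M.carrier M.struc φ

/-- The (coded) elementary diagram of a coded structure. -/
def elemDiagram (g : GoedelCoding L) (M : CodedStructure L) : Set ℕ :=
  { c | ∃ (k : ℕ) (φ : L.Formula (Fin k)) (a : Fin k → ↥M.carrier),
      c = Nat.pair (Nat.pair k (formulaCode g Fin.val φ)) (tupleCode fun i => ((a i : ℕ))) ∧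
      (letI := M.struc; φ.Realize a) }

/-- A coded structure is arithmetically decidable if its elementary diagram is arithmetical. -/
def ArithDecidable (g : GoedelCoding L) (M : CodedStructure L) : Prop :=
  IsArithmetical (elemDiagram g M)

/-- `M ≼ N` for coded structures: `M`'s domain is contained in `N`'s, and the
inclusion is elementary. -/
structure ElemSub (M N : CodedStructure L) : Prop where
  subset : M.carrier ⊆ N.carrier
  elem : ∀ (k : ℕ) (φ : L.Formula (Fin k)) (a : Fin k → ↥M.carrier),
    (letI := M.struc; φ.Realize a) ↔
      (letI := N.struc; φ.Realize (fun i => (⟨((a i : ℕ)), subset (a i).2⟩ : ↥N.carrier)))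

/-- A coded model of `T` is arithmetically extendible if it is an elementary substructure of
an arithmetically decidable coded model of `T`. -/
def ArithExtendible (g : GoedelCoding L) (T : L.Theory) (M : CodedStructure L) : Prop :=
  ∃ N : CodedStructure L, ArithDecidable g N ∧ N.Models T ∧ ElemSub M N

/-! ## Model-theoretic notions in arbitrary structures -/

/-- `N` (with structure `SN`) is a model of `T`. -/
def ModelsT (L : FirstOrder.Language) (T : L.Theory) (N : Type) (SN : L.Structure N) : Prop :=
  ∀ φ ∈ T, @Sentence.Realize L N SN φ

/-- `T` has no finite models. -/
def NoFiniteModels (L : FirstOrder.Language) (T : L.Theory) : Prop :=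
  ∀ (N : Type) (SN : L.Structure N), ModelsT L T N SN → Infinite N

/-- Elementary embeddings, with the structures given explicitly. -/
def EEmb (L : FirstOrder.Language) (M : Type) (SM : L.Structure M)
    (N : Type) (SN : L.Structure N) : Type _ :=
  @FirstOrder.Language.ElementaryEmbedding L M N SM SN

/-- The underlying map of an elementary embedding. -/
def EEmb.fn {L : FirstOrder.Language} {M : Type} {SM : L.Structure M}
    {N : Type} {SN : L.Structure N} (j : EEmb L M SM N SN) : M → N :=
  @FirstOrder.Language.ElementaryEmbedding.toFun L M N SM SN j

/-- A subset of `N^n` definable with parameters from `P`. -/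
def DefinableOverT (L : FirstOrder.Language) (N : Type) (SN : L.Structure N) (P : Set N)
    {n : ℕ} (X : Set (Fin n → N)) : Prop :=
  letI := SN
  ∃ (m : ℕ) (ψ : L.Formula (Fin n ⊕ Fin m)) (b : Fin m → N),
    (∀ i, b i ∈ P) ∧ X = { v | ψ.Realize (Sum.elim v b) }

/-- A subset of `N` definable with (arbitrary) parameters. -/
def Definable1 (L : FirstOrder.Language) (N : Type) (SN : L.Structure N) (Y : Set N) : Prop :=
  letI := SN
  ∃ (m : ℕ) (ψ : L.Formula (Fin 1 ⊕ Fin m)) (b : Fin m → N),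
    Y = { x : N | ψ.Realize (Sum.elim (fun _ => x) b) }

/-- The algebraic closure of `B` in `N`: elements satisfying a formula with parameters
from `B` having finitely many solutions. -/
def aclIn (L : FirstOrder.Language) (N : Type) (SN : L.Structure N) (B : Set N) : Set N :=
  letI := SN
  { a : N | ∃ (k : ℕ) (φ : L.Formula (Fin 1 ⊕ Fin k)) (b : Fin k → N),
      (∀ i, b i ∈ B) ∧ φ.Realize (Sum.elim (fun _ => a) b) ∧
      { x : N | φ.Realize (Sum.elim (fun _ => x) b) }.Finite }

/-- The domain of the substructure of `N` generated by `B`: values of terms at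
arguments from `B`. -/
def genSub (L : FirstOrder.Language) (N : Type) (SN : L.Structure N) (B : Set N) : Set N :=
  letI := SN
  { a : N | ∃ (t : L.Term ℕ) (v : ℕ → N), (∀ i, v i ∈ B) ∧ a = t.realize v }

/-- The set defined by a formula `φ(x, p̄)` in one free variable with parameters `p̄`. -/
def smSet (L : FirstOrder.Language) (N : Type) (SN : L.Structure N) {k : ℕ}
    (φ : L.Formula (Fin 1 ⊕ Fin k)) (p : Fin k → N) : Set N :=
  letI := SN
  { x : N | φ.Realize (Sum.elim (fun _ => x) p) }

/-- A definable tuple-set in a coded structure, with parameters from `P`. -/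
def DefinableOver (M : CodedStructure L) (P : Set ↥M.carrier) {n : ℕ}
    (X : Set (Fin n → ↥M.carrier)) : Prop :=
  DefinableOverT L ↥M.carrier M.struc P X

/-- A definable tuple-set in a coded structure, with arbitrary parameters. -/
def DefinableIn (M : CodedStructure L) {n : ℕ} (X : Set (Fin n → ↥M.carrier)) : Prop :=
  DefinableOver M Set.univ X

/-! ## Isomorphisms of coded structures and `D`-categoricity -/

/-- An isomorphism of coded `L`-structures. -/
structure CodedIso (M N : CodedStructure L) where
  toFun : ↥M.carrier → ↥N.carrier
  invFun : ↥N.carrier → ↥M.carrier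
  left_inv : Function.LeftInverse invFun toFun
  right_inv : Function.RightInverse invFun toFun
  map_fun : ∀ {k : ℕ} (f : L.Functions k) (v : Fin k → ↥M.carrier),
    toFun (M.struc.funMap f v) = N.struc.funMap f (toFun ∘ v)
  map_rel : ∀ {k : ℕ} (r : L.Relations k) (v : Fin k → ↥M.carrier),
    M.struc.RelMap r v ↔ N.struc.RelMap r (toFun ∘ v)

/-- `f` is a `D`-preserving isomorphism, where `d` is a representative of the
arithmetic degree `D`. -/
def DPreserving (d : Set ℕ) {M N : CodedStructure L} (f : CodedIso M N) : Prop :=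
  ArReducible (graphCode f.toFun) d ∧
  ArReducible (graphCode f.invFun) d ∧
  (∀ (n : ℕ) (X : Set (Fin n → ↥M.carrier)), DefinableIn M X →
      ArEquiv (tupleSetCode X) d →
      ArEquiv (tupleSetCode ((fun v => f.toFun ∘ v) '' X)) d) ∧
  (∀ (n : ℕ) (Y : Set (Fin n → ↥N.carrier)), DefinableIn N Y →
      ArEquiv (tupleSetCode Y) d →
      ArEquiv (tupleSetCode ((fun v => f.invFun ∘ v) '' Y)) d)

/-- `T` is `D`-categorical, where `d` is a representative of the nonzero
arithmetic degree `D`. -/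
def DCategorical (g : GoedelCoding L) (T : L.Theory) (d : Set ℕ) : Prop :=
  ∀ M₀ M₁ M₂ : CodedStructure L,
    ArithDecidable g M₀ → M₀.Models T →
    M₁.Models T → ArithExtendible g T M₁ →
    M₂.Models T → ArithExtendible g T M₂ →
    ElemSub M₀ M₁ → ElemSub M₀ M₂ →
    ArEquiv M₁.carrier d → ArEquiv M₂.carrier d →
    ∃ f : CodedIso M₁ M₂, DPreserving d f ∧
      ∀ (x : ℕ) (hx : x ∈ M₀.carrier) (h₁ : x ∈ M₁.carrier),
        ((f.toFun ⟨x, h₁⟩ : ℕ)) = x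

/-! ## Vaughtian pairs, prime models, strong minimality -/

/-- `T` has a Vaughtian pair. -/
def HasVaughtianPair (T : L.Theory) : Prop :=
  ∃ (N : Type) (SN : L.Structure N),
    ModelsT L T N SN ∧
    ∃ S : @FirstOrder.Language.ElementarySubstructure L N SN,
      ((S.toSubstructure : Set N) ≠ Set.univ ∧
      ∃ (k : ℕ) (φ : L.Formula (Fin 1 ⊕ Fin k)) (a : Fin k → N),
        (∀ i, a i ∈ (S.toSubstructure : Set N)) ∧
        smSet L N SN φ a ⊆ (S.toSubstructure : Set N) ∧
        (smSet L N SN φ a).Infinite)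

/-- A coded model of `T` is prime: it elementarily embeds into every model of `T`. -/
def PrimeModel (L : FirstOrder.Language) (T : L.Theory) (P : CodedStructure L) : Prop :=
  P.Models T ∧ ∀ (N : Type) (SN : L.Structure N), ModelsT L T N SN →
    Nonempty (EEmb L ↥P.carrier P.struc N SN)

/-- `φ(x, p̄)` is strongly minimal over the coded model `M`: its solution set in `M` is
infinite, and in every elementary extension of `M` modelling `T` every definable subset of
its solution set is finite or cofinite in it. -/
def StronglyMinimalOver (T : L.Theory) (M : CodedStructure L) {k : ℕ}
    (φ : L.Formula (Fin 1 ⊕ Fin k)) (p : Fin k → ↥M.carrier) : Prop :=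
  (smSet L ↥M.carrier M.struc φ p).Infinite ∧
  ∀ (N : Type) (SN : L.Structure N), ModelsT L T N SN →
    ∀ j : EEmb L ↥M.carrier M.struc N SN,
      ∀ Y : Set N, Definable1 L N SN Y →
        Y ⊆ smSet L N SN φ (fun i => j.fn (p i)) →
        (Y.Finite ∨ ((smSet L N SN φ (fun i => j.fn (p i))) \ Y).Finite)

/-- `T` is a strongly minimal theory: every model is infinite, and every
parameter-definable subset of any model is finite or cofinite. -/
def StronglyMinimalTheory (L : FirstOrder.Language) (T : L.Theory) : Prop :=
  (∀ (N : Type) (SN : L.Structure N), ModelsT L T N SN → Infinite N) ∧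
  (∀ (N : Type) (SN : L.Structure N), ModelsT L T N SN →
    ∀ Y : Set N, Definable1 L N SN Y → (Y.Finite ∨ (Yᶜ : Set N).Finite))

/-- The structural control clause: an arithmetically decidable prime model together with
a strongly minimal formula over it generating every elementary extension. -/
def GeneratesAll (T : L.Theory) (P : CodedStructure L) {k : ℕ}
    (φ : L.Formula (Fin 1 ⊕ Fin k)) (p : Fin k → ↥P.carrier) : Prop :=
  ∀ (N : Type) (SN : L.Structure N), ModelsT L T N SN →
    ∀ j : EEmb L ↥P.carrier P.struc N SN,
      aclIn L N SN (Set.range j.fn ∪ smSet L N SN φ (fun i => j.fn (p i))) = Set.univ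

/-- Clause (3) of the arithmetic Baldwin–Lachlan theorem. -/
def SMControl (g : GoedelCoding L) (T : L.Theory) : Prop :=
  ∃ (P : CodedStructure L), ArithDecidable g P ∧ PrimeModel L T P ∧
    ∃ (k : ℕ) (φ : L.Formula (Fin 1 ⊕ Fin k)) (p : Fin k → ↥P.carrier),
      StronglyMinimalOver T P φ p ∧ GeneratesAll T P φ p

/-! ## Types and arithmetical stability -/

/-- A formula with a finite parameter tuple from a coded structure, in `n` object
variables. -/
def ParamFormula (L : FirstOrder.Language) (M : CodedStructure L) (n : ℕ) : Type :=
  Σ k : ℕ, L.Formula (Fin n ⊕ Fin k) × (Fin k → ↥M.carrier)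

/-- All parameters of `q` lie in `A`. -/
def paramsIn {M : CodedStructure L} {n : ℕ} (A : Set ℕ) (q : ParamFormula L M n) : Prop :=
  ∀ i, ((q.2.2 i : ℕ)) ∈ A

/-- `p` is consistent with the elementary diagram of `M`: it is realized in some
elementary extension of `M`. -/
def TypeConsistent (M : CodedStructure L) {n : ℕ} (p : Set (ParamFormula L M n)) : Prop :=
  ∃ (N : Type) (SN : L.Structure N) (j : EEmb L ↥M.carrier M.struc N SN) (b : Fin n → N),
    ∀ q ∈ p, letI := SN; q.2.1.Realize (Sum.elim b (fun i => j.fn (q.2.2 i)))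

/-- `p` is a (complete) `n`-type over `A` inside `M`: a maximal set of formulas with
parameters from `A` consistent with the elementary diagram of `M`. -/
def IsNType (M : CodedStructure L) (A : Set ℕ) (n : ℕ)
    (p : Set (ParamFormula L M n)) : Prop :=
  (∀ q ∈ p, paramsIn A q) ∧
  TypeConsistent M p ∧
  ∀ q : ParamFormula L M n, paramsIn A q → q ∉ p → ¬ TypeConsistent M (insert q p)

/-- The code of a formula-with-parameters. -/
def pfCode (g : GoedelCoding L) {M : CodedStructure L} {n : ℕ} (q : ParamFormula L M n) : ℕ :=
  Nat.pair
    (Nat.pair q.1 (formulaCode g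
      (Sum.elim (fun i : Fin n => Nat.pair 0 i.1) (fun j : Fin q.1 => Nat.pair 1 j.1)) q.2.1))
    (tupleCode fun i => ((q.2.2 i : ℕ)))

/-- The set of codes of the formulas of `p`. -/
def typeCode (g : GoedelCoding L) {M : CodedStructure L} {n : ℕ}
    (p : Set (ParamFormula L M n)) : Set ℕ :=
  { c | ∃ q ∈ p, c = pfCode g q }

/-- `p` is realized in the coded elementary extension `N` of `M`. -/
def RealizesType {M N : CodedStructure L} (h : M.carrier ⊆ N.carrier) {n : ℕ}
    (p : Set (ParamFormula L M n)) : Prop :=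
  ∃ b : Fin n → ↥N.carrier, ∀ q ∈ p,
    letI := N.struc
    q.2.1.Realize (Sum.elim b (fun i => (⟨((q.2.2 i : ℕ)), h (q.2.2 i).2⟩ : ↥N.carrier)))

/-- The `(n, i)`-th column of an effective join. -/
def tripleSection (X : Set ℕ) (n i : ℕ) : Set ℕ := { m | Nat.pair n (Nat.pair i m) ∈ X }

/-- `T` is arithmetically stable: over every arithmetically decidable model and every
arithmetical parameter set, the family of arithmetic `n`-types (for all `n ≥ 1`) has a
uniform arithmetical code in which every arithmetic `n`-type appears at least once. -/
def ArithStable (g : GoedelCoding L) (T : L.Theory) : Prop :=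
  ∀ M : CodedStructure L, ArithDecidable g M → M.Models T →
    ∀ A : Set ℕ, A ⊆ M.carrier → IsArithmetical A →
      ∃ X : Set ℕ, IsArithmetical X ∧
        (∀ n, 1 ≤ n → ∀ i : ℕ, ∃ p : Set (ParamFormula L M n),
            IsNType M A n p ∧ IsArithmetical (typeCode g p) ∧
            tripleSection X n i = typeCode g p) ∧
        (∀ n, 1 ≤ n → ∀ p : Set (ParamFormula L M n),
            IsNType M A n p → IsArithmetical (typeCode g p) →
            ∃ i : ℕ, tripleSection X n i = typeCode g p)

/-- The set of elements occurring as a coordinate of a tuple in `X`. -/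
def coordSet {N : Type} {n : ℕ} (X : Set (Fin n → N)) : Set N :=
  { m | ∃ v ∈ X, ∃ i, v i = m }

/-! ## First-order definability, uniformly in a family of structures with named parameters -/

/-- A structure with elements named by `C`. -/
structure Pt (L : FirstOrder.Language) (C : Type) where
  M : Type
  S : L.Structure M
  c : C → M

section UDf

variable {L : FirstOrder.Language} {C I : Type} {A : I → Pt L C}

/-- The predicates `P i` are defined by one formula in all the structures `A i`. -/
def UDf (A : I → Pt L C) {α : Type} (P : ∀ i, (α → (A i).M) → Prop) : Prop :=
  ∃ φ : L.Formula (C ⊕ α), ∀ i v, @Formula.Realize L _ (A i).S _ φ (Sum.elim (A i).c v) ↔ P i v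

variable {α β : Type} {P Q : ∀ i, (α → (A i).M) → Prop}

theorem UDf.congr (h : UDf A P) (e : ∀ i v, P i v ↔ Q i v) : UDf A Q := by
  obtain ⟨φ, hφ⟩ := h
  exact ⟨φ, fun i v => (hφ i v).trans (e i v)⟩

theorem UDf.not (h : UDf A P) : UDf A (fun i v => ¬ P i v) := by
  obtain ⟨φ, hφ⟩ := h
  exact ⟨∼φ, fun i v => by beta_reduce; rw [← hφ]; exact @Formula.realize_not L _ (A i).S _ _ _⟩

theorem UDf.and (h : UDf A P) (h' : UDf A Q) : UDf A (fun i v => P i v ∧ Q i v) := by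
  obtain ⟨φ, hφ⟩ := h
  obtain ⟨ψ, hψ⟩ := h'
  exact ⟨φ ⊓ ψ, fun i v => by beta_reduce; rw [← hφ, ← hψ]; exact @Formula.realize_inf L _ (A i).S _ _ _ _⟩

theorem UDf.or (h : UDf A P) (h' : UDf A Q) : UDf A (fun i v => P i v ∨ Q i v) :=
  ((h.not.and h'.not).not).congr fun i v => by tauto

theorem UDf.imp (h : UDf A P) (h' : UDf A Q) : UDf A (fun i v => P i v → Q i v) :=
  (h.not.or h').congr fun i v => by tauto

/-- Substituting variables and parameters for variables. -/
theorem UDf.subst {P : ∀ i, (β → (A i).M) → Prop} (h : UDf A P) (f : β → C ⊕ α) :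
    UDf A (fun i v => P i (fun b => Sum.elim (A i).c v (f b))) := by
  obtain ⟨φ, hφ⟩ := h
  refine ⟨φ.relabel (Sum.elim Sum.inl f), fun i v => ?_⟩
  let _ := (A i).S
  beta_reduce
  rw [← hφ, Formula.realize_relabel]
  refine iff_of_eq (congrArg _ ?_)
  ext x
  rcases x with x | x <;> rfl

theorem UDf.comp {P : ∀ i, (β → (A i).M) → Prop} (h : UDf A P) (f : β → α) :
    UDf A (fun i v => P i (fun b => v (f b))) :=
  h.subst (fun b => Sum.inr (f b))

theorem UDf.ex [Finite β] {P : ∀ i, (α ⊕ β → (A i).M) → Prop} (h : UDf A P) :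
    UDf A (fun i v => ∃ w : β → (A i).M, P i (Sum.elim v w)) := by
  obtain ⟨φ, hφ⟩ := h
  refine ⟨(φ.relabel (Equiv.sumAssoc C α β).symm).iExs β, fun i v => ?_⟩
  let _ := (A i).S
  rw [Formula.realize_iExs]
  refine exists_congr fun w => ?_
  rw [← hφ, Formula.realize_relabel]
  refine iff_of_eq (congrArg _ ?_)
  ext x
  rcases x with x | x | x <;> rfl

theorem UDf.all [Finite β] {P : ∀ i, (α ⊕ β → (A i).M) → Prop} (h : UDf A P) :
    UDf A (fun i v => ∀ w : β → (A i).M, P i (Sum.elim v w)) :=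
  h.not.ex.not.congr fun i v => by simp

theorem UDf.ex1 {P : ∀ i, (α → (A i).M) → (A i).M → Prop}
    (h : UDf (α := α ⊕ Unit) A fun i v => P i (fun a => v (Sum.inl a)) (v (Sum.inr ()))) :
    UDf A (fun i v => ∃ x, P i v x) :=
  h.ex.congr fun _ _ => ⟨fun ⟨w, hw⟩ => ⟨w (), hw⟩, fun ⟨x, hx⟩ => ⟨fun _ => x, hx⟩⟩

theorem UDf.all1 {P : ∀ i, (α → (A i).M) → (A i).M → Prop}
    (h : UDf (α := α ⊕ Unit) A fun i v => P i (fun a => v (Sum.inl a)) (v (Sum.inr ()))) :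
    UDf A (fun i v => ∀ x, P i v x) :=
  (UDf.ex1 (P := fun i v x => ¬ P i v x) h.not).not.congr fun _ _ => by simp

theorem UDf.eq (f f' : C ⊕ α) :
    UDf A (fun i v => Sum.elim (A i).c v f = Sum.elim (A i).c v f') := by
  refine ⟨Term.equal (Term.var f) (Term.var f'), fun i v => ?_⟩
  let _ := (A i).S
  rw [Formula.realize_equal]
  rfl

theorem UDf.eq_var (a b : α) : UDf A (fun _ v => v a = v b) := UDf.eq (Sum.inr a) (Sum.inr b)

theorem UDf.eq_const (a : α) (c : C) : UDf A (fun i v => v a = (A i).c c) :=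
  UDf.eq (Sum.inr a) (Sum.inl c)

theorem UDf.true : UDf (α := α) A (fun _ _ => True) :=
  ⟨⊤, fun i v => by let _ := (A i).S; simp⟩

theorem UDf.false : UDf (α := α) A (fun _ _ => False) :=
  ⟨⊥, fun i v => by let _ := (A i).S; simp⟩

theorem UDf.const (p : Prop) : UDf (α := α) A (fun _ _ => p) := by
  by_cases h : p
  · exact UDf.true.congr (by simp [h])
  · exact UDf.false.congr (by simp [h])

theorem UDf.iInf {κ : Type} [Finite κ] {P : κ → ∀ i, (α → (A i).M) → Prop}
    (h : ∀ k, UDf A (P k)) : UDf A (fun i v => ∀ k, P k i v) := by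
  choose φ hφ using h
  refine ⟨Formula.iInf φ, fun i v => ?_⟩
  let _ := (A i).S
  rw [Formula.realize_iInf]
  exact forall_congr' fun k => hφ k i v

theorem UDf.iSup {κ : Type} [Finite κ] {P : κ → ∀ i, (α → (A i).M) → Prop}
    (h : ∀ k, UDf A (P k)) : UDf A (fun i v => ∃ k, P k i v) :=
  ((UDf.iInf fun k => (h k).not).not).congr fun i v => by simp

/-- A formula evaluated at variables and parameters. -/
theorem UDf.formula (φ : L.Formula β) (f : β → C ⊕ α) :
    UDf A (fun i v => @Formula.Realize L _ (A i).S _ φ (fun b => Sum.elim (A i).c v (f b))) :=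
  ⟨φ.relabel f, fun i v => by let _ := (A i).S; rw [Formula.realize_relabel]; rfl⟩

/-- At most `k` solutions. -/
def AtMost {X : Type} (k : ℕ) (p : X → Prop) : Prop :=
  ∀ w : Fin (k + 1) → X, (∀ j, p (w j)) → ∃ i j, i ≠ j ∧ w i = w j

theorem UDf.atMost (k : ℕ) {P : ∀ i, (α → (A i).M) → (A i).M → Prop}
    (h : UDf (α := α ⊕ Unit) A fun i v => P i (fun a => v (Sum.inl a)) (v (Sum.inr ()))) :
    UDf A (fun i v => AtMost k (P i v)) := by
  refine (UDf.all (β := Fin (k + 1)) (P := fun i v =>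
    (∀ j, P i (fun a => v (Sum.inl a)) (v (Sum.inr j))) →
      ∃ i j : Fin (k + 1), i ≠ j ∧ v (Sum.inr i) = v (Sum.inr j)) ?_)
  refine (UDf.iInf fun j => ?_).imp (UDf.iSup fun i => UDf.iSup fun j =>
    (UDf.const _).and (UDf.eq_var _ _))
  exact h.comp (Sum.elim Sum.inl (fun _ => Sum.inr j))

end UDf

theorem atMost_iff {X : Type} {k : ℕ} {p : X → Prop} :
    AtMost k p ↔ {x | p x}.Finite ∧ {x | p x}.ncard ≤ k := by
  constructor
  · intro h
    have key : ∀ t : Finset X, (∀ x ∈ t, p x) → t.card ≤ k := by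
      intro t ht
      by_contra hc
      push Not at hc
      obtain ⟨s, hs, hsc⟩ := Finset.exists_subset_card_eq (show k + 1 ≤ t.card from hc)
      obtain ⟨i, j, hij, e⟩ := h (fun i => (s.equivFinOfCardEq hsc).symm i)
        (fun j => ht _ (hs (Subtype.mem _)))
      exact hij (by simpa using e)
    have hfin : {x | p x}.Finite := by
      by_contra hinf
      obtain ⟨t, ht, hc⟩ := Set.Infinite.exists_subset_card_eq hinf (k + 1)
      have := key t (fun x hx => ht hx)
      omega
    refine ⟨hfin, ?_⟩
    rw [Set.ncard_eq_toFinset_card _ hfin]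
    exact key _ (by simp)
  · rintro ⟨hf, hc⟩ w hw
    by_contra hne
    push Not at hne
    have hinj : Function.Injective w := fun i j e => by
      by_contra hij
      exact hne i j hij e
    have h1 : (Set.range w).ncard = k + 1 := by
      rw [← Set.image_univ, Set.ncard_image_of_injective _ hinj]; simp
    have := Set.ncard_le_ncard (s := Set.range w) (t := {x | p x})
      (by rintro _ ⟨j, rfl⟩; exact hw j) hf
    omega

theorem AtMost.mono {X : Type} {k k' : ℕ} {p q : X → Prop} (h : AtMost k p) (hk : k ≤ k')
    (hq : ∀ x, q x → p x) : AtMost k' q := by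
  rw [atMost_iff] at *
  exact ⟨h.1.subset hq, (Set.ncard_le_ncard hq h.1).trans (h.2.trans hk)⟩

theorem AtMost.finite {X : Type} {k : ℕ} {p : X → Prop} (h : AtMost k p) : {x | p x}.Finite :=
  (atMost_iff.1 h).1

/-- Elements definable over an elementary map transfer. -/
theorem UDf.transfer {L : FirstOrder.Language} {C I : Type} {A : I → Pt L C} {α : Type}
    {P : ∀ i, (α → (A i).M) → Prop} (h : UDf A P) {i j : I} (f : (A i).M → (A j).M)
    (hf : ∀ (n : ℕ) (φ : L.Formula (Fin n)) (v : Fin n → (A i).M),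
      @Formula.Realize L _ (A j).S _ φ (f ∘ v) ↔ @Formula.Realize L _ (A i).S _ φ v)
    (hc : ∀ x, f ((A i).c x) = (A j).c x) (v : α → (A i).M) :
    P i v ↔ P j (f ∘ v) := by
  obtain ⟨φ, hφ⟩ := h
  rw [← hφ, ← hφ]
  let _ := (A i).S
  let _ := (A j).S
  let e : (A i).M ↪ₑ[L] (A j).M := ⟨f, fun n φ v => hf n φ v⟩
  rw [← e.map_formula]
  refine iff_of_eq (congrArg _ ?_)
  ext x
  rcases x with x | x
  · exact hc x
  · rfl

/-! ## Definability in arithmetic -/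

/-- The structure of arithmetic with oracle `Y`. -/
abbrev natPt (Y : Set ℕ) : Pt arithLang Empty := ⟨ℕ, arithStructure Y, Empty.elim⟩

/-- A predicate on tuples definable in arithmetic with oracle `Y`. -/
def DN (Y : Set ℕ) {α : Type} (P : (α → ℕ) → Prop) : Prop :=
  UDf (fun _ : Unit => natPt Y) (fun _ v => P v)

/-- A function on tuples whose graph is definable in arithmetic with oracle `Y`. -/
def DNf (Y : Set ℕ) {α : Type} (f : (α → ℕ) → ℕ) : Prop :=
  DN (α := α ⊕ Unit) Y (fun v => f (fun a => v (Sum.inl a)) = v (Sum.inr ()))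

section
variable {Y : Set ℕ} {α β : Type} {P Q : (α → ℕ) → Prop} {f g : (α → ℕ) → ℕ}

theorem DN.congr (h : DN Y P) (e : ∀ v, P v ↔ Q v) : DN Y Q := UDf.congr h fun _ => e
theorem DN.not (h : DN Y P) : DN Y (fun v => ¬ P v) := UDf.not h
theorem DN.and (h : DN Y P) (h' : DN Y Q) : DN Y (fun v => P v ∧ Q v) := UDf.and h h'
theorem DN.or (h : DN Y P) (h' : DN Y Q) : DN Y (fun v => P v ∨ Q v) := UDf.or h h'
theorem DN.imp (h : DN Y P) (h' : DN Y Q) : DN Y (fun v => P v → Q v) := UDf.imp h h'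
theorem DN.comp {P : (β → ℕ) → Prop} (h : DN Y P) (f : β → α) :
    DN Y (fun v => P (fun b => v (f b))) := UDf.comp h f
theorem DN.ex1 {P : (α → ℕ) → ℕ → Prop}
    (h : DN (α := α ⊕ Unit) Y fun v => P (fun a => v (Sum.inl a)) (v (Sum.inr ()))) :
    DN Y (fun v => ∃ x, P v x) := UDf.ex1 (A := fun _ : Unit => natPt Y) (P := fun _ v x => P v x) h
theorem DN.all1 {P : (α → ℕ) → ℕ → Prop}
    (h : DN (α := α ⊕ Unit) Y fun v => P (fun a => v (Sum.inl a)) (v (Sum.inr ()))) :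
    DN Y (fun v => ∀ x, P v x) := UDf.all1 (A := fun _ : Unit => natPt Y) (P := fun _ v x => P v x) h
theorem DN.eq_var (a b : α) : DN Y (fun v => v a = v b) :=
  UDf.eq_var (A := fun _ : Unit => natPt Y) a b

theorem DN.comp1 {p : ℕ → Prop} (h : DN (α := Unit) Y (fun v => p (v ()))) (hf : DNf Y f) :
    DN Y (fun v => p (f v)) := by
  refine (DN.ex1 (P := fun v x => f v = x ∧ p x)
    (DN.and hf (h.comp fun _ => Sum.inr ()))).congr fun v => ?_
  simp

theorem DN.comp2 {p : ℕ → ℕ → Prop} (h : DN (α := Bool) Y (fun v => p (v true) (v false)))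
    (hf : DNf Y f) (hg : DNf Y g) : DN Y (fun v => p (f v) (g v)) := by
  have h1 : DN (α := (α ⊕ Unit) ⊕ Unit) Y (fun v => p (v (Sum.inl (Sum.inr ()))) (v (Sum.inr ()))) :=
    h.comp fun b => if b then Sum.inl (Sum.inr ()) else Sum.inr ()
  have h2 : DN (α := (α ⊕ Unit) ⊕ Unit) Y
    (fun v => f (fun a => v (Sum.inl (Sum.inl a))) = (v (Sum.inl (Sum.inr ())))) :=
    DN.comp hf (Sum.elim (fun a => Sum.inl (Sum.inl a)) (fun _ => Sum.inl (Sum.inr ())))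
  have h3 : DN (α := (α ⊕ Unit) ⊕ Unit) Y
    (fun v => g (fun a => v (Sum.inl (Sum.inl a))) = v (Sum.inr ())) :=
    DN.comp hg (Sum.elim (fun a => Sum.inl (Sum.inl a)) (fun _ => Sum.inr ()))
  refine (DN.ex1 (P := fun v x => ∃ y, f v = x ∧ g v = y ∧ p x y)
    (DN.ex1 (P := fun (v : α ⊕ Unit → ℕ) y => f (fun a => v (Sum.inl a)) = v (Sum.inr ()) ∧
      g (fun a => v (Sum.inl a)) = y ∧ p (v (Sum.inr ())) y)
      (h2.and (h3.and h1)))).congr fun v => ?_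
  simp

theorem DNf.weak (hf : DNf Y f) : DNf (α := α ⊕ β) Y (fun v => f (fun a => v (Sum.inl a))) :=
  DN.comp hf (Sum.elim (fun a => Sum.inl (Sum.inl a)) Sum.inr)

theorem DNf.var (a : α) : DNf Y (fun v => v a) := DN.eq_var _ _

theorem DNf.comp1 {u : ℕ → ℕ} (h : DNf (α := Unit) Y (fun v => u (v ()))) (hf : DNf Y f) :
    DNf Y (fun v => u (f v)) := by
  have := DN.comp2 (p := fun x y => u x = y) (DN.comp h
    (Sum.elim (fun _ => true) (fun _ => false))) (hf.weak (β := Unit)) (DNf.var (Sum.inr ()))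
  exact this

theorem DNf.comp2 {u : ℕ → ℕ → ℕ} (h : DNf (α := Bool) Y (fun v => u (v true) (v false)))
    (hf : DNf Y f) (hg : DNf Y g) : DNf Y (fun v => u (f v) (g v)) := by
  have h1 : DN (α := ((α ⊕ Unit) ⊕ Unit) ⊕ Unit) Y
      (fun v => u (v (Sum.inl (Sum.inr ()))) (v (Sum.inr ())) = v (Sum.inl (Sum.inl (Sum.inr ())))) :=
    DN.comp h (Sum.elim (fun b => if b then Sum.inl (Sum.inr ()) else Sum.inr ())
      (fun _ => (Sum.inl (Sum.inl (Sum.inr ())))))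
  have h2 : DN (α := ((α ⊕ Unit) ⊕ Unit) ⊕ Unit) Y
    (fun v => f (fun a => v (Sum.inl (Sum.inl (Sum.inl a)))) = (v (Sum.inl (Sum.inr ())))) :=
    DN.comp hf (Sum.elim (fun a => Sum.inl (Sum.inl (Sum.inl a))) (fun _ => Sum.inl (Sum.inr ())))
  have h3 : DN (α := ((α ⊕ Unit) ⊕ Unit) ⊕ Unit) Y
    (fun v => g (fun a => v (Sum.inl (Sum.inl (Sum.inl a)))) = v (Sum.inr ())) :=
    DN.comp hg (Sum.elim (fun a => Sum.inl (Sum.inl (Sum.inl a))) (fun _ => Sum.inr ()))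
  refine (DN.ex1 (P := fun (v : α ⊕ Unit → ℕ) x => ∃ y, f (fun a => v (Sum.inl a)) = x ∧
      g (fun a => v (Sum.inl a)) = y ∧ u x y = v (Sum.inr ()))
    (DN.ex1 (P := fun (v : (α ⊕ Unit) ⊕ Unit → ℕ) y =>
      f (fun a => v (Sum.inl (Sum.inl a))) = v (Sum.inr ()) ∧
      g (fun a => v (Sum.inl (Sum.inl a))) = y ∧ u (v (Sum.inr ())) y = v (Sum.inl (Sum.inr ())))
      (h2.and (h3.and h1)))).congr fun v => ?_
  simp

theorem DNf.zero : DNf Y (fun _ : α → ℕ => 0) := by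
  let t : arithLang.Term (Empty ⊕ (α ⊕ Unit)) := Term.func ArFunc.zero Fin.elim0
  refine ⟨Term.equal t (Term.var (Sum.inr (Sum.inr ()))), fun _ v => ?_⟩
  let _ := arithStructure Y
  rw [Formula.realize_equal]
  rfl

theorem DNf.one : DNf Y (fun _ : α → ℕ => 1) := by
  let t : arithLang.Term (Empty ⊕ (α ⊕ Unit)) := Term.func ArFunc.one Fin.elim0
  refine ⟨Term.equal t (Term.var (Sum.inr (Sum.inr ()))), fun _ v => ?_⟩
  let _ := arithStructure Y
  rw [Formula.realize_equal]
  rfl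

theorem DNf.add (hf : DNf Y f) (hg : DNf Y g) : DNf Y (fun v => f v + g v) := by
  refine DNf.comp2 ?_ hf hg
  let t : arithLang.Term (Empty ⊕ (Bool ⊕ Unit)) := Term.func ArFunc.add
    ![Term.var (Sum.inr (Sum.inl true)), Term.var (Sum.inr (Sum.inl false))]
  refine ⟨Term.equal t (Term.var (Sum.inr (Sum.inr ()))), fun _ v => ?_⟩
  let _ := arithStructure Y
  rw [Formula.realize_equal]
  rfl

theorem DNf.mul (hf : DNf Y f) (hg : DNf Y g) : DNf Y (fun v => f v * g v) := by
  refine DNf.comp2 ?_ hf hg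
  let t : arithLang.Term (Empty ⊕ (Bool ⊕ Unit)) := Term.func ArFunc.mul
    ![Term.var (Sum.inr (Sum.inl true)), Term.var (Sum.inr (Sum.inl false))]
  refine ⟨Term.equal t (Term.var (Sum.inr (Sum.inr ()))), fun _ v => ?_⟩
  let _ := arithStructure Y
  rw [Formula.realize_equal]
  rfl

theorem DN.lt (hf : DNf Y f) (hg : DNf Y g) : DN Y (fun v => f v < g v) := by
  refine DN.comp2 (p := fun a b => a < b) ?_ hf hg
  let r : arithLang.Relations 2 := ArRel.lt
  refine ⟨r.formula₂ (Term.var (Sum.inr true)) (Term.var (Sum.inr false)), fun _ v => ?_⟩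
  let _ := arithStructure Y
  rw [Formula.realize_rel₂]
  rfl

theorem DN.mem (hf : DNf Y f) : DN Y (fun v => f v ∈ Y) := by
  refine DN.comp1 (p := fun a => a ∈ Y) ?_ hf
  let r : arithLang.Relations 1 := ArRel.mem
  refine ⟨r.formula₁ (Term.var (Sum.inr ())), fun _ v => ?_⟩
  let _ := arithStructure Y
  rw [Formula.realize_rel₁]
  rfl

theorem DN.eq (hf : DNf Y f) (hg : DNf Y g) : DN Y (fun v => f v = g v) :=
  DN.comp2 (p := fun a b => a = b) (DN.eq_var true false) hf hg

theorem DNf.pair (hf : DNf Y f) (hg : DNf Y g) : DNf Y (fun v => Nat.pair (f v) (g v)) := by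
  have hf' := hf.weak (β := Unit)
  have hg' := hg.weak (β := Unit)
  have ho : DNf (α := α ⊕ Unit) Y (fun v => v (Sum.inr ())) := DNf.var _
  refine (((DN.lt hf' hg').and (DN.eq ((hg'.mul hg').add hf') ho)).or
    ((DN.lt hf' hg').not.and (DN.eq (((hf'.mul hf').add hf').add hg') ho))).congr fun v => ?_
  unfold Nat.pair
  beta_reduce
  split_ifs with h <;> simp [h]

theorem DNf.unpair1 (hf : DNf Y f) : DNf Y (fun v => (f v).unpair.1) := by
  refine (DN.ex1 (P := fun (v : α ⊕ Unit → ℕ) x =>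
    Nat.pair (v (Sum.inr ())) x = f (fun a => v (Sum.inl a)))
    (DN.eq ((DNf.var _).pair (DNf.var _)) hf.weak.weak)).congr fun v => ?_
  constructor
  · rintro ⟨x, hx⟩
    simp [← hx]
  · intro h
    exact ⟨_, by rw [← h]; exact Nat.pair_unpair _⟩

theorem DNf.unpair2 (hf : DNf Y f) : DNf Y (fun v => (f v).unpair.2) := by
  refine (DN.ex1 (P := fun (v : α ⊕ Unit → ℕ) x =>
    Nat.pair x (v (Sum.inr ())) = f (fun a => v (Sum.inl a)))
    (DN.eq ((DNf.var _).pair (DNf.var _)) hf.weak.weak)).congr fun v => ?_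
  constructor
  · rintro ⟨x, hx⟩
    simp [← hx]
  · intro h
    exact ⟨_, by rw [← h]; exact Nat.pair_unpair _⟩

theorem DNf.beta (hf : DNf Y f) (hg : DNf Y g) : DNf Y (fun v => Nat.beta (f v) (g v)) := by
  have hb : DNf Y (fun v => (g v + 1) * (f v).unpair.2 + 1) :=
    ((hg.add DNf.one).mul hf.unpair2).add DNf.one
  have hb' := hb.weak (β := Unit)
  have ho : DNf (α := α ⊕ Unit) Y (fun v => v (Sum.inr ())) := DNf.var _
  refine ((DN.lt ho hb').and (DN.ex1 (P := fun (v : α ⊕ Unit → ℕ) x =>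
    (f (fun a => v (Sum.inl a))).unpair.1 =
      ((g (fun a => v (Sum.inl a)) + 1) * (f (fun a => v (Sum.inl a))).unpair.2 + 1) * x +
      v (Sum.inr ()))
    (DN.eq hf.unpair1.weak.weak ((hb'.weak.mul (DNf.var _)).add ho.weak)))).congr fun v => ?_
  unfold Nat.beta
  beta_reduce
  set b := (g (fun a => v (Sum.inl a)) + 1) * (f (fun a => v (Sum.inl a))).unpair.2 + 1 with hbd
  constructor
  · rintro ⟨h1, x, hx⟩
    rw [hx, Nat.mul_add_mod, Nat.mod_eq_of_lt h1]
  · intro h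
    rw [← h]
    exact ⟨Nat.mod_lt _ (by omega), _, (Nat.div_add_mod _ _).symm⟩

theorem exists_beta (s : ℕ → ℕ) (k : ℕ) : ∃ c, ∀ i ≤ k, Nat.beta c i = s i := by
  refine ⟨Nat.unbeta ((List.range (k + 1)).map s), fun i hi => ?_⟩
  have h : i < ((List.range (k + 1)).map s).length := by simp; omega
  have := Nat.beta_unbeta_coe ((List.range (k + 1)).map s) ⟨i, h⟩
  simpa using this

theorem DNf.of_primrec {u : ℕ → ℕ} (hu : Nat.Primrec u) :
    ∀ {α : Type} {f : (α → ℕ) → ℕ}, DNf Y f → DNf Y (fun v => u (f v)) := by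
  induction hu with
  | zero => exact fun _ => DNf.zero
  | succ => exact fun h => h.add DNf.one
  | left => exact fun h => h.unpair1
  | right => exact fun h => h.unpair2
  | pair _ _ ih1 ih2 => exact fun h => (ih1 h).pair (ih2 h)
  | comp _ _ ih1 ih2 => exact fun h => ih1 (ih2 h)
  | @prec f g _ _ ih1 ih2 =>
    intro α u hu
    refine DNf.comp1 (u := Nat.unpaired fun z n => n.rec (f z) fun y IH =>
      g <| Nat.pair z <| Nat.pair y IH) ?_ hu
    have h0 : DNf (α := (Unit ⊕ Unit) ⊕ Unit) Y (fun v => v (Sum.inl (Sum.inl ()))) := DNf.var _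
    have h1 : DNf (α := (Unit ⊕ Unit) ⊕ Unit) Y (fun v => v (Sum.inl (Sum.inr ()))) := DNf.var _
    have h2 : DNf (α := (Unit ⊕ Unit) ⊕ Unit) Y (fun v => v (Sum.inr ())) := DNf.var _
    have hi : DNf (α := ((Unit ⊕ Unit) ⊕ Unit) ⊕ Unit) Y (fun v => v (Sum.inr ())) := DNf.var _
    have key : DN (α := Unit ⊕ Unit) Y (fun v => ∃ c,
        Nat.beta c 0 = f (v (Sum.inl ())).unpair.1 ∧
        Nat.beta c (v (Sum.inl ())).unpair.2 = v (Sum.inr ()) ∧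
        ∀ i, i < (v (Sum.inl ())).unpair.2 → Nat.beta c (i + 1) =
          g (Nat.pair (v (Sum.inl ())).unpair.1 (Nat.pair i (Nat.beta c i)))) := by
      refine DN.ex1 ((DN.eq (h2.beta DNf.zero) (ih1 h0.unpair1)).and
        ((DN.eq (h2.beta h0.unpair2) h1).and ?_))
      refine DN.all1 (P := fun (v : (Unit ⊕ Unit) ⊕ Unit → ℕ) i =>
        i < (v (Sum.inl (Sum.inl ()))).unpair.2 → Nat.beta (v (Sum.inr ())) (i + 1) =
          g (Nat.pair (v (Sum.inl (Sum.inl ()))).unpair.1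
            (Nat.pair i (Nat.beta (v (Sum.inr ())) i)))) ?_
      exact (DN.lt hi h0.unpair2.weak).imp (DN.eq (h2.weak.beta (hi.add DNf.one))
        (ih2 (h0.unpair1.weak.pair (hi.pair (h2.weak.beta hi)))))
    refine key.congr fun v => ?_
    set z := (v (Sum.inl ())).unpair.1
    set n := (v (Sum.inl ())).unpair.2
    change _ ↔ Nat.rec (f z) (fun y IH => g (Nat.pair z (Nat.pair y IH))) n = v (Sum.inr ())
    set s : ℕ → ℕ := fun n => Nat.rec (f z) (fun y IH => g (Nat.pair z (Nat.pair y IH))) n with hs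
    constructor
    · rintro ⟨c, e0, e1, e2⟩
      rw [← e1]
      have : ∀ i ≤ n, Nat.beta c i = s i := by
        intro i
        induction i with
        | zero => exact fun _ => e0
        | succ i ih =>
          intro hi
          rw [e2 i (by omega), ih (by omega)]
      exact (this n le_rfl).symm
    · intro e
      obtain ⟨c, hc⟩ := exists_beta s n
      refine ⟨c, hc 0 (Nat.zero_le _), (hc n le_rfl).trans e, fun i hi => ?_⟩
      rw [hc _ hi, hc _ hi.le]

theorem arReducible_iff {X : Set ℕ} :
    ArReducible X Y ↔ DN (α := Unit) Y (fun v => v () ∈ X) := by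
  let _ := arithStructure Y
  constructor
  · rintro ⟨φ, rfl⟩
    refine ⟨φ.relabel (fun _ => Sum.inr ()), fun _ v => ?_⟩
    rw [Formula.realize_relabel]
    rfl
  · rintro ⟨φ, h⟩
    refine ⟨φ.relabel (Sum.elim Empty.elim fun _ => 0), ?_⟩
    ext n
    rw [Set.mem_ofPred_eq, Formula.realize_relabel]
    refine (h () (fun _ => n)).symm.trans (iff_of_eq (congrArg _ ?_))
    ext x
    rcases x with x | x
    · exact x.elim
    · rfl

end

/-- Definability is transitive in the oracle. -/
theorem DN.trans {Y Z : Set ℕ} (h : ArReducible Z Y) {α : Type} {P : (α → ℕ) → Prop}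
    (hP : DN Z P) : DN Y P := by
  rw [arReducible_iff] at h
  obtain ⟨φ, hφ⟩ := hP
  have ht : ∀ {β : Type} (t : arithLang.Term β),
      DNf Y (fun v : β → ℕ => @Term.realize arithLang ℕ (arithStructure Z) _ v t) := by
    intro β t
    induction t with
    | var a => exact DNf.var a
    | func f ts ih =>
      cases f with
      | zero => exact DNf.zero
      | one => exact DNf.one
      | add => exact (ih 0).add (ih 1)
      | mul => exact (ih 0).mul (ih 1)
  have hb : ∀ {β : Type} {n : ℕ} (ψ : arithLang.BoundedFormula β n),
      DN Y (fun v : β ⊕ Fin n → ℕ => @BoundedFormula.Realize arithLang ℕ (arithStructure Z) _ _ ψ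
        (fun b => v (Sum.inl b)) (fun i => v (Sum.inr i))) := by
    intro β n ψ
    induction ψ with
    | falsum => exact UDf.false
    | equal t₁ t₂ =>
      refine (DN.eq (ht t₁) (ht t₂)).congr fun v => ?_
      unfold BoundedFormula.Realize
      rw [show Sum.elim (fun b => v (Sum.inl b)) (fun i => v (Sum.inr i)) = v from by
        ext x; rcases x with x | x <;> rfl]
    | rel R ts =>
      cases R with
      | lt =>
        refine (DN.lt (ht (ts 0)) (ht (ts 1))).congr fun v => ?_
        unfold BoundedFormula.Realize
        rw [show Sum.elim (fun b => v (Sum.inl b)) (fun i => v (Sum.inr i)) = v from by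
          ext x; rcases x with x | x <;> rfl]
        rfl
      | mem =>
        refine (DN.comp1 h (ht (ts 0))).congr fun v => ?_
        unfold BoundedFormula.Realize
        rw [show Sum.elim (fun b => v (Sum.inl b)) (fun i => v (Sum.inr i)) = v from by
          ext x; rcases x with x | x <;> rfl]
        rfl
    | imp _ _ ih1 ih2 => exact ih1.imp ih2
    | @all n ψ ih =>
      refine (DN.all1 (P := fun v x => @BoundedFormula.Realize arithLang ℕ (arithStructure Z) _ _ ψ
        (fun b => v (Sum.inl b)) (Fin.snoc (fun i => v (Sum.inr i)) x)) ?_).congr fun v => ?_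
      · refine (ih.comp (Sum.elim (fun b => Sum.inl (Sum.inl b))
          (Fin.snoc (α := fun _ => (β ⊕ Fin n) ⊕ Unit)
            (fun i => Sum.inl (Sum.inr i)) (Sum.inr ())))).congr fun v => ?_
        refine iff_of_eq (congrArg _ ?_)
        ext i
        refine Fin.lastCases ?_ (fun i => ?_) i <;> simp
      · rfl
  have h1 := hb φ
  have h2 : DN Y (fun v : Empty ⊕ α → ℕ =>
      @Formula.Realize arithLang ℕ (arithStructure Z) _ φ v) := by
    refine (h1.comp (Sum.elim id Fin.elim0)).congr fun v => ?_
    unfold Formula.Realize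
    refine iff_of_eq (congrArg _ ?_)
    ext i
    exact i.elim0
  have h3 := UDf.subst h2 (A := fun _ : Unit => natPt Y) (α := α) id
  refine UDf.congr h3 fun _ v => ?_
  refine Iff.trans (iff_of_eq (congrArg _ ?_)) (hφ () v)
  ext x
  rcases x with x | x <;> rfl

/-! ## Arithmetical predicates and functions on primitively codable types -/

/-- A predicate arithmetical in `Y`. -/
def Ar (Y : Set ℕ) {α : Type} [Primcodable α] (p : α → Prop) : Prop :=
  DN (α := Unit) Y (fun v => ∃ a, a ∈ (Encodable.decode (v ()) : Option α) ∧ p a)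

/-- A function with graph arithmetical in `Y`. -/
@[fun_prop]
def ArF (Y : Set ℕ) {α β : Type} [Primcodable α] [Primcodable β] (f : α → β) : Prop :=
  Ar Y (fun x : α × β => f x.1 = x.2)

section
variable {Y : Set ℕ} {α β γ δ : Type} [Primcodable α] [Primcodable β] [Primcodable γ]
  [Primcodable δ] {p q : α → Prop}

theorem Ar.congr (h : Ar Y p) (e : ∀ a, p a ↔ q a) : Ar Y q := by
  have : p = q := funext fun a => propext (e a)
  rwa [← this]

theorem Ar.comp {p : β → Prop} (h : Ar Y p) {f : α → β} (hf : Primrec f) :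
    Ar Y (fun a => p (f a)) := by
  have h1 : DNf (α := Unit) Y (fun v =>
      Encodable.encode ((Encodable.decode (v ()) : Option α).map f)) :=
    DNf.of_primrec (f := fun v : Unit → ℕ => v ()) hf (DNf.var ())
  refine (DN.ex1 (P := fun (v : Unit → ℕ) m =>
    Encodable.encode ((Encodable.decode (v ()) : Option α).map f) = m + 1 ∧
    ∃ b, b ∈ (Encodable.decode m : Option β) ∧ p b)
    ((DN.eq h1.weak ((DNf.var _).add DNf.one)).and (DN.comp h fun _ => Sum.inr ()))).congr fun v => ?_
  rcases hd : (Encodable.decode (v ()) : Option α) with _ | a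
  · simp
  · simp only [Option.map_some, Encodable.encode_some]
    constructor
    · rintro ⟨m, hm, b, hb, hp⟩
      obtain rfl : Encodable.encode (f a) = m := Nat.succ_injective hm
      rw [Encodable.encodek] at hb
      obtain rfl : f a = b := Option.some_injective _ hb
      exact ⟨a, rfl, hp⟩
    · rintro ⟨a', ha, hp⟩
      obtain rfl : a = a' := Option.some_injective _ ha
      exact ⟨_, rfl, f a, by simp, hp⟩

theorem Ar.and (h : Ar Y p) (h' : Ar Y q) : Ar Y (fun a => p a ∧ q a) := by
  refine (DN.and h h').congr fun v => ?_
  rcases (Encodable.decode (v ()) : Option α) with _ | a <;> simp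

theorem Ar.dom : DN (α := Unit) Y (fun v => ∃ a, a ∈ (Encodable.decode (v ()) : Option α)) := by
  have h1 : DNf (α := Unit) Y (fun v => Encodable.encode (Encodable.decode (v ()) : Option α)) :=
    DNf.of_primrec (f := fun v : Unit → ℕ => v ()) (Primcodable.prim (α := α)) (DNf.var ())
  refine (DN.lt DNf.zero h1).congr fun v => ?_
  rcases (Encodable.decode (v ()) : Option α) with _ | a <;> simp

theorem Ar.not (h : Ar Y p) : Ar Y (fun a => ¬ p a) := by
  refine (DN.and (Ar.dom (α := α)) (DN.not h)).congr fun v => ?_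
  rcases (Encodable.decode (v ()) : Option α) with _ | a <;> simp

theorem Ar.or (h : Ar Y p) (h' : Ar Y q) : Ar Y (fun a => p a ∨ q a) :=
  (h.not.and h'.not).not.congr fun a => by tauto

theorem Ar.imp (h : Ar Y p) (h' : Ar Y q) : Ar Y (fun a => p a → q a) :=
  (h.not.or h').congr fun a => by tauto

theorem Ar.iff (h : Ar Y p) (h' : Ar Y q) : Ar Y (fun a => p a ↔ q a) :=
  ((h.imp h').and (h'.imp h)).congr fun a => by tauto

theorem Ar.ex {p : α → β → Prop} (h : Ar Y fun x : α × β => p x.1 x.2) :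
    Ar Y (fun a => ∃ b, p a b) := by
  refine (DN.ex1 (P := fun (v : Unit → ℕ) m =>
    ∃ a, a ∈ (Encodable.decode (Nat.pair (v ()) m) : Option (α × β)) ∧ p a.1 a.2)
    (DN.comp1 (p := fun k => ∃ a, a ∈ (Encodable.decode k : Option (α × β)) ∧ p a.1 a.2) h
      ((DNf.var _).pair (DNf.var _)))).congr fun v => ?_
  constructor
  · rintro ⟨m, ⟨a, b⟩, ha, hp⟩
    rw [Encodable.decode_prod_val] at ha
    simp only [Nat.unpair_pair, Option.mem_def] at ha
    rcases hd : (Encodable.decode (v ()) : Option α) with _ | a'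
    · simp [hd] at ha
    · rcases hd' : (Encodable.decode m : Option β) with _ | b'
      · simp [hd, hd'] at ha
      · simp only [hd, hd', Option.bind_some, Option.map_some, Option.some.injEq,
          Prod.mk.injEq] at ha
        obtain ⟨rfl, rfl⟩ := ha
        exact ⟨a', rfl, _, hp⟩
  · rintro ⟨a, ha, b, hp⟩
    refine ⟨Encodable.encode b, (a, b), ?_, hp⟩
    rw [Encodable.decode_prod_val]
    simp only [Nat.unpair_pair, Option.mem_def]
    rw [Option.mem_def.1 ha]
    simp

theorem Ar.all {p : α → β → Prop} (h : Ar Y fun x : α × β => p x.1 x.2) :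
    Ar Y (fun a => ∀ b, p a b) :=
  (Ar.ex (p := fun a b => ¬ p a b) h.not).not.congr fun a => by simp

theorem Ar.const (c : Prop) : Ar Y (fun _ : α => c) := by
  by_cases hc : c
  · refine (Ar.dom (α := α)).congr fun v => ?_
    simp [hc]
  · refine (DN.lt (α := Unit) (f := fun _ => 0) (g := fun _ => 0) DNf.zero DNf.zero).congr
      fun v => ?_
    simp [hc]

theorem Ar.of_nat {p : ℕ → Prop} : Ar Y p ↔ DN (α := Unit) Y (fun v => p (v ())) := by
  constructor <;> intro h <;> refine DN.congr h fun v => ?_ <;> simp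

theorem Ar.arReducible {X : Set ℕ} : Ar Y (fun n => n ∈ X) ↔ ArReducible X Y := by
  rw [Ar.of_nat, arReducible_iff]

theorem Ar.oracle : Ar Y (fun n => n ∈ Y) := Ar.of_nat.2 (DN.mem (DNf.var ()))

theorem Ar.trans {Z : Set ℕ} (h : ArReducible Z Y) (hp : Ar Z p) : Ar Y p := DN.trans h hp

theorem Ar.mono (hp : Ar ∅ p) : Ar Y p :=
  Ar.trans (Ar.arReducible.1 ((Ar.const False).congr fun a => by simp)) hp

theorem Ar.eqv : Ar Y (fun x : α × α => x.1 = x.2) := by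
  have : Ar Y (fun x : ℕ × ℕ => x.1 = x.2) := by
    have h : DN (α := Unit) Y (fun v => (v ()).unpair.1 = (v ()).unpair.2) :=
      DN.eq (DNf.unpair1 (DNf.var _)) (DNf.unpair2 (DNf.var _))
    exact DN.congr h fun v => by simp
  refine (this.comp (f := fun x : α × α => (Encodable.encode x.1, Encodable.encode x.2))
    ((Primrec.encode.comp Primrec.fst).pair (Primrec.encode.comp Primrec.snd))).congr fun a => ?_
  exact Encodable.encode_inj

theorem ArF.of_primrec {f : α → β} (hf : Primrec f) : ArF Y f :=
  (Ar.eqv (α := β)).comp ((hf.comp Primrec.fst).pair Primrec.snd)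

@[fun_prop]
theorem ArF.id : ArF Y (fun a : α => a) := ArF.of_primrec Primrec.id

@[fun_prop]
theorem ArF.const (b : β) : ArF Y (fun _ : α => b) := ArF.of_primrec (Primrec.const b)

theorem Ar.compF {p : β → Prop} (h : Ar Y p) {f : α → β} (hf : ArF Y f) :
    Ar Y (fun a => p (f a)) :=
  (Ar.ex (p := fun a b => f a = b ∧ p b) (Ar.and hf (h.comp Primrec.snd))).congr fun a => by simp

@[fun_prop]
theorem ArF.comp {g : β → γ} {f : α → β} (hg : ArF Y g) (hf : ArF Y f) :
    ArF Y (fun a => g (f a)) := by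
  refine (Ar.ex (p := fun (x : α × γ) b => f x.1 = b ∧ g b = x.2) (Ar.and ?_ ?_)).congr fun a => ?_
  · exact Ar.comp hf ((Primrec.fst.comp Primrec.fst).pair Primrec.snd)
  · exact Ar.comp hg (Primrec.snd.pair (Primrec.snd.comp Primrec.fst))
  · simp

@[fun_prop]
theorem ArF.prodMk {f : α → β} {g : α → γ} (hf : ArF Y f) (hg : ArF Y g) :
    ArF Y (fun a => (f a, g a)) := by
  refine Ar.congr (p := fun x : α × β × γ => f x.1 = x.2.1 ∧ g x.1 = x.2.2) (Ar.and ?_ ?_) ?_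
  · exact Ar.comp hf (Primrec.fst.pair (Primrec.fst.comp Primrec.snd))
  · exact Ar.comp hg (Primrec.fst.pair (Primrec.snd.comp Primrec.snd))
  · rintro ⟨a, b, c⟩
    simp

@[fun_prop]
theorem ArF.fst {f : α → β × γ} (hf : ArF Y f) : ArF Y (fun a => (f a).1) :=
  (ArF.of_primrec Primrec.fst).comp hf

@[fun_prop]
theorem ArF.snd {f : α → β × γ} (hf : ArF Y f) : ArF Y (fun a => (f a).2) :=
  (ArF.of_primrec Primrec.snd).comp hf

theorem ArF.of_primrec₂ {u : β → γ → δ} (hu : Primrec₂ u) {f : α → β} {g : α → γ}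
    (hf : ArF Y f) (hg : ArF Y g) : ArF Y (fun a => u (f a) (g a)) :=
  (ArF.of_primrec hu).comp (hf.prodMk hg)

theorem ArF.mono {f : α → β} (h : ArF ∅ f) : ArF Y f := Ar.mono h

theorem ArF.congr {f g : α → β} (h : ArF Y f) (e : ∀ a, f a = g a) : ArF Y g := by
  have : f = g := funext e
  rwa [← this]

theorem Ar.eq {f g : α → β} (hf : ArF Y f) (hg : ArF Y g) : Ar Y (fun a => f a = g a) :=
  (Ar.eqv (α := β)).compF (hf.prodMk hg)

theorem Ar.lt {f g : α → ℕ} (hf : ArF Y f) (hg : ArF Y g) : Ar Y (fun a => f a < g a) := by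
  have : Ar Y (fun x : ℕ × ℕ => x.1 < x.2) := by
    have h : DN (α := Unit) Y (fun v => (v ()).unpair.1 < (v ()).unpair.2) :=
      DN.lt (DNf.unpair1 (DNf.var _)) (DNf.unpair2 (DNf.var _))
    exact DN.congr h fun v => by simp
  exact this.compF (hf.prodMk hg)

theorem Ar.le {f g : α → ℕ} (hf : ArF Y f) (hg : ArF Y g) : Ar Y (fun a => f a ≤ g a) :=
  (Ar.lt hg hf).not.congr fun a => by simp

@[fun_prop]
theorem ArF.add {f g : α → ℕ} (hf : ArF Y f) (hg : ArF Y g) : ArF Y (fun a => f a + g a) :=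
  ArF.of_primrec₂ Primrec.nat_add hf hg

@[fun_prop]
theorem ArF.mul {f g : α → ℕ} (hf : ArF Y f) (hg : ArF Y g) : ArF Y (fun a => f a * g a) :=
  ArF.of_primrec₂ Primrec.nat_mul hf hg

@[fun_prop]
theorem ArF.sub {f g : α → ℕ} (hf : ArF Y f) (hg : ArF Y g) : ArF Y (fun a => f a - g a) :=
  ArF.of_primrec₂ Primrec.nat_sub hf hg

@[fun_prop]
theorem ArF.natPair {f g : α → ℕ} (hf : ArF Y f) (hg : ArF Y g) :
    ArF Y (fun a => Nat.pair (f a) (g a)) :=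
  ArF.of_primrec₂ Primrec₂.natPair hf hg

@[fun_prop]
theorem ArF.unpair {f : α → ℕ} (hf : ArF Y f) : ArF Y (fun a => Nat.unpair (f a)) :=
  (ArF.of_primrec Primrec.unpair).comp hf

@[fun_prop]
theorem ArF.encode {f : α → β} (hf : ArF Y f) : ArF Y (fun a => Encodable.encode (f a)) :=
  (ArF.of_primrec Primrec.encode).comp hf

@[fun_prop]
theorem ArF.some {f : α → β} (hf : ArF Y f) : ArF Y (fun a => some (f a)) :=
  (ArF.of_primrec Primrec.option_some).comp hf

@[fun_prop]
theorem ArF.cons {f : α → β} {l : α → List β} (hf : ArF Y f) (hl : ArF Y l) :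
    ArF Y (fun a => f a :: l a) :=
  ArF.of_primrec₂ Primrec.list_cons hf hl

@[fun_prop]
theorem ArF.append {f : α → List β} {l : α → List β} (hf : ArF Y f) (hl : ArF Y l) :
    ArF Y (fun a => f a ++ l a) :=
  ArF.of_primrec₂ Primrec.list_append hf hl

@[fun_prop]
theorem ArF.length {l : α → List β} (hl : ArF Y l) : ArF Y (fun a => (l a).length) :=
  (ArF.of_primrec Primrec.list_length).comp hl

@[fun_prop]
theorem ArF.range {l : α → ℕ} (hl : ArF Y l) : ArF Y (fun a => List.range (l a)) :=
  (ArF.of_primrec Primrec.list_range).comp hl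

@[fun_prop]
theorem ArF.getElem? {l : α → List β} {n : α → ℕ} (hl : ArF Y l) (hn : ArF Y n) :
    ArF Y (fun a => (l a)[n a]?) :=
  ArF.of_primrec₂ Primrec.list_getElem? hl hn

@[fun_prop]
theorem ArF.getD {l : α → List β} {n : α → ℕ} {d : β} (hl : ArF Y l) (hn : ArF Y n) :
    ArF Y (fun a => (l a).getD (n a) d) :=
  ArF.of_primrec₂ (Primrec.list_getD d) hl hn

@[fun_prop]
theorem ArF.take {l : α → List β} {n : α → ℕ} (hl : ArF Y l) (hn : ArF Y n) :
    ArF Y (fun a => (l a).take (n a)) :=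
  ArF.of_primrec₂ Primrec.list_take hn hl

theorem Ar.ite {f g : α → β} (hp : Ar Y p) [DecidablePred p] (hf : ArF Y f) (hg : ArF Y g) :
    ArF Y (fun a => if p a then f a else g a) := by
  refine Ar.congr (p := fun x : α × β => (p x.1 ∧ f x.1 = x.2) ∨ (¬ p x.1 ∧ g x.1 = x.2)) ?_ ?_
  · exact ((hp.comp Primrec.fst).and hf).or ((hp.comp Primrec.fst).not.and hg)
  · intro x
    by_cases h : p x.1 <;> simp [h]

/-- Arithmetical selection of witnesses. -/
theorem Ar.choose [Inhabited β] {p : α → β → Prop} (h : Ar Y fun x : α × β => p x.1 x.2) :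
    ∃ f : α → β, ArF Y f ∧ ∀ a, (∃ b, p a b) → p a (f a) := by
  classical
  let least (a : α) (b : β) : Prop :=
    p a b ∧ ∀ c, Encodable.encode c < Encodable.encode b → ¬ p a c
  have hex : ∀ a, (∃ b, p a b) → ∃ b, least a b := by
    rintro a ⟨b, hb⟩
    obtain ⟨b', hb', hm⟩ := (InvImage.wf (Encodable.encode : β → ℕ) Nat.lt_wfRel.wf).has_min
      {b | p a b} ⟨b, hb⟩
    exact ⟨b', hb', fun c hc hp => hm c hp hc⟩
  have hun : ∀ a b b', least a b → least a b' → b = b' := by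
    intro a b b' hb hb'
    have h1 := fun hc => hb.2 b' hc hb'.1
    have h2 := fun hc => hb'.2 b hc hb.1
    exact Encodable.encode_injective
      (le_antisymm (not_lt.1 fun hc => h1 hc) (not_lt.1 fun hc => h2 hc))
  let f (a : α) : β := if h : ∃ b, p a b then (hex a h).choose else default
  have hf : ∀ a, (∃ b, p a b) → least a (f a) := by
    intro a ha
    simp only [f, dif_pos ha]
    exact (hex a ha).choose_spec
  refine ⟨f, ?_, fun a ha => (hf a ha).1⟩
  have hl : Ar Y (fun x : α × β => least x.1 x.2) := by
    refine h.and (Ar.all (p := fun (x : α × β) c =>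
      Encodable.encode c < Encodable.encode x.2 → ¬ p x.1 c) (Ar.imp ?_ (Ar.not ?_)))
    · exact Ar.lt (by fun_prop) (by fun_prop)
    · exact h.compF (f := fun x : (α × β) × β => (x.1.1, x.2)) (by fun_prop)
  have hx : Ar Y (fun x : α × β => ∃ b, p x.1 b) := (Ar.ex h).comp Primrec.fst
  refine (((hx.and hl).or (hx.not.and (Ar.eq (f := fun x : α × β => x.2)
    (g := fun _ => (default : β)) (by fun_prop) (by fun_prop))))).congr fun x => ?_
  by_cases hx : ∃ b, p x.1 b
  · simp only [hx, true_and, not_true, false_and, or_false]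
    exact ⟨fun h => hun _ _ _ (hf _ hx) h, fun h => h ▸ hf _ hx⟩
  · have : f x.1 = default := dif_neg hx
    simp only [hx, false_and, not_false_iff, true_and, false_or, this]
    exact eq_comm

/-- The history of a course-of-values recursion. -/
def hist {α β : Type} (G : α → List β → β) (a : α) : ℕ → List β
  | 0 => []
  | n + 1 => hist G a n ++ [G a (hist G a n)]

theorem hist_length {α β : Type} (G : α → List β → β) (a : α) (n : ℕ) :
    (hist G a n).length = n := by
  induction n with
  | zero => rfl
  | succ n ih => simp [hist, ih]

theorem hist_take {α β : Type} (G : α → List β → β) (a : α) {m n : ℕ} (h : m ≤ n) :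
    (hist G a n).take m = hist G a m := by
  induction n with
  | zero => obtain rfl : m = 0 := by omega
            rfl
  | succ n ih =>
    rcases Nat.lt_or_ge n m with h' | h'
    · obtain rfl : m = n + 1 := by omega
      exact List.take_of_length_le (by rw [hist_length])
    · rw [hist, List.take_append_of_le_length (by rw [hist_length]; exact h'), ih h']

theorem hist_getElem? {α β : Type} (G : α → List β → β) (a : α) {m n : ℕ} (h : m < n) :
    (hist G a n)[m]? = Option.some (G a (hist G a m)) := by
  have h1 := hist_take G a (Nat.succ_le_of_lt h)
  have : (List.take (m + 1) (hist G a n))[m]? = (hist G a n)[m]? := by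
    rw [List.getElem?_take]; simp
  rw [← this, h1, hist]
  rw [List.getElem?_append_right (by rw [hist_length])]
  simp [hist_length]

theorem ArF.hist {G : α → List β → β} (hG : ArF Y fun x : α × List β => G x.1 x.2) :
    ArF Y (fun x : α × ℕ => hist G x.1 x.2) := by
  refine Ar.congr (p := fun x : (α × ℕ) × List β => x.2.length = x.1.2 ∧
    ∀ i b, x.2[i]? = Option.some b → G x.1.1 (x.2.take i) = b) (Ar.and ?_ ?_) ?_
  · exact Ar.eq (by fun_prop) (by fun_prop)
  · refine Ar.all (p := fun (x : (α × ℕ) × List β) i => ∀ b,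
      x.2[i]? = Option.some b → G x.1.1 (x.2.take i) = b) ?_
    refine Ar.all (p := fun (x : ((α × ℕ) × List β) × ℕ) b =>
      x.1.2[x.2]? = Option.some b → G x.1.1.1 (x.1.2.take x.2) = b) ?_
    refine Ar.imp (Ar.eq (by fun_prop) (by fun_prop)) (Ar.eq ?_ (by fun_prop))
    exact hG.comp (f := fun x : (((α × ℕ) × List β) × ℕ) × β => (x.1.1.1.1, x.1.1.2.take x.1.2))
      (by fun_prop)
  · rintro ⟨⟨a, n⟩, l⟩
    simp only
    constructor
    · rintro ⟨rfl, h⟩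
      induction l using List.reverseRecOn with
      | nil => rfl
      | append_singleton l b ih =>
        have h1 : ArMorley.hist G a l.length = l := by
          refine ih fun i b' hb => ?_
          have hi : i < l.length := (List.getElem?_eq_some_iff.1 hb).1
          have := h i b' (by rw [List.getElem?_append_left hi, hb])
          rwa [List.take_append_of_le_length hi.le] at this
        have h2 := h l.length b (by simp)
        rw [List.take_append_of_le_length le_rfl, List.take_length] at h2
        rw [List.length_append, List.length_singleton, ArMorley.hist, h1, h2]
    · rintro rfl
      refine ⟨hist_length _ _ _, fun i b hb => ?_⟩
      have hi : i < n := by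
        have := (List.getElem?_eq_some_iff.1 hb).1
        rwa [hist_length] at this
      rw [hist_getElem? G a hi] at hb
      rw [hist_take G a hi.le]
      exact Option.some_injective _ hb

/-- Course-of-values recursion with arithmetical selection at every step. -/
theorem Ar.recursion [Inhabited β] {p : α → List β → β → Prop}
    (h : Ar Y fun x : (α × List β) × β => p x.1.1 x.1.2 x.2) :
    ∃ F : α → ℕ → β, ArF Y (fun x : α × ℕ => F x.1 x.2) ∧
      ArF Y (fun x : α × ℕ => (List.range x.2).map (F x.1)) ∧
      ∀ a n, (∃ b, p a ((List.range n).map (F a)) b) → p a ((List.range n).map (F a)) (F a n) := by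
  obtain ⟨G, hG, hp⟩ := Ar.choose (p := fun (x : α × List β) b => p x.1 x.2 b) h
  let G' : α → List β → β := fun a l => G (a, l)
  have hH : ArF Y (fun x : α × ℕ => ArMorley.hist G' x.1 x.2) := ArF.hist (G := G') hG
  have hr : ∀ a n, (List.range n).map (fun i => G' a (ArMorley.hist G' a i)) =
      ArMorley.hist G' a n := by
    intro a n
    induction n with
    | zero => rfl
    | succ n ih => rw [List.range_succ, List.map_append, ih]; rfl
  refine ⟨fun a n => G' a (ArMorley.hist G' a n), ?_, ?_, ?_⟩
  · exact hG.comp (f := fun x : α × ℕ => (x.1, ArMorley.hist G' x.1 x.2)) (by fun_prop)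
  · exact hH.congr fun x => (hr _ _).symm
  · intro a n hb
    rw [hr] at hb ⊢
    exact hp (a, _) hb

theorem ArF.map {f : α → β → γ} {l : α → List β} (hf : ArF Y fun x : α × β => f x.1 x.2)
    (hl : ArF Y l) : ArF Y (fun a => (l a).map (f a)) := by
  refine Ar.congr (p := fun x : α × List γ => x.2.length = (l x.1).length ∧
    ∀ (i : ℕ) b c, (l x.1)[i]? = Option.some b → x.2[i]? = Option.some c → f x.1 b = c)
    (Ar.and (Ar.eq (by fun_prop) (by fun_prop)) ?_) ?_
  · refine Ar.all (p := fun (x : α × List γ) (i : ℕ) => ∀ b c,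
      (l x.1)[i]? = Option.some b → x.2[i]? = Option.some c → f x.1 b = c) ?_
    refine Ar.all (p := fun (x : (α × List γ) × ℕ) b => ∀ c,
      (l x.1.1)[x.2]? = Option.some b → x.1.2[x.2]? = Option.some c → f x.1.1 b = c) ?_
    refine Ar.all (p := fun (x : ((α × List γ) × ℕ) × β) c =>
      (l x.1.1.1)[x.1.2]? = Option.some x.2 → x.1.1.2[x.1.2]? = Option.some c →
      f x.1.1.1 x.2 = c) ?_
    refine Ar.imp (Ar.eq (by fun_prop) (by fun_prop)) (Ar.imp (Ar.eq (by fun_prop) (by fun_prop))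
      (Ar.eq ?_ (by fun_prop)))
    exact hf.comp (f := fun x : (((α × List γ) × ℕ) × β) × γ => (x.1.1.1.1, x.1.2)) (by fun_prop)
  · rintro ⟨a, m⟩
    simp only
    constructor
    · rintro ⟨e, h⟩
      refine List.ext_getElem (by simp [e]) fun i h1 h2 => ?_
      rw [List.getElem_map]
      exact h i _ _ (List.getElem?_eq_getElem (by simpa using h1)) (List.getElem?_eq_getElem h2)
    · rintro rfl
      refine ⟨by simp, fun i b c hb hc => ?_⟩
      rw [List.getElem?_map, hb] at hc
      exact Option.some_injective _ hc

/-- Membership in a list. -/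
theorem Ar.memList {f : α → β} {l : α → List β} (hf : ArF Y f) (hl : ArF Y l) :
    Ar Y (fun a => f a ∈ l a) := by
  refine (Ar.ex (p := fun a (i : ℕ) => (l a)[i]? = Option.some (f a))
    (Ar.eq (by fun_prop) (by fun_prop))).congr fun a => ?_
  exact List.mem_iff_getElem?.symm

theorem Ar.finite {p : α → ℕ → Prop} (h : Ar Y fun x : α × ℕ => p x.1 x.2) :
    Ar Y (fun a => {n | p a n}.Finite) := by
  refine (Ar.ex (p := fun a b => ∀ n, p a n → n ≤ b) (Ar.all (p := fun (x : α × ℕ) n =>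
    p x.1 n → n ≤ x.2) (Ar.imp ?_ (Ar.le (by fun_prop) (by fun_prop))))).congr fun a => ?_
  · exact h.compF (f := fun x : (α × ℕ) × ℕ => (x.1.1, x.2)) (by fun_prop)
  · constructor
    · rintro ⟨b, hb⟩
      exact (Set.finite_le_nat b).subset hb
    · intro hf
      obtain ⟨b, hb⟩ := hf.bddAbove
      exact ⟨b, fun n hn => hb hn⟩

end

/-! ## Codes of formulas and satisfaction -/

section
variable {L : FirstOrder.Language}

instance codedStruc (M : CodedStructure L) : L.Structure M.carrier := M.struc

theorem termCode_injective (g : GoedelCoding L) {α : Type} {encα : α → ℕ}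
    (h : Function.Injective encα) : Function.Injective (termCode g encα) := by
  intro t t' e
  refine Term.listEncode_injective (Function.Injective.list_map ?_ (Encodable.encode_injective e))
  rintro (a | ⟨k, f⟩) (b | ⟨k', f'⟩) e <;> simp only [Sum.elim_inl, Sum.elim_inr,
    Nat.pair_eq_pair] at e
  · rw [h e.2]
  · exact absurd e.1 (by decide)
  · exact absurd e.1 (by decide)
  · obtain ⟨-, rfl, e⟩ := e
    rw [g.encFun_inj _ e]

theorem formulaCode_injective (g : GoedelCoding L) {α : Type} {encα : α → ℕ}
    (h : Function.Injective encα) {n : ℕ} :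
    Function.Injective (formulaCode g encα : L.BoundedFormula α n → ℕ) := by
  intro φ φ' e
  have : φ.listEncode = φ'.listEncode := by
    refine Function.Injective.list_map ?_ (Encodable.encode_injective e)
    rintro (⟨k, t⟩ | ⟨k, R⟩ | m) (⟨k', t'⟩ | ⟨k', R'⟩ | m') e <;>
      simp only [Sum.elim_inl, Sum.elim_inr, Nat.pair_eq_pair] at e
    · obtain ⟨-, rfl, e⟩ := e
      refine congrArg Sum.inl (congrArg (Sigma.mk k) (termCode_injective g ?_ e))
      rintro (a | a) (b | b) e <;> simp only [Sum.elim_inl, Sum.elim_inr, Nat.pair_eq_pair] at e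
      · rw [h e.2]
      · exact absurd e.1 (by decide)
      · exact absurd e.1 (by decide)
      · rw [Fin.ext e.2]
    all_goals try exact absurd e.1 (by decide)
    · obtain ⟨-, rfl, e⟩ := e
      rw [g.encRel_inj _ e]
    · rw [e.2]
  have h2 := BoundedFormula.listEncode_sigma_injective (L := L) (α := α)
    (a₁ := ⟨n, φ⟩) (a₂ := ⟨n, φ'⟩) this
  exact eq_of_heq (Sigma.mk.inj h2).2

/-- The code of a formula together with its number of variables. -/
def fc (g : GoedelCoding L) {k : ℕ} (φ : L.Formula (Fin k)) : ℕ :=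
  Nat.pair k (formulaCode g Fin.val φ)

/-- The values of a tuple. -/
def vals {A : Set ℕ} {k : ℕ} (a : Fin k → A) : List ℕ := List.ofFn fun i => (a i : ℕ)

theorem vals_injective {A : Set ℕ} {k : ℕ} : Function.Injective (vals : (Fin k → A) → List ℕ) := by
  intro a b e
  have := List.ofFn_injective e
  exact funext fun i => Subtype.ext (congrFun this i)

@[simp] theorem vals_length {A : Set ℕ} {k : ℕ} (a : Fin k → A) : (vals a).length = k := by
  simp [vals]

theorem vals_cons {A : Set ℕ} {k : ℕ} (x : A) (a : Fin k → A) :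
    vals (Fin.cons x a) = (x : ℕ) :: vals a := by
  simp [vals, List.ofFn_succ]

theorem vals_append {A : Set ℕ} {k m : ℕ} (a : Fin k → A) (b : Fin m → A) :
    vals (Fin.append a b) = vals a ++ vals b := by
  unfold vals
  rw [← List.ofFn_fin_append]
  congr 1
  funext i
  refine Fin.addCases (fun j => ?_) (fun j => ?_) i <;> simp

theorem exists_vals {A : Set ℕ} (l : List ℕ) (h : ∀ x ∈ l, x ∈ A) :
    ∃ a : Fin l.length → A, vals a = l :=
  ⟨fun i => ⟨l[i], h _ (List.getElem_mem _)⟩, List.ofFn_getElem⟩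

theorem exists_vals' {A : Set ℕ} {k : ℕ} (l : List ℕ) (hk : l.length = k) (h : ∀ x ∈ l, x ∈ A) :
    ∃ a : Fin k → A, vals a = l := by
  subst hk
  exact exists_vals l h

/-- Satisfaction of coded formulas by lists of elements. -/
def Sat (g : GoedelCoding L) (M : CodedStructure L) (c : ℕ) (l : List ℕ) : Prop :=
  ∃ (k : ℕ) (φ : L.Formula (Fin k)) (a : Fin k → M.carrier), c = fc g φ ∧ l = vals a ∧ φ.Realize a

variable {g : GoedelCoding L} {M N : CodedStructure L}

theorem sat_iff_mem {c : ℕ} {l : List ℕ} :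
    Sat g M c l ↔ Nat.pair c (Encodable.encode l) ∈ elemDiagram g M := by
  constructor
  · rintro ⟨k, φ, a, rfl, rfl, h⟩
    exact ⟨k, φ, a, rfl, h⟩
  · rintro ⟨k, φ, a, e, h⟩
    rw [Nat.pair_eq_pair] at e
    exact ⟨k, φ, a, e.1, Encodable.encode_injective e.2, h⟩

theorem sat_iff {k : ℕ} {φ : L.Formula (Fin k)} {a : Fin k → M.carrier} :
    Sat g M (fc g φ) (vals a) ↔ φ.Realize a := by
  constructor
  · rintro ⟨k', φ', a', e, e', h⟩
    rw [fc, fc, Nat.pair_eq_pair] at e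
    obtain ⟨rfl, e⟩ := e
    rwa [formulaCode_injective g Fin.val_injective e, vals_injective e']
  · exact fun h => ⟨k, φ, a, rfl, rfl, h⟩

theorem Sat.mem {c : ℕ} {l : List ℕ} (h : Sat g M c l) {x : ℕ} (hx : x ∈ l) : x ∈ M.carrier := by
  obtain ⟨k, φ, a, -, rfl, -⟩ := h
  obtain ⟨i, rfl⟩ := (List.mem_ofFn ..).1 hx
  exact (a i).2

theorem Sat.length {k : ℕ} {φ : L.Formula (Fin k)} {l : List ℕ} (h : Sat g M (fc g φ) l) :
    l.length = k := by
  obtain ⟨k', φ', a, e, rfl, -⟩ := h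
  rw [fc, fc, Nat.pair_eq_pair] at e
  simp [e.1]

theorem sat_iff' {k : ℕ} {φ : L.Formula (Fin k)} {l : List ℕ} :
    Sat g M (fc g φ) l ↔ ∃ a : Fin k → M.carrier, vals a = l ∧ φ.Realize a := by
  constructor
  · intro h
    obtain ⟨a, rfl⟩ := exists_vals' l h.length (fun x hx => h.mem hx)
    exact ⟨a, rfl, sat_iff.1 h⟩
  · rintro ⟨a, rfl, h⟩
    exact sat_iff.2 h

theorem ArithDecidable.sat (h : ArithDecidable g M) :
    Ar ∅ (fun x : ℕ × List ℕ => Sat g M x.1 x.2) :=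
  ((Ar.arReducible.2 h).compF (f := fun x : ℕ × List ℕ => Nat.pair x.1 (Encodable.encode x.2))
    (by fun_prop)).congr fun _ => sat_iff_mem.symm

theorem ArithDecidable.of_sat (h : Ar ∅ (fun x : ℕ × List ℕ => Sat g M x.1 x.2)) :
    ArithDecidable g M := by
  refine Ar.arReducible.1 ((Ar.ex (p := fun n (x : ℕ × List ℕ) =>
    n = Nat.pair x.1 (Encodable.encode x.2) ∧ Sat g M x.1 x.2) (Ar.and
    (Ar.eq (by fun_prop) (by fun_prop)) (h.comp Primrec.snd))).congr fun n => ?_)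
  constructor
  · rintro ⟨x, rfl, h⟩
    exact sat_iff_mem.1 h
  · rintro ⟨k, φ, a, e, h⟩
    exact ⟨(fc g φ, vals a), e, sat_iff.2 h⟩

/-- The inclusion of an elementary substructure. -/
def ElemSub.inc (h : ElemSub M N) (x : M.carrier) : N.carrier := ⟨x, h.subset x.2⟩

/-- The inclusion of an elementary substructure, as an elementary embedding. -/
def ElemSub.emb (h : ElemSub M N) : M.carrier ↪ₑ[L] N.carrier where
  toFun := h.inc
  map_formula' n φ a := (h.elem n φ a).symm

theorem ElemSub.realize (h : ElemSub M N) {α : Type} (φ : L.Formula α) (v : α → M.carrier) :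
    φ.Realize (fun a => h.inc (v a)) ↔ φ.Realize v :=
  h.emb.map_formula φ v

theorem ElemSub.sat (h : ElemSub M N) {c : ℕ} {l : List ℕ} (hl : ∀ x ∈ l, x ∈ M.carrier) :
    Sat g N c l ↔ Sat g M c l := by
  constructor
  · rintro ⟨k, φ, a, rfl, rfl, hr⟩
    obtain ⟨b, hb⟩ := exists_vals' (A := M.carrier) (vals a) (vals_length a) hl
    obtain rfl : a = fun i => h.inc (b i) := vals_injective hb.symm
    exact ⟨k, φ, b, rfl, hb.symm, (h.realize φ b).1 hr⟩
  · rintro ⟨k, φ, a, rfl, rfl, hr⟩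
    exact ⟨k, φ, fun i => h.inc (a i), rfl, rfl, (h.realize φ a).2 hr⟩

theorem ElemSub.models (h : ElemSub M N) {T : L.Theory} : M.Models T ↔ N.Models T := by
  refine forall₂_congr fun φ _ => ?_
  exact (h.emb.map_sentence φ)

/-- Two elementary substructures of the same structure. -/
theorem ElemSub.of_subset {M N K : CodedStructure L} (h : ElemSub M K) (h' : ElemSub N K)
    (hs : M.carrier ⊆ N.carrier) : ElemSub M N :=
  ⟨hs, fun k φ a => (h.elem k φ a).trans (h'.elem k φ (fun i => ⟨a i, hs (a i).2⟩)).symm⟩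

theorem ArithDecidable.carrier (h : ArithDecidable g M) : Ar ∅ (fun x => x ∈ M.carrier) := by
  let φ : L.Formula (Fin 1) := ⊤
  refine (h.sat.compF (f := fun x : ℕ => (fc g φ, [x])) (by fun_prop)).congr fun x => ?_
  rw [sat_iff']
  constructor
  · rintro ⟨a, ha, -⟩
    have : x ∈ vals a := by rw [ha]; simp
    obtain ⟨i, rfl⟩ := (List.mem_ofFn ..).1 this
    exact (a i).2
  · intro hx
    exact ⟨fun _ => ⟨x, hx⟩, by simp [vals], by simp [φ]⟩

/-- A formula only mentions finitely many parameters. -/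
theorem exists_finite_support {C α : Type} (φ : L.Formula (C ⊕ α)) :
    ∃ (m : ℕ) (ψ : L.Formula (Fin m ⊕ α)) (b : Fin m → C), Function.Injective b ∧
      ∀ (M : Type) (_ : L.Structure M) (c : C → M) (v : α → M),
        φ.Realize (Sum.elim c v) ↔ ψ.Realize (Sum.elim (fun i => c (b i)) v) := by
  classical
  let s : Finset C := (BoundedFormula.freeVarFinset φ).toLeft
  let e := s.equivFin
  let f : BoundedFormula.freeVarFinset φ → Fin s.card ⊕ α := fun x =>
    match x with
    | ⟨Sum.inl c, h⟩ => Sum.inl (e ⟨c, by simpa [s] using h⟩)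
    | ⟨Sum.inr a, _⟩ => Sum.inr a
  refine ⟨s.card, BoundedFormula.restrictFreeVar φ f, fun i => e.symm i,
    Subtype.val_injective.comp e.symm.injective, fun M _ c v => ?_⟩
  refine (BoundedFormula.realize_restrictFreeVar _ ?_).symm
  rintro ⟨c | a, h⟩ <;> simp [f]

/-- Definable sets with parameters in a decidable structure are arithmetical. -/
theorem ArithDecidable.definable (h : ArithDecidable g N) {k : ℕ}
    (φ : L.Formula (N.carrier ⊕ Fin k)) :
    Ar ∅ (fun l : List ℕ => ∃ v : Fin k → N.carrier, vals v = l ∧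
      φ.Realize (Sum.elim (fun x => x) v)) := by
  obtain ⟨m, ψ, b, -, hψ⟩ := exists_finite_support φ
  refine (h.sat.compF (f := fun l : List ℕ => (fc g (ψ.relabel finSumFinEquiv), vals b ++ l))
    (by fun_prop)).congr fun l => ?_
  have key : ∀ v : Fin k → N.carrier, (ψ.relabel finSumFinEquiv).Realize (Fin.append b v) ↔
      φ.Realize (Sum.elim (fun x => x) v) := by
    intro v
    rw [hψ _ N.struc (fun x => x) v, Formula.realize_relabel]
    have : (Fin.append b v ∘ finSumFinEquiv : Fin m ⊕ Fin k → N.carrier) = Sum.elim b v := by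
      funext x
      rcases x with x | x <;> simp
    rw [this]
  constructor
  · intro hs
    have hl : l.length = k := by
      have := hs.length
      simp at this
      omega
    obtain ⟨v, rfl⟩ := exists_vals' (A := N.carrier) l hl
      (fun x hx => hs.mem (List.mem_append_right _ hx))
    refine ⟨v, rfl, (key v).1 ?_⟩
    rw [← sat_iff (g := g), vals_append]
    exact hs
  · rintro ⟨v, rfl, hv⟩
    rw [← vals_append, sat_iff]
    exact (key v).2 hv

theorem ArithDecidable.definable1 (h : ArithDecidable g N) (φ : L.Formula (N.carrier ⊕ Unit)) :
    Ar ∅ (fun x : ℕ => ∃ hx : x ∈ N.carrier,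
      φ.Realize (Sum.elim (fun x => x) (fun _ => ⟨x, hx⟩))) := by
  refine ((h.definable (k := 1) (φ.relabel (Sum.map id fun _ => 0))).compF
    (f := fun x : ℕ => [x]) (by fun_prop)).congr fun x => ?_
  constructor
  · rintro ⟨v, hv, hr⟩
    have hx : (v 0 : ℕ) = x := by simpa [vals] using hv
    subst hx
    refine ⟨(v 0).2, ?_⟩
    rw [Formula.realize_relabel] at hr
    convert hr using 1
    funext y
    rcases y with y | y <;> rfl
  · rintro ⟨hx, hr⟩
    refine ⟨fun _ => ⟨x, hx⟩, by simp [vals], ?_⟩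
    rw [Formula.realize_relabel]
    convert hr using 1
    funext y
    rcases y with y | y <;> rfl

end

/-! ## Arithmetical ultrapowers -/

section
variable {L : FirstOrder.Language} {g : GoedelCoding L} {M₀ : CodedStructure L}

/-- An arithmetical sequence of sets is decided by a cofinal sequence of numbers. -/
theorem exists_cohesive {A : ℕ → ℕ → Prop} (hA : Ar ∅ fun x : ℕ × ℕ => A x.1 x.2) :
    ∃ (s : ℕ → ℕ) (b : ℕ → Prop), Filter.Tendsto s Filter.atTop Filter.atTop ∧ Ar ∅ b ∧
      ∀ i, ∀ᶠ j in Filter.atTop, (A i (s j) ↔ b i) := by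
  let good (h : List Bool) (n : ℕ) : Prop :=
    ∀ (i : ℕ) (bit : Bool), h[i]? = some bit → (A i n ↔ bit = true)
  have hgood : Ar ∅ (fun x : List Bool × ℕ => good x.1 x.2) := by
    refine Ar.all (p := fun (x : List Bool × ℕ) (i : ℕ) => ∀ (bit : Bool), x.1[i]? = some bit →
      (A i x.2 ↔ bit = true)) (Ar.all (p := fun (x : (List Bool × ℕ) × ℕ) (bit : Bool) =>
      x.1.1[x.2]? = some bit → (A x.2 x.1.2 ↔ bit = true)) (Ar.imp
      (Ar.eq (by fun_prop) (by fun_prop)) (Ar.iff ?_ (Ar.eq (by fun_prop) (by fun_prop)))))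
    exact hA.compF (f := fun x : ((List Bool × ℕ) × ℕ) × Bool => (x.1.2, x.1.1.2)) (by fun_prop)
  obtain ⟨F, hF, -, hp⟩ := Ar.recursion (α := Unit) (Y := ∅)
    (p := fun _ h bit => ¬ {n | good (h ++ [bit]) n}.Finite) (Ar.not
      (Ar.finite (p := fun (x : (Unit × List Bool) × Bool) n => good (x.1.2 ++ [x.2]) n)
      (hgood.compF (f := fun x : ((Unit × List Bool) × Bool) × ℕ => (x.1.1.2 ++ [x.1.2], x.2))
        (by fun_prop))))
  let H (n : ℕ) : List Bool := (List.range n).map (F ())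
  have hinf : ∀ n, {m | good (H n) m}.Infinite := by
    intro n
    induction n with
    | zero =>
      have : {m | good (H 0) m} = Set.univ := by
        ext m
        simp [good, H]
      rw [this]
      exact Set.infinite_univ
    | succ n ih =>
      have : H (n + 1) = H n ++ [F () n] := by simp [H, List.range_succ]
      rw [this]
      refine hp () n ?_
      by_contra hcon
      push Not at hcon
      have h1 := (hcon true).union (hcon false)
      refine ih (h1.subset fun m hm => ?_)
      by_cases ha : A n m
      · refine Or.inl fun i bit hi => ?_
        rcases lt_trichotomy i n with h | h | h
        · rw [List.getElem?_append_left (by simpa using h)] at hi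
          exact hm i bit hi
        · subst h
          rw [List.getElem?_append_right (by simp)] at hi
          simp at hi
          simp [← hi, ha]
        · rw [List.getElem?_eq_none (by simp; omega)] at hi
          simp at hi
      · refine Or.inr fun i bit hi => ?_
        rcases lt_trichotomy i n with h | h | h
        · rw [List.getElem?_append_left (by simpa using h)] at hi
          exact hm i bit hi
        · subst h
          rw [List.getElem?_append_right (by simp)] at hi
          simp at hi
          simp [← hi, ha]
        · rw [List.getElem?_eq_none (by simp; omega)] at hi
          simp at hi
  choose s hs hs' using fun j => (hinf j).exists_gt j
  refine ⟨s, fun i => F () i = true, ?_, ?_, fun i => ?_⟩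
  · exact Filter.tendsto_atTop_mono (fun j => (hs' j).le) Filter.tendsto_id
  · exact Ar.eq (hF.comp (f := fun i : ℕ => ((), i)) (by fun_prop)) (by fun_prop)
  · filter_upwards [Filter.eventually_gt_atTop i] with j hj
    exact hs j i _ (by simp [H, hj])

theorem exists_coded_of_equiv {S : Type} [L.Structure S] {A : Set ℕ} (hA : (Aᶜ : Set ℕ).Infinite)
    (f : S ≃ A) : ∃ (N : CodedStructure L) (i : S ≃[L] N.carrier), N.carrier = A ∧
      ∀ x, (i x : ℕ) = f x :=
  ⟨⟨A, hA, f.inducedStructure⟩, @Equiv.inducedStructureEquiv L S A _ f, rfl, fun _ => rfl⟩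

/-- An arithmetically presented elementary extension of a decidable structure is isomorphic to a
decidable coded structure. -/
theorem exists_coded (h₀ : ArithDecidable g M₀) {S : Type} [L.Structure S] (name : ℕ → S)
    (hname : Function.Surjective name) {b : ℕ → List ℕ → Prop}
    (hb : Ar ∅ fun x : ℕ × List ℕ => b x.1 x.2)
    (hbr : ∀ (k : ℕ) (φ : L.Formula (Fin k)) (t : Fin k → ℕ), b (fc g φ) (List.ofFn t) ↔
      φ.Realize fun i => name (t i))
    (hbc : ∀ c l, b c l → ∃ φ : L.Formula (Fin l.length), c = fc g φ)
    (j : M₀.carrier ↪ₑ[L] S) (κ : ℕ → ℕ) (hκ : ArF ∅ κ) (hκj : ∀ m : M₀.carrier, name (κ m) = j m) :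
    ∃ (N : CodedStructure L) (e : ElemSub M₀ N) (i : S ≃[L] N.carrier), ArithDecidable g N ∧
      ArF ∅ (fun t => (i (name t) : ℕ)) ∧ ∀ m, i (j m) = e.inc m := by
  classical
  have hM := h₀.carrier
  -- equality of names
  let φe : L.Formula (Fin 2) := Term.equal (Term.var 0) (Term.var 1)
  have hsame : Ar ∅ (fun x : ℕ × ℕ => name x.1 = name x.2) := by
    refine (hb.compF (f := fun x : ℕ × ℕ => (fc g φe, [x.1, x.2])) (by fun_prop)).congr fun x => ?_
    have := hbr 2 φe ![x.1, x.2]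
    simpa [φe, List.ofFn_succ] using this
  -- canonical names
  obtain ⟨r, hr, hr'⟩ := Ar.choose (Y := ∅) (p := fun t t' : ℕ => name t = name t' ∧
      ∀ u, u < t' → ¬ name t = name u) (hsame.and (Ar.all (p := fun (x : ℕ × ℕ) u => u < x.2 →
        ¬ name x.1 = name u) (Ar.imp (Ar.lt (by fun_prop) (by fun_prop))
        (hsame.compF (f := fun x : (ℕ × ℕ) × ℕ => (x.1.1, x.2)) (by fun_prop)).not)))
  replace hr' : ∀ t, name t = name (r t) ∧ ∀ u, u < r t → ¬ name t = name u := by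
    intro t
    refine hr' t ⟨Nat.find (p := fun u => name t = name u) ⟨t, rfl⟩,
      Nat.find_spec (p := fun u => name t = name u) ⟨t, rfl⟩, fun u hu => ?_⟩
    exact Nat.find_min (p := fun u => name t = name u) ⟨t, rfl⟩ hu
  have hrr : ∀ t t', name t = name t' → r t = r t' := by
    intro t t' h
    by_contra hne
    rcases Nat.lt_or_gt_of_ne hne with hlt | hlt
    · exact (hr' t').2 _ hlt (h.symm.trans (hr' t).1)
    · exact (hr' t).2 _ hlt (h.trans (hr' t').1)
  -- new elements
  obtain ⟨F, hF, -, hp⟩ := Ar.recursion (α := Unit) (Y := ∅)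
    (p := fun _ (h : List ℕ) x => x ∉ M₀.carrier ∧ x ∉ h)
    ((hM.comp Primrec.snd).not.and (Ar.memList (f := fun x : (Unit × List ℕ) × ℕ => x.2)
      (l := fun x => x.1.2) (by fun_prop) (by fun_prop)).not)
  replace hp : ∀ n, F () n ∉ M₀.carrier ∧ ∀ m < n, F () n ≠ F () m := by
    intro n
    obtain ⟨x, hx, hx'⟩ := (M₀.compl_infinite.exists_notMem_finset
      ((List.range n).map (F ())).toFinset)
    have := hp () n ⟨x, hx, by simpa using hx'⟩
    refine ⟨this.1, fun m hm he => this.2 ?_⟩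
    rw [he]
    exact List.mem_map_of_mem (List.mem_range.2 hm)
  have hFinj : ∀ m n, F () m = F () n → m = n := by
    intro m n h
    by_contra hne
    rcases Nat.lt_or_gt_of_ne hne with hlt | hlt
    · exact (hp n).2 _ hlt h.symm
    · exact (hp m).2 _ hlt h
  -- the coding
  have hold : Ar ∅ (fun x : ℕ × ℕ => x.2 ∈ M₀.carrier ∧ name x.1 = name (κ x.2)) :=
    (hM.comp Primrec.snd).and
      (hsame.compF (f := fun x : ℕ × ℕ => (x.1, κ x.2)) (by fun_prop))
  obtain ⟨o, ho, ho'⟩ := Ar.choose (Y := ∅)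
    (p := fun t m : ℕ => m ∈ M₀.carrier ∧ name t = name (κ m)) hold
  let old (t : ℕ) : Prop := ∃ m : ℕ, m ∈ M₀.carrier ∧ name t = name (κ m)
  let ν (t : ℕ) : ℕ := if old t then o t else F () (2 * r t)
  have hν : ArF ∅ ν := Ar.ite (Ar.ex hold) ho
    (hF.comp (f := fun t => ((), 2 * r t)) (by fun_prop))
  have hνeq : ∀ t t', ν t = ν t' ↔ name t = name t' := by
    intro t t'
    have hoM : ∀ t, old t → o t ∈ M₀.carrier := fun t h => (ho' t h).1
    by_cases h : old t <;> by_cases h' : old t'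
    · simp only [ν, if_pos h, if_pos h']
      have h1 := (ho' t h).2
      have h2 := (ho' t' h').2
      constructor
      · intro e
        rw [h1, h2, e]
      · intro e
        have h3 : j ⟨o t, hoM t h⟩ = j ⟨o t', hoM t' h'⟩ := by
          rw [← hκj, ← hκj]
          exact h1.symm.trans (e.trans h2)
        exact congrArg Subtype.val (j.injective h3)
    · simp only [ν, if_pos h, if_neg h']
      constructor
      · intro e
        exact absurd (e ▸ hoM t h) (hp _).1
      · intro e
        obtain ⟨m, hm, hm'⟩ := h
        exact absurd ⟨m, hm, e.symm.trans hm'⟩ h'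
    · simp only [ν, if_neg h, if_pos h']
      constructor
      · intro e
        exact absurd (e.symm ▸ hoM t' h') (hp _).1
      · intro e
        obtain ⟨m, hm, hm'⟩ := h'
        exact absurd ⟨m, hm, e.trans hm'⟩ h
    · simp only [ν, if_neg h, if_neg h']
      constructor
      · intro e
        have : r t = r t' := by
          have := hFinj _ _ e
          omega
        rw [(hr' t).1, (hr' t').1, this]
      · intro e
        rw [hrr t t' e]
  have hνold : ∀ m : M₀.carrier, ν (κ m) = m := by
    intro m
    have h : old (κ m) := ⟨m, m.2, rfl⟩
    simp only [ν, if_pos h]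
    have h1 := ho' _ h
    have h3 : j ⟨o (κ m), h1.1⟩ = j m := by
      rw [← hκj, ← hκj]
      exact h1.2.symm
    exact congrArg Subtype.val (j.injective h3)
  have hcompl : ((Set.range ν)ᶜ : Set ℕ).Infinite := by
    refine Set.infinite_of_injective_forall_mem (f := fun n => F () (2 * n + 1)) ?_ ?_
    · intro m n h
      have := hFinj _ _ h
      omega
    · rintro n ⟨t, ht⟩
      by_cases h : old t
      · simp only [ν, if_pos h] at ht
        exact (hp _).1 (ht ▸ (ho' t h).1)
      · simp only [ν, if_neg h] at ht
        have := hFinj _ _ ht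
        omega
  let f (x : S) : Set.range ν := ⟨ν (Function.surjInv hname x), Set.mem_range_self _⟩
  have hf : ∀ t, (f (name t) : ℕ) = ν t := fun t =>
    (hνeq _ _).2 (Function.surjInv_eq hname _)
  let fe : S ≃ Set.range ν := Equiv.ofBijective f ⟨fun x y h => by
    have := (hνeq _ _).1 (congrArg Subtype.val h)
    rwa [Function.surjInv_eq hname, Function.surjInv_eq hname] at this, by
    rintro ⟨_, t, rfl⟩
    exact ⟨name t, Subtype.ext (hf t)⟩⟩
  obtain ⟨N, i, hN, hif⟩ := exists_coded_of_equiv (L := L) hcompl fe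
  have hi : ∀ t, (i (name t) : ℕ) = ν t := fun t => (hif _).trans (hf t)
  have hsub : M₀.carrier ⊆ N.carrier := fun m hm => hN ▸ ⟨κ m, hνold ⟨m, hm⟩⟩
  have hij : ∀ m : M₀.carrier, i (j m) = (⟨m, hsub m.2⟩ : N.carrier) := by
    intro m
    refine Subtype.ext ?_
    rw [← hκj, hi]
    exact hνold m
  have he : ElemSub M₀ N := by
    refine ⟨hsub, fun k φ a => ?_⟩
    have h1 := i.toElementaryEmbedding.map_formula φ (fun x => j (a x))
    refine (j.map_formula φ a).symm.trans (Iff.trans h1.symm ?_)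
    have : (i ∘ fun x => j (a x)) = fun i => (⟨((a i : ℕ)), hsub (a i).2⟩ : N.carrier) :=
      funext fun x => hij (a x)
    exact iff_of_eq (congrArg (fun v => φ.Realize v) this)
  refine ⟨N, he, i, ArithDecidable.of_sat ?_, hν.congr fun t => (hi t).symm, fun m => ?_⟩
  · refine (Ar.ex (p := fun (x : ℕ × List ℕ) (t : List ℕ) => t.map ν = x.2 ∧ b x.1 t)
      (Ar.and (Ar.eq ?_ (by fun_prop)) (hb.compF (f := fun x : (ℕ × List ℕ) × List ℕ =>
        (x.1.1, x.2)) (by fun_prop)))).congr fun x => ?_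
    · exact ArF.map (f := fun _ t => ν t) (by fun_prop) (by fun_prop)
    · obtain ⟨c, l⟩ := x
      simp only
      have key : ∀ (k : ℕ) (φ : L.Formula (Fin k)) (t : Fin k → ℕ),
          b (fc g φ) (List.ofFn t) ↔ φ.Realize (fun x => i (name (t x))) := by
        intro k φ t
        rw [hbr]
        exact (i.toElementaryEmbedding.map_formula φ (fun x => name (t x))).symm
      constructor
      · rintro ⟨t, rfl, h⟩
        obtain ⟨φ, rfl⟩ := hbc c t h
        have h2 := key _ φ t.get
        rw [List.ofFn_get] at h2
        refine ⟨_, φ, _, rfl, ?_, h2.1 h⟩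
        simp only [vals, hi]
        conv_lhs => rw [← List.ofFn_get t, List.map_ofFn]
        rfl
      · rintro ⟨k, φ, a, rfl, rfl, h⟩
        choose t ht using fun x => (show (a x : ℕ) ∈ Set.range ν from hN ▸ (a x).2)
        refine ⟨List.ofFn t, ?_, (key k φ t).2 ?_⟩
        · rw [List.map_ofFn]
          exact congrArg List.ofFn (funext ht)
        · have : (fun x => i (name (t x))) = a := funext fun x => Subtype.ext ((hi _).trans (ht x))
          rw [this]
          exact h
  · exact hij m

/-- Arithmetical sequences of elements of a decidable structure are realized, simultaneously, in a
decidable elementary extension. -/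
theorem exists_ultra (h₀ : ArithDecidable g M₀) (d : ℕ → ℕ → M₀.carrier)
    (hd : ArF ∅ fun x : ℕ × ℕ => (d x.1 x.2 : ℕ)) :
    ∃ (N : CodedStructure L) (e : ElemSub M₀ N) (ν : ℕ → N.carrier), ArithDecidable g N ∧
      ArF ∅ (fun i => (ν i : ℕ)) ∧ ∀ φ : L.Formula (M₀.carrier ⊕ ℕ),
        (∀ᶠ n in Filter.atTop, φ.Realize (Sum.elim (fun x => x) fun i => d i n)) →
        φ.Realize (Sum.elim e.inc ν) := by
  classical
  have hM := h₀.carrier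
  let m0 : M₀.carrier := d 0 0
  have : Nonempty M₀.carrier := ⟨m0⟩
  -- names
  let wit (n : ℕ) (h : List ℕ) (c : ℕ) (l : List ℕ) (b : ℕ) : Prop :=
    Sat g M₀ c (b :: l.map fun i => h.getD i 0)
  have hwit : Ar ∅ (fun x : ((((ℕ × List ℕ) × ℕ) × ℕ) × List ℕ) × ℕ =>
      wit x.1.1.1.1.1 x.1.1.1.1.2 x.1.1.2 x.1.2 x.2) := by
    refine h₀.sat.compF (f := fun x : ((((ℕ × List ℕ) × ℕ) × ℕ) × List ℕ) × ℕ => (x.1.1.2,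
      x.2 :: x.1.2.map fun i => x.1.1.1.1.2.getD i 0)) ?_
    have : ArF ∅ (fun x : ((((ℕ × List ℕ) × ℕ) × ℕ) × List ℕ) × ℕ =>
      x.1.2.map fun i => x.1.1.1.1.2.getD i 0) :=
      ArF.map (f := fun (x : ((((ℕ × List ℕ) × ℕ) × ℕ) × List ℕ) × ℕ) i =>
        x.1.1.1.1.2.getD i 0) (by fun_prop) (by fun_prop)
    fun_prop
  obtain ⟨F, hF, -, hp⟩ := Ar.recursion (α := ℕ) (Y := ∅)
    (p := fun n h b => b ∈ M₀.carrier ∧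
      (h.length.unpair.1 = 0 → b = d h.length.unpair.2 n) ∧
      (h.length.unpair.1 = 1 → h.length.unpair.2 ∈ M₀.carrier → b = h.length.unpair.2) ∧
      ∀ c l, h.length = Nat.pair 2 (Nat.pair c (Encodable.encode l)) →
        (∃ b', wit n h c l b') → wit n h c l b) (by
    refine Ar.and (hM.comp Primrec.snd) (Ar.and (Ar.imp (Ar.eq (by fun_prop) (by fun_prop))
      (Ar.eq (by fun_prop) ?_)) (Ar.and (Ar.imp (Ar.eq (by fun_prop) (by fun_prop))
      (Ar.imp (hM.compF (f := fun x : (ℕ × List ℕ) × ℕ => x.1.2.length.unpair.2) (by fun_prop))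
      (Ar.eq (by fun_prop) (by fun_prop)))) ?_))
    · exact hd.comp (f := fun x : (ℕ × List ℕ) × ℕ => (x.1.2.length.unpair.2, x.1.1)) (by fun_prop)
    · refine Ar.all (p := fun (x : (ℕ × List ℕ) × ℕ) c => ∀ l,
        x.1.2.length = Nat.pair 2 (Nat.pair c (Encodable.encode l)) →
        (∃ b', wit x.1.1 x.1.2 c l b') → wit x.1.1 x.1.2 c l x.2) ?_
      refine Ar.all (p := fun (x : ((ℕ × List ℕ) × ℕ) × ℕ) l =>
        x.1.1.2.length = Nat.pair 2 (Nat.pair x.2 (Encodable.encode l)) →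
        (∃ b', wit x.1.1.1 x.1.1.2 x.2 l b') → wit x.1.1.1 x.1.1.2 x.2 l x.1.2) ?_
      refine Ar.imp (Ar.eq (by fun_prop) (by fun_prop)) (Ar.imp (Ar.ex
        (p := fun (x : (((ℕ × List ℕ) × ℕ) × ℕ) × List ℕ) b' =>
          wit x.1.1.1.1 x.1.1.1.2 x.1.2 x.2 b') hwit) ?_)
      exact hwit.compF (f := fun x : (((ℕ × List ℕ) × ℕ) × ℕ) × List ℕ => (x, x.1.1.2))
        (by fun_prop))
  replace hp := fun n t => hp n t (by
    generalize List.map (F n) (List.range t) = h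
    by_cases h0 : h.length.unpair.1 = 0
    · refine ⟨_, (d h.length.unpair.2 n).2, fun _ => rfl, by omega, fun c l e => ?_⟩
      rw [e] at h0
      simp at h0
    by_cases h1 : h.length.unpair.1 = 1
    · by_cases hm : h.length.unpair.2 ∈ M₀.carrier
      · refine ⟨_, hm, fun h => absurd h h0, fun _ _ => rfl, fun c l e => ?_⟩
        rw [e] at h1
        simp at h1
      · refine ⟨m0, m0.2, fun h => absurd h h0, fun _ h => absurd h hm, fun c l e => ?_⟩
        rw [e] at h1
        simp at h1
    by_cases h2 : ∃ c l, h.length = Nat.pair 2 (Nat.pair c (Encodable.encode (l : List ℕ))) ∧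
        (∃ b', wit n h c l b')
    · obtain ⟨c, l, e, b', hb⟩ := h2
      refine ⟨b', hb.mem (List.mem_cons_self ..), fun h => absurd h h0, fun h => absurd h h1, ?_⟩
      intro c' l' e' hb'
      rw [e, Nat.pair_eq_pair, Nat.pair_eq_pair] at e'
      obtain ⟨-, rfl, e'⟩ := e'
      rwa [← Encodable.encode_injective e']
    · exact ⟨m0, m0.2, fun h => absurd h h0, fun h => absurd h h1,
        fun c l e hb => absurd ⟨c, l, e, hb⟩ h2⟩)
  simp only [List.length_map, List.length_range] at hp
  let D (t n : ℕ) : M₀.carrier := ⟨F n t, (hp n t).1⟩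
  have hD : ArF ∅ (fun x : ℕ × ℕ => (D x.1 x.2 : ℕ)) :=
    hF.comp (f := fun x : ℕ × ℕ => (x.2, x.1)) (by fun_prop)
  have hD0 : ∀ i n, D (Nat.pair 0 i) n = d i n := fun i n =>
    Subtype.ext (by simpa using (hp n (Nat.pair 0 i)).2.1 (by simp))
  have hD1 : ∀ (m : M₀.carrier) n, D (Nat.pair 1 m) n = m := fun m n =>
    Subtype.ext (by simpa using (hp n (Nat.pair 1 m)).2.2.1 (by simp) (by simp))
  have hD2 : ∀ (k : ℕ) (χ : L.Formula (Fin (k + 1))) (t : Fin k → ℕ) (n : ℕ) (x : M₀.carrier),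
      χ.Realize (Fin.cons x fun i => D (t i) n) → χ.Realize (Fin.cons
        (D (Nat.pair 2 (Nat.pair (fc g χ) (Encodable.encode (List.ofFn t)))) n)
          fun i => D (t i) n) := by
    intro k χ t n x hx
    have h1 := (hp n (Nat.pair 2 (Nat.pair (fc g χ) (Encodable.encode (List.ofFn t))))).2.2.2
      (fc g χ) (List.ofFn t) rfl
    have h2 : (List.ofFn t).map (fun i => (List.map (F n) (List.range (Nat.pair 2 (Nat.pair (fc g χ)
        (Encodable.encode (List.ofFn t)))))).getD i 0) = vals fun i => D (t i) n := by
      rw [List.map_ofFn]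
      refine congrArg List.ofFn (funext fun i => ?_)
      have hlt : t i < Nat.pair 2 (Nat.pair (fc g χ) (Encodable.encode (List.ofFn t))) := by
        have hm : t i ∈ List.ofFn t := (List.mem_ofFn ..).2 ⟨i, rfl⟩
        have : ∀ l : List ℕ, t i ∈ l → t i < Encodable.encode l := by
          intro l hl
          induction l with
          | nil => simp at hl
          | cons y l ih =>
            rw [Encodable.encode_list_cons]
            rcases List.mem_cons.1 hl with h | h
            · rw [h]
              exact Nat.lt_succ_of_le (Nat.left_le_pair _ _)
            · exact (ih h).trans_le ((Nat.right_le_pair _ _).trans (Nat.le_succ _))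
        exact (this _ hm).trans_le ((Nat.right_le_pair _ _).trans (Nat.right_le_pair _ _))
      simp [hlt, D]
    simp only [wit] at h1
    rw [h2] at h1
    have h3 := h1 ⟨x, by rw [← vals_cons, sat_iff]; exact hx⟩
    have h4 : F n (Nat.pair 2 (Nat.pair (fc g χ) (Encodable.encode (List.ofFn t)))) =
      (D (Nat.pair 2 (Nat.pair (fc g χ) (Encodable.encode (List.ofFn t)))) n : ℕ) := rfl
    rwa [h4, ← vals_cons, sat_iff] at h3
  clear_value D
  clear hp hF hwit
  -- the cohesive sequence
  let A (x n : ℕ) : Prop := Sat g M₀ x.unpair.1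
    ((Denumerable.ofNat (List ℕ) x.unpair.2).map fun t => (D t n : ℕ))
  have hA : Ar ∅ (fun x : ℕ × ℕ => A x.1 x.2) := by
    have h1 : ArF ∅ (fun x : ℕ × ℕ => Denumerable.ofNat (List ℕ) x.1.unpair.2) :=
      (ArF.of_primrec (Primrec.ofNat (List ℕ))).comp (f := fun x : ℕ × ℕ => x.1.unpair.2)
        (by fun_prop)
    have h2 := ArF.map (Y := ∅) (f := fun (x : ℕ × ℕ) t => (D t x.2 : ℕ))
      (hD.comp (f := fun x : (ℕ × ℕ) × ℕ => (x.2, x.1.2)) (by fun_prop)) h1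
    exact h₀.sat.compF (f := fun x : ℕ × ℕ => (x.1.unpair.1, _)) (by fun_prop)
  obtain ⟨s, b, hs, hb, hsb⟩ := exists_cohesive hA
  let U : Ultrafilter ℕ := Filter.hyperfilter ℕ
  have hU : (U : Filter ℕ) ≤ Filter.atTop := by
    rw [← Nat.cofinite_eq_atTop]
    exact Filter.hyperfilter_le_cofinite
  let P := (U : Filter ℕ).Product (fun _ => M₀.carrier)
  let nm (t : ℕ) : P := ((fun j => D t (s j) : ∀ _ : ℕ, M₀.carrier) : P)
  have los : ∀ {β : Type} (φ : L.Formula β) (t : β → ℕ), φ.Realize (fun x => nm (t x)) ↔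
      ∀ᶠ j in (U : Filter ℕ), φ.Realize fun x => D (t x) (s j) := fun φ t =>
    Ultraproduct.realize_formula_cast (M := fun _ => M₀.carrier) (u := U) φ
      (fun x j => D (t x) (s j))
  have hw : ∀ (k : ℕ) (χ : L.Formula (Fin (k + 1))) (t : Fin k → ℕ) (x : P),
      χ.Realize (Fin.cons x fun i => nm (t i) : Fin (k + 1) → P) →
        ∃ t', χ.Realize (Fin.cons (nm t') fun i => nm (t i) : Fin (k + 1) → P) := by
    intro k χ t x hx
    obtain ⟨a, rfl⟩ := Quotient.exists_rep x
    refine ⟨Nat.pair 2 (Nat.pair (fc g χ) (Encodable.encode (List.ofFn t))), ?_⟩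
    have h1 := (Ultraproduct.realize_formula_cast (M := fun _ => M₀.carrier) (u := U) χ
      (Fin.cons a fun i j => D (t i) (s j))).1 (by
        refine (iff_of_eq (congrArg (fun v : Fin (k + 1) → P => χ.Realize v) (funext fun i => ?_))).1 hx
        exact Fin.cases rfl (fun i => rfl) i)
    have h2 := los χ (Fin.cons (Nat.pair 2 (Nat.pair (fc g χ) (Encodable.encode (List.ofFn t)))) t)
    have h3 : (fun x => nm ((Fin.cons (Nat.pair 2 (Nat.pair (fc g χ)
        (Encodable.encode (List.ofFn t)))) t : Fin (k + 1) → ℕ) x)) = (Fin.cons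
        (nm (Nat.pair 2 (Nat.pair (fc g χ) (Encodable.encode (List.ofFn t)))))
        fun i => nm (t i) : Fin (k + 1) → P) := by
      funext i
      refine Fin.cases rfl (fun i => rfl) i
    rw [h3] at h2
    refine h2.2 (h1.mono fun j hj => ?_)
    have h4 := hD2 k χ t (s j) (a j) (by
      convert hj using 1
      funext i
      refine Fin.cases rfl (fun i => rfl) i)
    convert h4 using 1
    funext i
    refine Fin.cases rfl (fun i => rfl) i
  let S : L.Substructure P := ⟨Set.range nm, by
    intro k f x hx
    choose t ht using hx
    obtain rfl : (fun i => nm (t i)) = x := funext ht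
    obtain ⟨t', h⟩ := hw k (Term.equal (Term.var 0) (Term.func f fun i => Term.var i.succ)) t
      (Structure.funMap f fun i => nm (t i)) (by simp)
    simp at h
    exact ⟨t', h⟩⟩
  have hS : S.IsElementary := by
    refine S.isElementary_of_exists fun k φ x a ha => ?_
    let χ : L.Formula (Fin (k + 1)) :=
      φ.toFormula.relabel (Sum.elim Empty.elim (Fin.lastCases 0 Fin.succ))
    have hχ : ∀ (a : P) (y : Fin k → P), χ.Realize (Fin.cons a y : Fin (k + 1) → P) ↔
        φ.Realize default (Fin.snoc y a : Fin (k + 1) → P) := by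
      intro a y
      rw [Formula.realize_relabel, BoundedFormula.realize_toFormula]
      have e1 : (((Fin.cons a y : Fin (k + 1) → P) ∘ Sum.elim Empty.elim (Fin.lastCases 0 Fin.succ)) ∘
        Sum.inl : Empty → P) = default := Subsingleton.elim _ _
      have e2 : (((Fin.cons a y : Fin (k + 1) → P) ∘ Sum.elim Empty.elim (Fin.lastCases 0 Fin.succ)) ∘
        Sum.inr : Fin (k + 1) → P) = Fin.snoc y a := by
        funext i
        refine Fin.lastCases ?_ (fun i => ?_) i <;> simp
      rw [e1, e2]
    choose t ht using fun i => (x i).2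
    have hx : (Subtype.val ∘ x : Fin k → P) = fun i => nm (t i) := funext fun i => (ht i).symm
    change φ.Realize default (Fin.snoc (Subtype.val ∘ x) a) at ha
    rw [hx, ← hχ] at ha
    obtain ⟨t', h⟩ := hw k χ t a ha
    refine ⟨⟨nm t', t', rfl⟩, ?_⟩
    change φ.Realize default (Fin.snoc (Subtype.val ∘ x) (nm t'))
    rw [hx, ← hχ]
    exact h
  let name (t : ℕ) : S := ⟨nm t, t, rfl⟩
  have hname : Function.Surjective name := by
    rintro ⟨_, t, rfl⟩
    exact ⟨t, rfl⟩
  have losS : ∀ {β : Type} (φ : L.Formula β) (t : β → ℕ), φ.Realize (fun x => name (t x)) ↔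
      ∀ᶠ j in (U : Filter ℕ), φ.Realize fun x => D (t x) (s j) := fun φ t =>
    ((ElementarySubstructure.subtype ⟨S, hS⟩).map_formula φ (fun x => name (t x))).symm.trans
      (los φ t)
  let j : M₀.carrier ↪ₑ[L] S := ⟨fun m => name (Nat.pair 1 m), fun k φ a => by
    refine (losS φ fun i => Nat.pair 1 (a i)).trans ?_
    simp [hD1]⟩
  have hev : ∀ (c : ℕ) (l : List ℕ), b (Nat.pair c (Encodable.encode l)) ↔
      ∀ᶠ j in (U : Filter ℕ), Sat g M₀ c (l.map fun t => (D t (s j) : ℕ)) := by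
    intro c l
    have h1 := hU (hsb (Nat.pair c (Encodable.encode l)))
    have h2 : ∀ n, A (Nat.pair c (Encodable.encode l)) n ↔
      Sat g M₀ c (l.map fun t => (D t n : ℕ)) := by
      intro n
      simp [A]
    simp only [h2] at h1
    constructor
    · intro hb
      filter_upwards [h1] with n hn
      exact hn.2 hb
    · intro hb
      obtain ⟨n, h, h'⟩ := (Filter.Eventually.and (f := (U : Filter ℕ)) h1 hb).exists
      exact h.1 h'
  obtain ⟨N, e, i, hN, hi, hij⟩ := exists_coded (g := g) h₀ name hname
    (b := fun c l => b (Nat.pair c (Encodable.encode l)))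
    (hb.compF (f := fun x : ℕ × List ℕ => Nat.pair x.1 (Encodable.encode x.2)) (by fun_prop))
    (fun k φ t => by
      rw [hev, losS]
      refine Filter.eventually_congr (Filter.Eventually.of_forall fun n => ?_)
      rw [List.map_ofFn]
      exact sat_iff (a := fun i => D (t i) (s n)))
    (fun c l h => by
      obtain ⟨n, k, φ, a, rfl, h1, -⟩ := ((hev c l).1 h).exists
      have : l.length = k := by simpa using congrArg List.length h1
      subst this
      exact ⟨φ, rfl⟩)
    j (fun m => Nat.pair 1 m) (by fun_prop) (fun m => rfl)
  refine ⟨N, e, fun k => i (name (Nat.pair 0 k)), hN,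
    hi.comp (f := fun k => Nat.pair 0 k) (by fun_prop), fun φ hφ => ?_⟩
  have h1 := (losS φ (Sum.elim (fun m : M₀.carrier => Nat.pair 1 m) fun k => Nat.pair 0 k)).2 (by
    filter_upwards [(hs.eventually hφ).filter_mono hU] with n hn
    convert hn using 1
    funext x
    rcases x with m | k
    · exact hD1 m _
    · exact hD0 k _)
  have h2 := (i.toElementaryEmbedding.map_formula φ _).2 h1
  convert h2 using 1
  funext x
  rcases x with m | k
  · exact (hij m).symm
  · rfl

end

/-! ## Small sets and finite trees in one structure -/

section ExInf

variable {L : FirstOrder.Language} {C I : Type} {A : I → Pt L C} {α β : Type}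

/-- Existential quantification over arbitrarily many variables. -/
theorem UDf.exInf (hA : ∀ i, Nonempty (A i).M) {P : ∀ i, (α ⊕ β → (A i).M) → Prop}
    (h : UDf A P) : UDf A (fun i v => ∃ w : β → (A i).M, P i (Sum.elim v w)) := by
  obtain ⟨φ, hφ⟩ := h
  let φ' : L.Formula (β ⊕ (C ⊕ α)) :=
    φ.relabel (Sum.elim (fun c => Sum.inr (Sum.inl c))
      (Sum.elim (fun a => Sum.inr (Sum.inr a)) Sum.inl))
  obtain ⟨m, ψ, b, hb, H⟩ := exists_finite_support φ'
  have h1 : UDf A (α := α ⊕ Fin m) (fun i v => @Formula.Realize L _ (A i).S _ ψ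
      (Sum.elim (fun i => v (Sum.inr i)) (Sum.elim (A i).c fun a => v (Sum.inl a)))) := by
    refine (UDf.formula (A := A) ψ (Sum.elim (fun i => Sum.inr (Sum.inr i))
      (Sum.elim Sum.inl (fun a => Sum.inr (Sum.inl a))))).congr fun i v => ?_
    refine iff_of_eq (congrArg _ ?_)
    ext x
    rcases x with x | x | x <;> rfl
  refine h1.ex.congr fun i v => ?_
  let _ := (A i).S
  have key : ∀ w : β → (A i).M, P i (Sum.elim v w) ↔
      ψ.Realize (Sum.elim (fun j => w (b j)) (Sum.elim (A i).c v)) := by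
    intro w
    rw [← hφ, ← H (A i).M (A i).S w]
    simp only [φ']
    rw [Formula.realize_relabel]
    refine iff_of_eq (congrArg _ ?_)
    ext x
    rcases x with x | x | x <;> rfl
  constructor
  · rintro ⟨w, hw⟩
    obtain ⟨m0⟩ := hA i
    refine ⟨Function.extend b w (fun _ => m0), (key _).2 ?_⟩
    simpa [hb.extend_apply] using hw
  · rintro ⟨w, hw⟩
    exact ⟨fun j => w (b j), by simpa using (key w).1 hw⟩

end ExInf

section Small

variable {L : FirstOrder.Language} {M : Type} [S : L.Structure M]

variable (L) in
/-- Definability with parameters in one structure. -/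
abbrev Dfn {α : Type} (P : (α → M) → Prop) : Prop :=
  UDf (L := L) (C := M) (I := Unit) (fun _ => ⟨M, S, fun x => x⟩) (fun _ => P)

variable (L M) in
/-- The structure `M` with all elements named. -/
abbrev selfPt : Unit → Pt L M := fun _ => ⟨M, S, fun x => x⟩

theorem Dfn.subst {α β : Type} {P : (β → M) → Prop} (h : Dfn L P) (f : β → M ⊕ α) :
    Dfn L (fun v : α → M => P (fun b => Sum.elim (fun x => x) v (f b))) :=
  UDf.subst (A := selfPt L M) (P := fun _ => P) h f

theorem Dfn.comp {α β : Type} {P : (β → M) → Prop} (h : Dfn L P) (f : β → α) :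
    Dfn L (fun v : α → M => P (fun b => v (f b))) :=
  UDf.comp (A := selfPt L M) (P := fun _ => P) h f

variable (L) in
/-- `X` is covered by finitely many points over each tuple from `θ`, uniformly. -/
def Small (θ : M → Prop) (X : Set M) : Prop :=
  ∃ χ : (ℕ → M) → M → Prop,
    Dfn L (fun v : ℕ ⊕ Unit → M => χ (fun i => v (Sum.inl i)) (v (Sum.inr ()))) ∧
    ∃ k, (∀ y, AtMost k (χ y)) ∧ ∀ x ∈ X, ∃ y, (∀ i, θ (y i)) ∧ χ y x

variable {θ : M → Prop}

theorem Small.mono {X Y : Set M} (h : Small L θ X) (hY : Y ⊆ X) : Small L θ Y := by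
  obtain ⟨χ, h1, k, h2, h3⟩ := h
  exact ⟨χ, h1, k, h2, fun x hx => h3 x (hY hx)⟩

theorem AtMost.or {X : Type} {k k' : ℕ} {p q : X → Prop} (h : AtMost k p) (h' : AtMost k' q) :
    AtMost (k + k') (fun x => p x ∨ q x) := by
  rw [atMost_iff] at *
  exact ⟨h.1.union h'.1, (Set.ncard_union_le {x | p x} {x | q x}).trans (add_le_add h.2 h'.2)⟩

theorem Small.union {X Y : Set M} (h : Small L θ X) (h' : Small L θ Y) :
    Small L θ (X ∪ Y) := by
  obtain ⟨χ, h1, k, h2, h3⟩ := h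
  obtain ⟨χ', h1', k', h2', h3'⟩ := h'
  refine ⟨fun y x => χ y x ∨ χ' y x, h1.or h1', k + k', fun y => (h2 y).or (h2' y), ?_⟩
  rintro x (hx | hx)
  · obtain ⟨y, hy, hc⟩ := h3 x hx
    exact ⟨y, hy, Or.inl hc⟩
  · obtain ⟨y, hy, hc⟩ := h3' x hx
    exact ⟨y, hy, Or.inr hc⟩

theorem Small.self : Small L θ {x | θ x} := by
  refine ⟨fun y x => x = y 0, UDf.eq_var _ _, 1, fun y => ?_, fun x hx => ⟨fun _ => x, ?_, rfl⟩⟩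
  · rw [atMost_iff]
    simp
  · exact fun _ => hx

theorem Small.of_finite {X : Set M} (hθ : ∃ m, θ m) (hX : X.Finite) : Small L θ X := by
  obtain ⟨m, hm⟩ := hθ
  induction X, hX using Set.Finite.induction_on with
  | empty =>
    refine ⟨fun _ _ => False, UDf.false, 0, fun y => ?_, by simp⟩
    rw [atMost_iff]
    simp
  | @insert a s _ _ ih =>
    rw [Set.insert_eq]
    refine Small.union ⟨fun _ x => x = a, UDf.eq_const (Sum.inr ()) a, 1, fun y => ?_, ?_⟩ ih
    · rw [atMost_iff]
      simp
    · rintro x rfl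
      exact ⟨fun _ => m, fun _ => hm, rfl⟩

theorem Small.biUnion (hθ : ∃ m, θ m) {ι : Type} (s : Finset ι) {X : ι → Set M}
    (h : ∀ i ∈ s, Small L θ (X i)) : Small L θ {x | ∃ i ∈ s, x ∈ X i} := by
  classical
  induction s using Finset.induction_on with
  | empty => exact (Small.of_finite hθ Set.finite_empty).mono (by intro x; simp)
  | insert a s _ ih =>
    refine ((h a (by simp)).union (ih fun i hi => h i (by simp [hi]))).mono ?_
    rintro x ⟨i, hi, hx⟩
    rw [Finset.mem_insert] at hi
    rcases hi with rfl | hi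
    · exact Or.inl hx
    · exact Or.inr ⟨i, hi, hx⟩

theorem Small.of_datum {γ : (ℕ → M) → M → Prop} (k : ℕ)
    (h : Dfn L (fun v : ℕ ⊕ Unit → M => γ (fun i => v (Sum.inl i)) (v (Sum.inr ())))) :
    Small L θ {x | ∃ y, (∀ i, θ (y i)) ∧ γ y x ∧ AtMost k (γ y)} := by
  refine ⟨fun y x => γ y x ∧ AtMost k (γ y), h.and ?_, k, fun y => ?_, ?_⟩
  · refine UDf.atMost (A := selfPt L M) k
      (P := fun _ (v : ℕ ⊕ Unit → M) x => γ (fun i => v (Sum.inl i)) x) ?_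
    exact Dfn.comp h (Sum.elim (fun i => Sum.inl (Sum.inl i)) (fun _ => Sum.inr ()))
  · by_cases hk : AtMost k (γ y)
    · exact hk.mono le_rfl fun x hx => hx.1
    · rw [atMost_iff]
      simp [hk]
  · rintro x ⟨y, h1, h2, h3⟩
    exact ⟨y, h1, h2, h3⟩

end Small

section FinTree

variable {L : FirstOrder.Language} {M : Type} [S : L.Structure M]

/-- Data governing trees of finite approximations: the splitting formula, the omitted formula and
the requirement at each level. -/
structure TreeSpec (L : FirstOrder.Language) (M : Type) [L.Structure M] where
  ψ : M → Prop
  θ : M → Prop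
  V : ℕ → (ℕ → M) → M → Prop
  hψ : Dfn L (fun v : Unit → M => ψ (v ()))
  hθ : Dfn L (fun v : Unit → M => θ (v ()))
  hV : ∀ r, Dfn L (fun v : ℕ ⊕ Unit → M => V r (fun i => v (Sum.inl i)) (v (Sum.inr ())))
  total : ∀ r x, ∃ w, V r x w

namespace TreeSpec

variable (D : TreeSpec L M)

/-- The requirement on a single node `(a, w)` at level `r` above the path `x`. -/
def Node (J : Finset ℕ) (r : ℕ) (x q : ℕ → M) (a w : M) : Prop :=
  D.ψ a ∧ ¬ D.θ a ∧ (∀ k < 2 * r, a ≠ x k) ∧ D.V r x w ∧ (r ∈ J → w = q r) ∧ (r ∉ J → ¬ D.θ w)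

/-- Extending a path by the node `(a, w)` at level `r`. -/
def ext (r : ℕ) (x : ℕ → M) (a w : M) : ℕ → M :=
  fun k => if k = 2 * r then a else if k = 2 * r + 1 then w else x k

/-- `d` is a correct tree of height `h` above the path `x` of length `r`. -/
def RT (J : Finset ℕ) : ℕ → ℕ → (ℕ → M) → (ℕ → M) → (List Bool × Bool → M) → Prop
  | 0, r, x, q, d => D.Node J r x q (d ([], false)) (d ([], true))
  | h + 1, r, x, q, d => D.Node J r x q (d ([], false)) (d ([], true)) ∧
      (∀ b, RT J h (r + 1) (ext r x (d ([], false)) (d ([], true))) q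
        (fun t => d (b :: t.1, t.2))) ∧
      ∀ (b : Bool) (u : List Bool) (c : Bool), u.length ≤ h → d ([b], false) ≠ d ((!b) :: u, c)

theorem dfn_node (J : Finset ℕ) (r : ℕ) {γ : Type} (fx fq : ℕ → γ) (fa fw : γ) :
    Dfn L (fun v : γ → M =>
      D.Node J r (fun i => v (fx i)) (fun i => v (fq i)) (v fa) (v fw)) := by
  refine (Dfn.comp D.hψ fun _ => fa).and ((Dfn.comp D.hθ fun _ => fa).not.and (UDf.and ?_
    ((Dfn.comp (D.hV r) (Sum.elim fx fun _ => fw)).and (UDf.and ?_ ?_))))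
  · refine (UDf.iInf (κ := Fin (2 * r)) fun k => (UDf.eq_var fa (fx k)).not).congr fun _ v => ?_
    exact ⟨fun h k hk => h ⟨k, hk⟩, fun h k => h k k.2⟩
  · exact (UDf.const _).imp (UDf.eq_var _ _)
  · exact (UDf.const _).imp (Dfn.comp D.hθ fun _ => fw).not

theorem finite_short (h : ℕ) : {p : List Bool × Bool | p.1.length ≤ h}.Finite := by
  have := (List.finite_length_le Bool h).prod (Set.finite_univ (α := Bool))
  exact this.subset fun p hp => ⟨hp, Set.mem_univ _⟩

theorem dfn_RT (J : Finset ℕ) (h : ℕ) : ∀ r, Dfn L (fun v : (ℕ ⊕ ℕ) ⊕ (List Bool × Bool) → M =>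
    D.RT J h r (fun i => v (Sum.inl (Sum.inl i))) (fun i => v (Sum.inl (Sum.inr i)))
      (fun t => v (Sum.inr t))) := by
  induction h with
  | zero => exact fun r => D.dfn_node J r _ _ _ _
  | succ h ih =>
    intro r
    refine (D.dfn_node J r _ _ _ _).and (UDf.and (UDf.iInf fun b => ?_) ?_)
    · refine (Dfn.comp (ih (r + 1)) (Sum.elim (Sum.elim
        (fun k => if k = 2 * r then Sum.inr ([], false) else
          if k = 2 * r + 1 then Sum.inr ([], true) else Sum.inl (Sum.inl k))
        (fun k => Sum.inl (Sum.inr k))) (fun t => Sum.inr (b :: t.1, t.2)))).congr fun _ v => ?_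
      have : (fun i => v (if i = 2 * r then Sum.inr ([], false) else
          if i = 2 * r + 1 then Sum.inr ([], true) else Sum.inl (Sum.inl i))) =
          ext r (fun i => v (Sum.inl (Sum.inl i))) (v (Sum.inr ([], false)))
            (v (Sum.inr ([], true))) := by
        funext k
        simp only [ext, apply_ite v]
      simp only [Sum.elim_inl, Sum.elim_inr, this]
    · have := (finite_short h).to_subtype
      refine (UDf.iInf (κ := Bool × {p : List Bool × Bool | p.1.length ≤ h}) fun p =>
        (UDf.eq_var (Sum.inr ([p.1], false)) (Sum.inr ((!p.1) :: p.2.1.1, p.2.1.2))).not).congr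
        fun _ v => ?_
      exact ⟨fun H b u c hu => H (b, ⟨(u, c), hu⟩), fun H p => H p.1 p.2.1.1 p.2.1.2 p.2.2⟩

/-- `a` is the root of a tree of height `h` above `x`. -/
def Root (J : Finset ℕ) (h r : ℕ) (x q : ℕ → M) (a : M) : Prop :=
  ∃ d, D.RT J h r x q d ∧ d ([], false) = a

theorem dfn_root (J : Finset ℕ) (h r : ℕ) (x : ℕ → M) :
    Dfn L (fun v : ℕ ⊕ Unit → M => D.Root J h r x (fun i => v (Sum.inl i)) (v (Sum.inr ()))) := by
  by_cases hM : Nonempty M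
  · have h1 : Dfn L (fun v : (ℕ ⊕ Unit) ⊕ (List Bool × Bool) → M =>
        D.RT J h r x (fun i => v (Sum.inl (Sum.inl i))) (fun t => v (Sum.inr t)) ∧
          v (Sum.inr ([], false)) = v (Sum.inl (Sum.inr ()))) :=
      (Dfn.subst (D.dfn_RT J h r) (Sum.elim (Sum.elim (fun k => Sum.inl (x k))
        (fun k => Sum.inr (Sum.inl (Sum.inl k)))) (fun t => Sum.inr (Sum.inr t)))).and
        (UDf.eq_var _ _)
    exact UDf.exInf (A := selfPt L M) (fun _ => hM) h1
  · exact (UDf.const True).congr fun _ v => (hM ⟨v (Sum.inr ())⟩).elim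

/-- The number of nodes of a tree of height `h`. -/
noncomputable def size (h : ℕ) : ℕ := {p : List Bool × Bool | p.1.length ≤ h}.ncard

theorem exists_forest (J : Finset ℕ) (h r : ℕ) (x q : ℕ → M)
    (hp : ¬ AtMost (size h * (size h + 1)) (D.Root J h r x q)) :
    ∃ d : Bool → List Bool × Bool → M, (∀ b, D.RT J h r x q (d b)) ∧
      ∀ (b : Bool) (u : List Bool) (c : Bool), u.length ≤ h → d b ([], false) ≠ d (!b) (u, c) := by
  classical
  set m := size h with hm
  set F : Finset (List Bool × Bool) := (finite_short h).toFinset with hF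
  have hFm : F.card = m := by
    rw [hm, size, Set.ncard_eq_toFinset_card _ (finite_short h)]
  have hmem : ∀ u c, u.length ≤ h → ((u, c) : List Bool × Bool) ∈ F := by
    intro u c hu
    simpa [hF] using hu
  simp only [AtMost, not_forall, not_exists] at hp
  obtain ⟨w, hw, hinj⟩ := hp
  have hwi : Function.Injective w := by
    intro i j hij
    by_contra hne
    exact hinj i j ⟨hne, hij⟩
  choose d hd using hw
  let P : Finset (Fin (m * (m + 1) + 1)) := Finset.univ
  obtain ⟨F0, -, hF0⟩ := Finset.exists_subset_card_eq (s := P) (n := m + 1) (by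
    simp only [P, Finset.card_univ, Fintype.card_fin]; nlinarith)
  let U : Finset M := F0.biUnion fun i => F.image (d i)
  have hU : U.card ≤ m * (m + 1) := by
    refine Finset.card_biUnion_le.trans ?_
    refine (Finset.sum_le_card_nsmul _ _ m fun i _ => ?_).trans ?_
    · exact Finset.card_image_le.trans hFm.le
    · rw [hF0, smul_eq_mul, mul_comm]
  obtain ⟨j, hj⟩ : ∃ j, w j ∉ U := by
    by_contra hcon
    push Not at hcon
    have h1 : (P.image w) ⊆ U := by
      intro y hy
      obtain ⟨i, -, rfl⟩ := Finset.mem_image.1 hy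
      exact hcon i
    have h2 := Finset.card_le_card h1
    rw [Finset.card_image_of_injective _ hwi] at h2
    simp only [P, Finset.card_univ, Fintype.card_fin] at h2
    omega
  obtain ⟨i, hi, hij⟩ : ∃ i ∈ F0, w i ∉ F.image (d j) := by
    by_contra hcon
    push Not at hcon
    have h1 : (F0.image w) ⊆ F.image (d j) := by
      intro y hy
      obtain ⟨i, hi, rfl⟩ := Finset.mem_image.1 hy
      exact hcon i hi
    have h2 := (Finset.card_le_card h1).trans Finset.card_image_le
    rw [Finset.card_image_of_injective _ hwi, hF0] at h2
    omega
  refine ⟨fun b => if b then d i else d j, fun b => ?_, fun b u c hu => ?_⟩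
  · cases b
    · exact (hd j).1
    · exact (hd i).1
  · cases b
    · simp only [Bool.false_eq_true, if_false, Bool.not_false, if_true]
      rw [(hd j).2]
      intro heq
      exact hj (Finset.mem_biUnion.2 ⟨i, hi, Finset.mem_image.2 ⟨_, hmem u c hu, heq.symm⟩⟩)
    · simp only [Bool.false_eq_true, if_false, Bool.not_true, if_true]
      rw [(hd i).2]
      intro heq
      exact hij (Finset.mem_image.2 ⟨_, hmem u c hu, heq.symm⟩)

/-- An element generic enough to start every kind of tree it starts in many ways. -/
theorem exists_good (hne : ∃ m, D.θ m) (hs : ¬ Small L D.θ {a | D.ψ a}) (n h r : ℕ)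
    (x : ℕ → M) : ∃ a w, D.ψ a ∧ ¬ D.θ a ∧ (∀ k < 2 * r, a ≠ x k) ∧ D.V r x w ∧
      ∀ J ⊆ Finset.range n, ∀ q, (∀ i, D.θ (q i)) → D.Root J h r x q a →
        ¬ AtMost (size h * (size h + 1)) (D.Root J h r x q) := by
  classical
  by_contra hcon
  push Not at hcon
  refine hs ((((Small.self (L := L) (θ := D.θ)).union (Small.of_finite hne
    (X := x '' Set.Iio (2 * r)) ((Set.finite_Iio _).image x))).union
    (Small.biUnion hne (Finset.range n).powerset fun J _ =>
      Small.of_datum (size h * (size h + 1)) (D.dfn_root J h r x))).mono fun a ha => ?_)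
  by_cases h1 : D.θ a
  · exact Or.inl (Or.inl h1)
  by_cases h2 : a ∈ x '' Set.Iio (2 * r)
  · exact Or.inl (Or.inr h2)
  obtain ⟨w, hw⟩ := D.total r x
  obtain ⟨J, hJ, q, hq, h3, h4⟩ := hcon a w ha h1 (fun k hk he => h2 ⟨k, hk, he.symm⟩) hw
  exact Or.inr ⟨J, Finset.mem_powerset.2 hJ, q, hq, h3, h4⟩

theorem exists_tree (hne : ∃ m, D.θ m) (hs : ¬ Small L D.θ {a | D.ψ a}) (n : ℕ) (x₀ : ℕ → M) :
    ∃ (J : Finset ℕ) (q : ℕ → M) (d : Bool → List Bool × Bool → M),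
      (∀ b, D.RT J n 0 x₀ q (d b)) ∧
      ∀ (b : Bool) (u : List Bool) (c : Bool), u.length ≤ n → d b ([], false) ≠ d (!b) (u, c) := by
  classical
  choose a w h1 h2 h3 h4 h5 using D.exists_good hne hs (n + 1)
  let X : ℕ → ℕ → M := fun r => Nat.rec x₀ (fun r x => ext r x (a (n - r) r x) (w (n - r) r x)) r
  have hX : ∀ r, X (r + 1) = ext r (X r) (a (n - r) r (X r)) (w (n - r) r (X r)) := fun r => rfl
  let A : ℕ → M := fun r => a (n - r) r (X r)
  let W : ℕ → M := fun r => w (n - r) r (X r)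
  obtain ⟨t0, ht0⟩ := hne
  let J : Finset ℕ := (Finset.range (n + 1)).filter fun r => D.θ (W r)
  let q : ℕ → M := fun r => if D.θ (W r) then W r else t0
  have hq : ∀ i, D.θ (q i) := by
    intro i
    by_cases h : D.θ (W i)
    · simp [q, h]
    · simp [q, h, ht0]
  have hnode : ∀ r ≤ n, D.Node J r (X r) q (A r) (W r) := by
    intro r hr
    refine ⟨h1 _ _ _, h2 _ _ _, h3 _ _ _, h4 _ _ _, fun h => ?_, fun h hw => h ?_⟩
    · simp [q, (Finset.mem_filter.1 h).2]
    · exact Finset.mem_filter.2 ⟨Finset.mem_range.2 (by omega), hw⟩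
  have main : ∀ h r, h + r = n → ∃ d : Bool → List Bool × Bool → M,
      (∀ b, D.RT J h r (X r) q (d b)) ∧
      ∀ (b : Bool) (u : List Bool) (c : Bool), u.length ≤ h → d b ([], false) ≠ d (!b) (u, c) := by
    intro h
    induction h with
    | zero =>
      intro r hr
      have hr' : 0 = n - r := by omega
      have hroot : D.Root J 0 r (X r) q (A r) :=
        ⟨fun p => if p.2 then W r else A r, hnode r (by omega), rfl⟩
      refine D.exists_forest J 0 r (X r) q ?_
      rw [hr'] at hroot ⊢
      exact h5 _ _ _ J (Finset.filter_subset _ _) q hq hroot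
    | succ h ih =>
      intro r hr
      obtain ⟨d, hd, hd'⟩ := ih (r + 1) (by omega)
      have hr' : h + 1 = n - r := by omega
      have hroot : D.Root J (h + 1) r (X r) q (A r) := by
        refine ⟨fun p => match p.1 with
          | [] => if p.2 then W r else A r
          | b :: t => d b (t, p.2), ⟨hnode r (by omega), hd, hd'⟩, rfl⟩
      refine D.exists_forest J (h + 1) r (X r) q ?_
      rw [hr'] at hroot ⊢
      exact h5 _ _ _ J (Finset.filter_subset _ _) q hq hroot
  exact ⟨J, q, main n 0 (by omega)⟩

theorem RT.node {D : TreeSpec L M} {J : Finset ℕ} {h : ℕ} : ∀ {r : ℕ} {x q : ℕ → M}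
    {d : List Bool × Bool → M}, D.RT J h r x q d → ∀ s : List Bool, s.length ≤ h →
    D.Node J (r + s.length) (fun k => if k < 2 * r then x k else
      if k < 2 * (r + s.length) then d (s.take (k / 2 - r), decide (k % 2 = 1)) else x k) q
      (d (s, false)) (d (s, true)) := by
  have base : ∀ r (x : ℕ → M) (d : List Bool × Bool → M), (fun k => if k < 2 * r then x k else
      if k < 2 * (r + ([] : List Bool).length) then
        d (([] : List Bool).take (k / 2 - r), decide (k % 2 = 1)) else x k) = x := by
    intro r x d
    funext k
    simp only [List.length_nil, add_zero]
    split_ifs <;> rfl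
  induction h with
  | zero =>
    intro r x q d hd s hs
    have : s = [] := List.length_eq_zero_iff.1 (by omega)
    subst this
    rw [base]
    exact hd
  | succ h ih =>
    intro r x q d hd s hs
    cases s with
    | nil =>
      rw [base]
      exact hd.1
    | cons b s =>
      have := ih (hd.2.1 b) s (by simpa using hs)
      have e : r + 1 + s.length = r + (b :: s).length := by simp; omega
      rw [e] at this
      convert this using 1
      funext k
      simp only [ext]
      by_cases h1 : k < 2 * r
      · have h2 : k < 2 * (r + 1) := by omega
        have h3 : k ≠ 2 * r := by omega
        have h4 : k ≠ 2 * r + 1 := by omega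
        simp [h1, h2, h3, h4]
      by_cases h2 : k < 2 * (r + 1)
      · have h5 : k < 2 * (r + (b :: s).length) := by simp; omega
        rw [if_neg h1, if_pos h5, if_pos h2]
        obtain rfl | rfl : k = 2 * r ∨ k = 2 * r + 1 := by omega
        · simp
        · rw [if_neg (by omega), if_pos rfl]
          have : (2 * r + 1) / 2 - r = 0 := by omega
          rw [this]
          have : (2 * r + 1) % 2 = 1 := by omega
          simp [this]
      · rw [if_neg h1, if_neg h2]
        have h3 : k ≠ 2 * r := by omega
        have h4 : k ≠ 2 * r + 1 := by omega
        rw [if_neg h3, if_neg h4]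
        have : k / 2 - r = (k / 2 - (r + 1)) + 1 := by omega
        rw [this, List.take_succ_cons]

theorem RT.ne {D : TreeSpec L M} {J : Finset ℕ} {h : ℕ} : ∀ {r : ℕ} {x q : ℕ → M}
    {d : List Bool × Bool → M}, D.RT J h r x q d → ∀ (t : List Bool) (b : Bool) (u : List Bool)
    (c : Bool), t.length + 1 + u.length ≤ h → d (t ++ [b], false) ≠ d (t ++ (!b) :: u, c) := by
  induction h with
  | zero => intro r x q d _ t b u c hl; omega
  | succ h ih =>
    intro r x q d hd t b u c hl
    cases t with
    | nil => exact hd.2.2 b u c (by simp at hl; omega)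
    | cons b' t => exact ih (hd.2.1 b') t b u c (by simp at hl; omega)

/-- The path of nodes below `σ`. -/
def path (x₀ : ℕ → M) (d : List Bool × Bool → M) (σ : List Bool) : ℕ → M :=
  fun k => if k < 2 * (σ.length - 1) then d (σ.take (k / 2 + 1), decide (k % 2 = 1)) else x₀ k

/-- A correct finite tree, described pointwise. -/
structure Good (x₀ : ℕ → M) (n : ℕ) (d : List Bool × Bool → M) : Prop where
  ψ : ∀ σ, σ ≠ [] → σ.length ≤ n → D.ψ (d (σ, false))
  θ : ∀ σ, σ ≠ [] → σ.length ≤ n → ¬ D.θ (d (σ, false))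
  path : ∀ σ, σ ≠ [] → σ.length ≤ n → ∀ k < 2 * (σ.length - 1),
    d (σ, false) ≠ path x₀ d σ k
  V : ∀ σ, σ ≠ [] → σ.length ≤ n → D.V (σ.length - 1) (TreeSpec.path x₀ d σ) (d (σ, true))
  eq : ∀ σ τ, σ ≠ [] → σ.length ≤ n → τ.length = σ.length → D.θ (d (σ, true)) →
    d (τ, true) = d (σ, true)
  ne : ∀ t b u c, t.length + 1 + u.length ≤ n → d (t ++ [b], false) ≠ d (t ++ (!b) :: u, c)

theorem exists_flat (hne : ∃ m, D.θ m) (hs : ¬ Small L D.θ {a | D.ψ a}) (n : ℕ) (x₀ : ℕ → M) :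
    ∃ d, D.Good x₀ n d := by
  cases n with
  | zero =>
    have h0 : ∀ σ : List Bool, σ ≠ [] → σ.length ≤ 0 → False := by
      intro σ h1 h2
      exact h1 (List.length_eq_zero_iff.1 (by omega))
    exact ⟨fun _ => x₀ 0, fun σ h1 h2 => (h0 σ h1 h2).elim, fun σ h1 h2 => (h0 σ h1 h2).elim,
      fun σ h1 h2 => (h0 σ h1 h2).elim, fun σ h1 h2 => (h0 σ h1 h2).elim,
      fun σ _ h1 h2 => (h0 σ h1 h2).elim, fun t b u c h => by omega⟩
  | succ n =>
    obtain ⟨J, q, d, hd, hd'⟩ := D.exists_tree hne hs n x₀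
    let dd : List Bool × Bool → M := fun p => match p.1 with
      | [] => x₀ 0
      | b :: t => d b (t, p.2)
    have hnode : ∀ σ, σ ≠ [] → σ.length ≤ n + 1 →
        D.Node J (σ.length - 1) (path x₀ dd σ) q (dd (σ, false)) (dd (σ, true)) := by
      intro σ h1 h2
      cases σ with
      | nil => exact (h1 rfl).elim
      | cons b s =>
        have := (hd b).node s (by simpa using h2)
        rw [zero_add] at this
        have e : path x₀ dd (b :: s) = fun k => if k < 2 * 0 then x₀ k else
            if k < 2 * s.length then d b (s.take (k / 2 - 0), decide (k % 2 = 1)) else x₀ k := by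
          funext k
          simp [path, dd]
        rw [e]
        exact this
    refine ⟨dd, fun σ h1 h2 => (hnode σ h1 h2).1, fun σ h1 h2 => (hnode σ h1 h2).2.1,
      fun σ h1 h2 => (hnode σ h1 h2).2.2.1, fun σ h1 h2 => (hnode σ h1 h2).2.2.2.1,
      fun σ τ h1 h2 h3 h4 => ?_, fun t b u c hl => ?_⟩
    · have hτ : τ ≠ [] := by
        rintro rfl
        exact h1 (List.length_eq_zero_iff.1 h3.symm)
      have hj : σ.length - 1 ∈ J := by
        by_contra hj
        exact (hnode σ h1 h2).2.2.2.2.2 hj h4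
      have e1 := (hnode σ h1 h2).2.2.2.2.1 hj
      have e2 := (hnode τ hτ (by omega)).2.2.2.2.1 (by rw [h3]; exact hj)
      rw [e1, e2, h3]
    · cases t with
      | nil => exact hd' b u c (by simp at hl; omega)
      | cons b' t => exact (hd b').ne t b u c (by simp at hl; omega)

end TreeSpec

end FinTree

/-! ## The tree theorem -/

section TV

variable {L : FirstOrder.Language}

/-- The Tarski–Vaught test for subsets of a coded structure. -/
theorem exists_elemSub (N : CodedStructure L) (A : Set ℕ) (hA : A ⊆ N.carrier)
    (H : ∀ (k : ℕ) (χ : L.Formula (Fin (k + 1))) (t : Fin k → N.carrier) (x : N.carrier),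
      (∀ i, (t i : ℕ) ∈ A) → χ.Realize (Fin.cons x t : Fin (k + 1) → N.carrier) →
        ∃ y : N.carrier, (y : ℕ) ∈ A ∧ χ.Realize (Fin.cons y t : Fin (k + 1) → N.carrier)) :
    ∃ M : CodedStructure L, M.carrier = A ∧ ElemSub M N := by
  let S : L.Substructure N.carrier := ⟨{x | (x : ℕ) ∈ A}, by
    intro k f x hx
    obtain ⟨y, hy, h⟩ := H k (Term.equal (Term.var 0) (Term.func f fun i => Term.var i.succ)) x
      (Structure.funMap f x) hx (by simp)
    simp at h
    rw [← h]
    exact hy⟩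
  have hS : S.IsElementary := by
    refine S.isElementary_of_exists fun k φ x a ha => ?_
    let χ : L.Formula (Fin (k + 1)) :=
      φ.toFormula.relabel (Sum.elim Empty.elim (Fin.lastCases 0 Fin.succ))
    have hχ : ∀ (a : N.carrier) (y : Fin k → N.carrier),
        χ.Realize (Fin.cons a y : Fin (k + 1) → N.carrier) ↔
        φ.Realize default (Fin.snoc y a : Fin (k + 1) → N.carrier) := by
      intro a y
      rw [Formula.realize_relabel, BoundedFormula.realize_toFormula]
      have e1 : (((Fin.cons a y : Fin (k + 1) → N.carrier) ∘
        Sum.elim Empty.elim (Fin.lastCases 0 Fin.succ)) ∘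
        Sum.inl : Empty → N.carrier) = default := Subsingleton.elim _ _
      have e2 : (((Fin.cons a y : Fin (k + 1) → N.carrier) ∘
        Sum.elim Empty.elim (Fin.lastCases 0 Fin.succ)) ∘
        Sum.inr : Fin (k + 1) → N.carrier) = Fin.snoc y a := by
        funext i
        refine Fin.lastCases ?_ (fun i => ?_) i <;> simp
      rw [e1, e2]
    obtain ⟨y, hy, h⟩ := H k χ (fun i => x i) a (fun i => (x i).2) ((hχ _ _).2 ha)
    exact ⟨⟨y, hy⟩, (hχ _ _).1 h⟩
  let E : A ≃ S := ⟨fun a => ⟨⟨a, hA a.2⟩, a.2⟩, fun s => ⟨s.1.1, s.2⟩, fun _ => rfl, fun _ => rfl⟩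
  let _ : L.Structure A := E.symm.inducedStructure
  let e : S ≃[L] A := E.symm.inducedStructureEquiv
  let j : A ↪ₑ[L] N.carrier :=
    (ElementarySubstructure.subtype ⟨S, hS⟩).comp e.symm.toElementaryEmbedding
  refine ⟨⟨A, N.compl_infinite.mono (Set.compl_subset_compl.2 hA), inferInstance⟩, rfl, hA, ?_⟩
  intro k φ a
  exact (j.map_formula φ a).symm

end TV

section Stage

variable {L : FirstOrder.Language} {g : GoedelCoding L} {M₀ : CodedStructure L}

theorem dfn_sat {γ : Type} (c : ℕ) (l : List γ) :
    Dfn L (fun v : γ → M₀.carrier => Sat g M₀ c (l.map fun i => (v i : ℕ))) := by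
  by_cases h : ∃ φ : L.Formula (Fin l.length), c = fc g φ
  · obtain ⟨φ, rfl⟩ := h
    refine (UDf.formula (A := selfPt L M₀.carrier) φ (fun i => Sum.inr (l.get i))).congr
      fun _ v => ?_
    have : l.map (fun i => (v i : ℕ)) = vals fun i : Fin l.length => v (l.get i) := by
      refine List.ext_getElem (by simp) fun i h1 h2 => ?_
      simp [vals]
    rw [this]
    exact sat_iff.symm
  · refine UDf.false.congr fun _ v => ?_
    simp only [false_iff]
    rintro ⟨k, φ, a, rfl, e, -⟩
    have : l.length = k := by simpa using congrArg List.length e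
    subst this
    exact h ⟨φ, rfl⟩

/-- The requirement at level `r` of stage `n`: name an element, a term of a sequence, or a witness
for an existential formula about earlier elements of the path. -/
def Req (g : GoedelCoding L) (M₀ : CodedStructure L) (e : ℕ → ℕ → M₀.carrier)
    (n r : ℕ) (x : ℕ → ℕ) (w : ℕ) : Prop :=
  (r.unpair.1.unpair.1 = 0 → r.unpair.1.unpair.2 ∈ M₀.carrier → w = r.unpair.1.unpair.2) ∧
  (r.unpair.1.unpair.1 = 1 → w = e r.unpair.1.unpair.2 n) ∧
  (r.unpair.1.unpair.1 = 2 →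
    (∃ y, Sat g M₀ r.unpair.1.unpair.2.unpair.1
      (y :: (Denumerable.ofNat (List ℕ) r.unpair.1.unpair.2.unpair.2).map x)) →
    Sat g M₀ r.unpair.1.unpair.2.unpair.1
      (w :: (Denumerable.ofNat (List ℕ) r.unpair.1.unpair.2.unpair.2).map x))

/-- The specification of the finite tree at stage `n`. -/
def stageSpec (g : GoedelCoding L) (ψ θ : L.Formula (M₀.carrier ⊕ Unit)) (m₀ : M₀.carrier)
    (e : ℕ → ℕ → M₀.carrier) (n : ℕ) : TreeSpec L M₀.carrier where
  ψ x := ψ.Realize (Sum.elim (fun x => x) fun _ => x)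
  θ x := θ.Realize (Sum.elim (fun x => x) fun _ => x)
  V r x w := Req g M₀ e n r (fun i => x i) w
  hψ := (UDf.formula (A := selfPt L M₀.carrier) ψ id).congr fun _ v => by
    refine iff_of_eq (congrArg _ ?_)
    funext x
    rcases x with x | x <;> rfl
  hθ := (UDf.formula (A := selfPt L M₀.carrier) θ id).congr fun _ v => by
    refine iff_of_eq (congrArg _ ?_)
    funext x
    rcases x with x | x <;> rfl
  hV r := by
    have hc : ∀ m : M₀.carrier, Dfn L (fun v : ℕ ⊕ Unit → M₀.carrier =>
        (v (Sum.inr ()) : ℕ) = m) := fun m =>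
      (UDf.eq_const (A := selfPt L M₀.carrier) (Sum.inr ()) m).congr fun _ v => Subtype.ext_iff
    have hs : ∀ c (l : List ℕ), Dfn L (fun v : ℕ ⊕ Unit → M₀.carrier =>
        Sat g M₀ c ((v (Sum.inr ()) : ℕ) :: l.map fun i => (v (Sum.inl i) : ℕ))) := fun c l =>
      (dfn_sat (g := g) c (Sum.inr () :: l.map Sum.inl)).congr fun _ v => by simp [Function.comp_def]
    change Dfn L fun v : ℕ ⊕ Unit → M₀.carrier =>
      Req g M₀ e n r (fun i => v (Sum.inl i)) (v (Sum.inr ()))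
    unfold Req
    refine UDf.and ?_ (UDf.and ((UDf.const _).imp (hc _)) ((UDf.const _).imp (UDf.imp ?_ (hs _ _))))
    · refine (UDf.const _).imp ?_
      by_cases h : r.unpair.1.unpair.2 ∈ M₀.carrier
      · exact (UDf.const _).imp (hc ⟨_, h⟩)
      · exact UDf.true.congr fun _ v => by simp [h]
    · have h1 := UDf.ex1 (A := selfPt L M₀.carrier) (α := ℕ ⊕ Unit)
        (P := fun _ v y => Sat g M₀ r.unpair.1.unpair.2.unpair.1 ((y : ℕ) ::
          (Denumerable.ofNat (List ℕ) r.unpair.1.unpair.2.unpair.2).map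
            fun i => (v (Sum.inl i) : ℕ)))
        (Dfn.comp (hs _ _) (Sum.elim (fun i => Sum.inl (Sum.inl i)) Sum.inr))
      refine h1.congr fun _ v => ?_
      constructor
      · rintro ⟨y, hy⟩
        exact ⟨y, hy⟩
      · rintro ⟨y, hy⟩
        exact ⟨⟨y, hy.mem (by simp)⟩, hy⟩
  total r x := by
    by_cases h0 : r.unpair.1.unpair.1 = 0 ∧ r.unpair.1.unpair.2 ∈ M₀.carrier
    · exact ⟨⟨_, h0.2⟩, fun _ _ => rfl, fun h => by omega, fun h => by omega⟩
    by_cases h1 : r.unpair.1.unpair.1 = 1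
    · exact ⟨e r.unpair.1.unpair.2 n, fun h => by omega, fun _ => rfl, fun h => by omega⟩
    by_cases h2 : ∃ y, Sat g M₀ r.unpair.1.unpair.2.unpair.1
      (y :: (Denumerable.ofNat (List ℕ) r.unpair.1.unpair.2.unpair.2).map fun i => (x i : ℕ))
    · obtain ⟨y, hy⟩ := h2
      exact ⟨⟨y, hy.mem (by simp)⟩, fun h h' => (h0 ⟨h, h'⟩).elim, fun h => (h1 h).elim,
        fun _ _ => hy⟩
    · exact ⟨m₀, fun h h' => (h0 ⟨h, h'⟩).elim, fun h => (h1 h).elim, fun _ h => (h2 h).elim⟩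

/-- The index of a node in a table. -/
def nd (σ : List Bool) (b : ℕ) : ℕ := 2 * Encodable.encode σ + b

@[fun_prop]
theorem ArF.nd {α : Type} [Primcodable α] {Y : Set ℕ} {f : α → List Bool} {b : α → ℕ}
    (hf : ArF Y f) (hb : ArF Y b) : ArF Y (fun a => nd (f a) (b a)) := by
  unfold ArMorley.nd
  fun_prop

@[fun_prop]
theorem ArF.div {α : Type} [Primcodable α] {Y : Set ℕ} {f b : α → ℕ}
    (hf : ArF Y f) (hb : ArF Y b) : ArF Y (fun a => f a / b a) :=
  ArF.of_primrec₂ Primrec.nat_div hf hb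

@[fun_prop]
theorem ArF.mod {α : Type} [Primcodable α] {Y : Set ℕ} {f b : α → ℕ}
    (hf : ArF Y f) (hb : ArF Y b) : ArF Y (fun a => f a % b a) :=
  ArF.of_primrec₂ Primrec.nat_mod hf hb

/-- The tree of elements listed in a table. -/
def tblTree (m₀ : M₀.carrier) (D : List ℕ) (h : ∀ y ∈ D, y ∈ M₀.carrier) :
    List Bool × Bool → M₀.carrier :=
  fun p => ⟨D.getD (nd p.1 p.2.toNat) m₀, by
    rw [List.getD_eq_getElem?_getD]
    cases h' : D[nd p.1 p.2.toNat]? with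
    | none => exact m₀.2
    | some y => exact h y (List.mem_of_getElem? h')⟩

theorem exists_table (d : List Bool × Bool → M₀.carrier) (n : ℕ) (m₀ : M₀.carrier) :
    ∃ (D : List ℕ) (h : ∀ y ∈ D, y ∈ M₀.carrier), ∀ σ b, σ.length ≤ n →
      tblTree m₀ D h (σ, b) = d (σ, b) := by
  obtain ⟨B, hB⟩ : ∃ B, ∀ σ : List Bool, σ.length ≤ n → Encodable.encode σ < B := by
    obtain ⟨B, hB⟩ := ((List.finite_length_le Bool n).image Encodable.encode).bddAbove
    exact ⟨B + 1, fun σ h => Nat.lt_succ_of_le (hB ⟨σ, h, rfl⟩)⟩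
  refine ⟨(List.range (2 * B)).map fun i =>
    (d (((Encodable.decode (i / 2) : Option (List Bool)).getD []), decide (i % 2 = 1)) : ℕ), ?_, ?_⟩
  · intro y hy
    obtain ⟨i, -, rfl⟩ := List.mem_map.1 hy
    exact Subtype.coe_prop _
  · intro σ b h
    have hb : b.toNat ≤ 1 := by cases b <;> simp
    have h1 : nd σ b.toNat < 2 * B := by
      have := hB σ h
      unfold nd
      omega
    apply Subtype.ext
    simp only [tblTree]
    rw [List.getD_eq_getElem?_getD, List.getElem?_map, List.getElem?_range h1]
    have h2 : nd σ b.toNat / 2 = Encodable.encode σ := by unfold nd; omega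
    have h3 : decide (nd σ b.toNat % 2 = 1) = b := by
      have : nd σ b.toNat % 2 = b.toNat := by unfold nd; omega
      rw [this]
      cases b <;> simp
    simp [h2, h3]

theorem TreeSpec.Good.congr {M : Type} [L.Structure M] {D : TreeSpec L M} {x₀ : ℕ → M} {n : ℕ}
    {d d' : List Bool × Bool → M} (h : D.Good x₀ n d)
    (e : ∀ σ b, σ.length ≤ n → d' (σ, b) = d (σ, b)) : D.Good x₀ n d' := by
  have hp : ∀ σ : List Bool, σ.length ≤ n → TreeSpec.path x₀ d' σ = TreeSpec.path x₀ d σ := by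
    intro σ hσ
    funext k
    unfold TreeSpec.path
    rw [e (σ.take (k / 2 + 1)) _ ((List.length_take_le' _ _).trans hσ)]
  refine ⟨fun σ h1 h2 => ?_, fun σ h1 h2 => ?_, fun σ h1 h2 => ?_, fun σ h1 h2 => ?_,
    fun σ τ h1 h2 h3 => ?_, fun t b u c h1 => ?_⟩
  · rw [e _ _ h2]; exact h.ψ σ h1 h2
  · rw [e _ _ h2]; exact h.θ σ h1 h2
  · rw [e _ _ h2, hp _ h2]; exact h.path σ h1 h2
  · rw [e _ _ h2, hp _ h2]; exact h.V σ h1 h2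
  · rw [e _ _ h2, e _ _ (h3.trans_le h2)]; exact h.eq σ τ h1 h2 h3
  · rw [e _ _ (by simp; omega), e _ _ (by simp; omega)]; exact h.ne t b u c h1

theorem exists_stages (h₀ : ArithDecidable g M₀) (ψ θ : L.Formula (M₀.carrier ⊕ Unit))
    (m₀ : M₀.carrier) (e : ℕ → ℕ → M₀.carrier) (he : ArF ∅ fun x : ℕ × ℕ => (e x.1 x.2 : ℕ))
    (H : ∀ n, ∃ d, (stageSpec g ψ θ m₀ e n).Good (fun _ => m₀) n d) :
    ∃ F : ℕ → ℕ → M₀.carrier, (ArF ∅ fun x : ℕ × ℕ => (F x.1 x.2 : ℕ)) ∧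
      ∀ n, (stageSpec g ψ θ m₀ e n).Good (fun _ => m₀) n (fun p => F (nd p.1 p.2.toNat) n) := by
  have hC := h₀.carrier
  have hψ := h₀.definable1 ψ
  have hθ := h₀.definable1 θ
  have hS := h₀.sat
  let p : ℕ → List ℕ → Prop := fun n D => ∃ h, (stageSpec g ψ θ m₀ e n).Good (fun _ => m₀) n
    (tblTree m₀ D h)
  let X : List ℕ → List Bool → ℕ → ℕ := fun D σ k =>
    if k < 2 * (σ.length - 1) then D.getD (nd (σ.take (k / 2 + 1)) (k % 2)) m₀ else m₀
  have hX : ArF ∅ (fun x : (List ℕ × List Bool) × ℕ => X x.1.1 x.1.2 x.2) :=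
    Ar.ite (Ar.lt (by fun_prop) (by fun_prop)) (by fun_prop) (by fun_prop)
  have hXp : ∀ D h σ k, ((TreeSpec.path (fun _ => m₀) (tblTree m₀ D h) σ k : M₀.carrier) : ℕ) = X D σ k := by
    intro D h σ k
    simp only [TreeSpec.path, X]
    have : (decide (k % 2 = 1)).toNat = k % 2 := by
      rcases Nat.mod_two_eq_zero_or_one k with h | h <;> simp [h]
    split_ifs
    · exact congrArg (fun i => D.getD (nd (σ.take (k / 2 + 1)) i) (m₀ : ℕ)) this
    · rfl
  have hR : Ar ∅ (fun x : (ℕ × ℕ) × (List ℕ × List Bool) × ℕ =>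
      Req g M₀ e x.1.1 x.1.2 (X x.2.1.1 x.2.1.2) x.2.2) := by
    have hl : ArF ∅ (fun x : (List ℕ × List Bool) × ℕ =>
        (Denumerable.ofNat (List ℕ) x.2).map (X x.1.1 x.1.2)) := by
      refine ArF.map (f := fun (x : (List ℕ × List Bool) × ℕ) k => X x.1.1 x.1.2 k)
        (hX.comp (f := fun x : ((List ℕ × List Bool) × ℕ) × ℕ => (x.1.1, x.2))
        (by fun_prop)) ?_
      exact (ArF.of_primrec (Primrec.ofNat (List ℕ))).comp (by fun_prop)
    have hc : ∀ {α : Type} [Primcodable α] (D : α → List ℕ) (σ : α → List Bool) (l c w : α → ℕ),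
        ArF ∅ D → ArF ∅ σ → ArF ∅ l → ArF ∅ c → ArF ∅ w → Ar ∅ fun a =>
          Sat g M₀ (c a) (w a :: (Denumerable.ofNat (List ℕ) (l a)).map (X (D a) (σ a))) := by
      intro α _ D σ l c w h1 h2 h3 h4 h5
      exact hS.compF (f := fun a => (c a, w a :: (Denumerable.ofNat (List ℕ) (l a)).map
        (X (D a) (σ a)))) (h4.prodMk (ArF.cons h5
        (hl.comp (f := fun a => ((D a, σ a), l a)) (by fun_prop))))
    refine ((Ar.eq (by fun_prop) (by fun_prop)).imp (Ar.imp ?_ ?_)).and (Ar.and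
      ((Ar.eq (by fun_prop) (by fun_prop)).imp (Ar.eq (by fun_prop) ?_))
      ((Ar.eq (by fun_prop) (by fun_prop)).imp (Ar.imp (Ar.ex ?_) ?_)))
    · exact hC.compF (by fun_prop)
    · exact Ar.eq (by fun_prop) (by fun_prop)
    · exact he.comp (f := fun x : (ℕ × ℕ) × (List ℕ × List Bool) × ℕ =>
        (x.1.2.unpair.1.unpair.2, x.1.1)) (by fun_prop)
    · exact hc (α := ((ℕ × ℕ) × (List ℕ × List Bool) × ℕ) × ℕ) (fun x => x.1.2.1.1)
        (fun x => x.1.2.1.2) _ _ (fun x => x.2) (by fun_prop) (by fun_prop) (by fun_prop)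
        (by fun_prop) (by fun_prop)
    · exact hc (α := (ℕ × ℕ) × (List ℕ × List Bool) × ℕ) (fun x => x.2.1.1)
        (fun x => x.2.1.2) _ _ (fun x => x.2.2) (by fun_prop) (by fun_prop) (by fun_prop)
        (by fun_prop) (by fun_prop)
  have hp : Ar ∅ fun x : ℕ × List ℕ => p x.1 x.2 := by
    have hdom : Ar ∅ fun x : (ℕ × List ℕ) × List Bool => x.2 ≠ [] :=
      (Ar.eq (by fun_prop) (by fun_prop)).not
    have hlen : Ar ∅ fun x : (ℕ × List ℕ) × List Bool => x.2.length ≤ x.1.1 :=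
      Ar.le (by fun_prop) (by fun_prop)
    have h1 : Ar ∅ fun x : ℕ × List ℕ => ∀ y, y ∈ x.2 → y ∈ M₀.carrier :=
      Ar.all (p := fun (x : ℕ × List ℕ) y => y ∈ x.2 → y ∈ M₀.carrier)
        (Ar.imp (Ar.memList (by fun_prop) (by fun_prop)) (hC.compF (by fun_prop)))
    have h2 := Ar.all (p := fun (x : ℕ × List ℕ) (σ : List Bool) => σ ≠ [] → σ.length ≤ x.1 →
        ∃ hx : x.2.getD (nd σ 0) m₀ ∈ M₀.carrier,
          ψ.Realize (Sum.elim (fun x => x) (fun _ => ⟨_, hx⟩)))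
        (hdom.imp (hlen.imp (hψ.compF (f := fun x : (ℕ × List ℕ) × List Bool =>
          x.1.2.getD (nd x.2 0) m₀) (by fun_prop))))
    have h3 := Ar.all (p := fun (x : ℕ × List ℕ) (σ : List Bool) => σ ≠ [] → σ.length ≤ x.1 →
        ¬ ∃ hx : x.2.getD (nd σ 0) m₀ ∈ M₀.carrier,
          θ.Realize (Sum.elim (fun x => x) (fun _ => ⟨_, hx⟩)))
        (hdom.imp (hlen.imp (hθ.compF (f := fun x : (ℕ × List ℕ) × List Bool =>
          x.1.2.getD (nd x.2 0) m₀) (by fun_prop)).not))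
    have h4 := Ar.all (p := fun (x : ℕ × List ℕ) (σ : List Bool) => σ ≠ [] → σ.length ≤ x.1 →
        ∀ k, k < 2 * (σ.length - 1) → x.2.getD (nd σ 0) m₀ ≠ X x.2 σ k)
        (hdom.imp (hlen.imp (Ar.all (p := fun (x : (ℕ × List ℕ) × List Bool) k =>
          k < 2 * (x.2.length - 1) → x.1.2.getD (nd x.2 0) m₀ ≠ X x.1.2 x.2 k)
          ((Ar.lt (by fun_prop) (by fun_prop)).imp (Ar.not (Ar.eq (by fun_prop)
            (hX.comp (f := fun x : ((ℕ × List ℕ) × List Bool) × ℕ => ((x.1.1.2, x.1.2), x.2))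
              (by fun_prop))))))))
    have h5 := Ar.all (p := fun (x : ℕ × List ℕ) (σ : List Bool) => σ ≠ [] → σ.length ≤ x.1 →
        Req g M₀ e x.1 (σ.length - 1) (X x.2 σ) (x.2.getD (nd σ 1) m₀))
        (hdom.imp (hlen.imp (hR.compF (f := fun x : (ℕ × List ℕ) × List Bool =>
          ((x.1.1, x.2.length - 1), (x.1.2, x.2), x.1.2.getD (nd x.2 1) m₀)) (by fun_prop))))
    have h6 := Ar.all (p := fun (x : ℕ × List ℕ) (σ : List Bool) => σ ≠ [] → σ.length ≤ x.1 →
        ∀ τ : List Bool, τ.length = σ.length → (∃ hx : x.2.getD (nd σ 1) m₀ ∈ M₀.carrier,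
          θ.Realize (Sum.elim (fun x => x) (fun _ => ⟨_, hx⟩))) →
          x.2.getD (nd τ 1) m₀ = x.2.getD (nd σ 1) m₀)
        (hdom.imp (hlen.imp (Ar.all (p := fun (x : (ℕ × List ℕ) × List Bool) (τ : List Bool) =>
          τ.length = x.2.length → (∃ hx : x.1.2.getD (nd x.2 1) m₀ ∈ M₀.carrier,
          θ.Realize (Sum.elim (fun x => x) (fun _ => ⟨_, hx⟩))) →
          x.1.2.getD (nd τ 1) m₀ = x.1.2.getD (nd x.2 1) m₀)
          ((Ar.eq (by fun_prop) (by fun_prop)).imp (Ar.imp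
          (hθ.compF (f := fun x : ((ℕ × List ℕ) × List Bool) × List Bool =>
          x.1.1.2.getD (nd x.1.2 1) m₀) (by fun_prop)) (Ar.eq (by fun_prop) (by fun_prop)))))))
    have hcons : ArF ∅ fun x : (ℕ × List ℕ) × List Bool × Bool × List Bool × Bool =>
        (!x.2.2.1) := (ArF.of_primrec Primrec.not).comp (by fun_prop)
    have hnat : ArF ∅ Bool.toNat := ArF.of_primrec (Primrec.dom_finite _)
    have h7 := Ar.all (Y := ∅) (p := fun (x : ℕ × List ℕ) (z : List Bool × Bool × List Bool × Bool) =>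
        z.1.length + 1 + z.2.2.1.length ≤ x.1 →
        x.2.getD (nd (z.1 ++ [z.2.1]) 0) m₀ ≠
          x.2.getD (nd (z.1 ++ (!z.2.1) :: z.2.2.1) z.2.2.2.toNat) m₀)
        ((Ar.le (by fun_prop) (by fun_prop)).imp (Ar.not (Ar.eq (by fun_prop)
          (by fun_prop))))
    refine (h1.and (h2.and (h3.and (h4.and (h5.and (h6.and h7)))))).congr fun x => ?_
    have hP : ∀ (h : ∀ y ∈ x.2, y ∈ M₀.carrier) σ, (fun k =>
        ((TreeSpec.path (fun _ => m₀) (tblTree m₀ x.2 h) σ k : M₀.carrier) : ℕ)) = X x.2 σ :=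
      fun h σ => funext fun k => hXp _ _ _ _
    constructor
    · rintro ⟨k1, k2, k3, k4, k5, k6, k7⟩
      refine ⟨k1, fun σ a b => ?_, fun σ a b hh => ?_, fun σ a b k hk hh => ?_, fun σ a b => ?_,
        fun σ τ a b c hh => ?_, fun t b u c hl hh => ?_⟩
      · obtain ⟨hx, hr⟩ := k2 σ a b
        exact hr
      · exact k3 σ a b ⟨_, hh⟩
      · refine k4 σ a b k hk ?_
        rw [← hXp x.2 k1, ← hh]
        rfl
      · have := k5 σ a b
        rw [← hP k1] at this
        exact this
      · exact Subtype.ext (k6 σ a b τ c ⟨_, hh⟩)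
      · exact k7 (t, b, u, c) hl (congrArg Subtype.val hh)
    · rintro ⟨k1, hg⟩
      refine ⟨k1, fun σ a b => ⟨_, hg.ψ σ a b⟩, fun σ a b => ?_, fun σ a b k hk hh => ?_,
        fun σ a b => ?_, fun σ a b τ c => ?_, fun z hl hh => ?_⟩
      · rintro ⟨hx, hr⟩
        exact hg.θ σ a b hr
      · rw [← hXp x.2 k1] at hh
        exact hg.path σ a b k hk (Subtype.ext hh)
      · have := hg.V σ a b
        simp only [stageSpec] at this
        rw [hP k1] at this
        exact this
      · rintro ⟨hx, hr⟩
        exact congrArg Subtype.val (hg.eq σ τ a b c hr)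
      · exact hg.ne z.1 z.2.1 z.2.2.1 z.2.2.2 hl (Subtype.ext hh)
  obtain ⟨F, hF, hFp⟩ := Ar.choose hp
  have hex : ∀ n, p n (F n) := by
    intro n
    refine hFp n ?_
    obtain ⟨d, hd⟩ := H n
    obtain ⟨D, h, hD⟩ := exists_table d n m₀
    exact ⟨D, h, hd.congr hD⟩
  choose h hh using hex
  refine ⟨fun i n => ⟨(F n).getD i m₀, ?_⟩, ?_, fun n => hh n⟩
  · rw [List.getD_eq_getElem?_getD]
    cases h' : (F n)[i]? with
    | none => exact m₀.2
    | some y => exact h n y (List.mem_of_getElem? h')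
  · fun_prop

end Stage

section Tree

variable {L : FirstOrder.Language} {g : GoedelCoding L} {M₀ : CodedStructure L}

open Classical in
/-- The initial segment of length `k` of the characteristic function of `S`. -/
noncomputable def br (S : Set ℕ) (k : ℕ) : List Bool := (List.range k).map fun i => decide (i ∈ S)

@[simp] theorem br_length (S : Set ℕ) (k : ℕ) : (br S k).length = k := by simp [br]

open Classical in
theorem br_succ (S : Set ℕ) (k : ℕ) : br S (k + 1) = br S k ++ [decide (k ∈ S)] := by
  simp [br, List.range_succ]

theorem br_take (S : Set ℕ) {k j : ℕ} (h : j ≤ k) : (br S k).take j = br S j := by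
  unfold br
  rw [← List.map_take, List.take_range, min_eq_left h]

theorem ArF.br (S : Set ℕ) : ArF S (br S) := by
  classical
  unfold ArMorley.br
  refine ArF.map (f := fun (_ : ℕ) i => decide (i ∈ S)) ?_ (by fun_prop)
  have := Ar.ite (Y := S) (p := fun x : ℕ × ℕ => x.2 ∈ S) (f := fun _ => true) (g := fun _ => false)
    (Ar.compF Ar.oracle (by fun_prop)) (by fun_prop) (by fun_prop)
  refine this.congr fun x => ?_
  by_cases h : x.2 ∈ S <;> simp [h]

/-- The elementary extension given by `E`, as a structure with named elements from `M₀`, together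
with `M₀` itself. -/
def extPt {N : CodedStructure L} (E : ElemSub M₀ N) : Bool → Pt L M₀.carrier
  | false => ⟨M₀.carrier, inferInstance, fun x => x⟩
  | true => ⟨N.carrier, inferInstance, E.inc⟩

/-- The properties of the elements of the full tree. -/
structure FullTree {N : CodedStructure L} (E : ElemSub M₀ N)
    (ψ θ : L.Formula (M₀.carrier ⊕ Unit))
    (α : ℕ → N.carrier) (d : List Bool × Bool → N.carrier) : Prop where
  hψ : ∀ σ, σ ≠ [] → ψ.Realize (Sum.elim E.inc fun _ => d (σ, false))
  hθ : ∀ σ, σ ≠ [] → ¬ θ.Realize (Sum.elim E.inc fun _ => d (σ, false))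
  path : ∀ σ j c, 0 < j → j < σ.length → d (σ, false) ≠ d (σ.take j, c)
  eq : ∀ σ τ, σ ≠ [] → τ.length = σ.length →
    θ.Realize (Sum.elim E.inc fun _ => d (σ, true)) → d (τ, true) = d (σ, true)
  ne : ∀ t b u c, d (t ++ [b], false) ≠ d (t ++ (!b) :: u, c)
  base : ∀ m, ∃ r, ∀ σ, σ.length = r + 1 → d (σ, true) = E.inc m
  seq : ∀ j, ∃ r, ∀ σ, σ.length = r + 1 → d (σ, true) = α j
  wit : ∀ (k : ℕ) (χ : L.Formula (Fin (k + 1))) (j : Fin k → ℕ) (c : Fin k → Bool), ∃ r,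
    (∀ i, j i < r) ∧ ∀ σ, σ.length = r + 1 → ∀ x,
      χ.Realize (Fin.cons x fun i => d (σ.take (j i + 1), c i) : Fin (k + 1) → N.carrier) →
      χ.Realize (Fin.cons (d (σ, true)) fun i => d (σ.take (j i + 1), c i) :
        Fin (k + 1) → N.carrier)

theorem path_eq {M : Type} (x₀ : ℕ → M) (d : List Bool × Bool → M) (σ : List Bool) (j : ℕ)
    (c : Bool) (h : j + 1 < σ.length) :
    TreeSpec.path x₀ d σ (2 * j + c.toNat) = d (σ.take (j + 1), c) := by
  have hc : c.toNat ≤ 1 := by cases c <;> simp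
  unfold TreeSpec.path
  rw [if_pos (by omega)]
  have h1 : (2 * j + c.toNat) / 2 = j := by omega
  have h2 : decide ((2 * j + c.toNat) % 2 = 1) = c := by
    have : (2 * j + c.toNat) % 2 = c.toNat := by omega
    rw [this]
    cases c <;> simp
  rw [h1, h2]

theorem exists_fullTree (h₀ : ArithDecidable g M₀) (ψ θ : L.Formula (M₀.carrier ⊕ Unit))
    (hne : ∃ m, θ.Realize (Sum.elim (fun x => x) fun _ => m))
    (hs : ¬ Small L (fun m : M₀.carrier => θ.Realize (Sum.elim (fun x => x) fun _ => m))
      {m | ψ.Realize (Sum.elim (fun x => x) fun _ => m)})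
    (e : ℕ → ℕ → M₀.carrier) (he : ArF ∅ fun x : ℕ × ℕ => (e x.1 x.2 : ℕ)) :
    ∃ (N : CodedStructure L) (E : ElemSub M₀ N) (α : ℕ → N.carrier)
      (d : List Bool × Bool → N.carrier), ArithDecidable g N ∧
      (ArF ∅ fun p => (d p : ℕ)) ∧ FullTree E ψ θ α d ∧
      ∀ φ : L.Formula (M₀.carrier ⊕ ℕ),
        (∀ᶠ n in Filter.atTop, φ.Realize (Sum.elim (fun x => x) fun j => e j n)) →
        φ.Realize (Sum.elim E.inc α) := by
  obtain ⟨m₀, hm₀⟩ := hne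
  obtain ⟨F, hF, hG⟩ := exists_stages (g := g) h₀ ψ θ m₀ e he fun n =>
    (stageSpec g ψ θ m₀ e n).exists_flat ⟨m₀, hm₀⟩ hs n _
  obtain ⟨D, hD, hDe, hDo⟩ : ∃ D : ℕ → ℕ → M₀.carrier, (ArF ∅ fun x : ℕ × ℕ => (D x.1 x.2 : ℕ)) ∧
      (∀ i n, D (2 * i) n = F i n) ∧ ∀ i n, D (2 * i + 1) n = e i n := by
    refine ⟨fun i n => if i % 2 = 0 then F (i / 2) n else e (i / 2) n, ?_, fun i n => by simp,
      fun i n => ?_⟩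
    · refine (Ar.ite (p := fun x : ℕ × ℕ => x.1 % 2 = 0) (f := fun x => (F (x.1 / 2) x.2 : ℕ))
        (g := fun x => (e (x.1 / 2) x.2 : ℕ)) (Ar.eq (by fun_prop) (by fun_prop))
        (hF.comp (f := fun x : ℕ × ℕ => (x.1 / 2, x.2)) (by fun_prop))
        (he.comp (f := fun x : ℕ × ℕ => (x.1 / 2, x.2)) (by fun_prop))).congr fun x => ?_
      exact (apply_ite Subtype.val _ _ _).symm
    · have h1 : (2 * i + 1) % 2 ≠ 0 := by omega
      have h2 : (2 * i + 1) / 2 = i := by omega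
      simp only [h1, h2, if_false]
  obtain ⟨N, E, ν, hN, hν, hφ⟩ := exists_ultra h₀ D hD
  have hnat : ArF ∅ Bool.toNat := ArF.of_primrec (Primrec.dom_finite _)
  let α : ℕ → N.carrier := fun j => ν (2 * j + 1)
  let d : List Bool × Bool → N.carrier := fun p => ν (2 * nd p.1 p.2.toNat)
  let _ : ∀ i, L.Structure (extPt E i).M := fun i => (extPt E i).S
  have tr : ∀ {P : ∀ i, ((List Bool × Bool) ⊕ ℕ → (extPt E i).M) → Prop}, UDf (extPt E) P →
      (∀ᶠ n in Filter.atTop, P false (Sum.elim (fun p => F (nd p.1 p.2.toNat) n) fun j => e j n)) →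
      P true (Sum.elim d α) := by
    rintro P ⟨φ, hφP⟩ h
    have key := hφ (φ.relabel (Sum.map id (Sum.elim (fun p => 2 * nd p.1 p.2.toNat)
      fun j => 2 * j + 1))) (h.mono fun n hn => by
        rw [Formula.realize_relabel]
        refine (iff_of_eq (congrArg _ ?_)).1 ((hφP false _).2 hn)
        funext x
        rcases x with x | x | x
        · rfl
        · exact (hDe _ _).symm
        · exact (hDo _ _).symm)
    rw [Formula.realize_relabel] at key
    refine (hφP true _).1 ((iff_of_eq (congrArg _ ?_)).1 key)
    funext x
    rcases x with x | x | x <;> rfl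
  refine ⟨N, E, α, d, hN, ?_, ?_, ?_⟩
  · exact hν.comp (f := fun p : List Bool × Bool => 2 * nd p.1 p.2.toNat) (by fun_prop)
  · have uψ : ∀ (χ : L.Formula (M₀.carrier ⊕ Unit)) (p : List Bool × Bool), UDf (extPt E)
        (fun i (v : (List Bool × Bool) ⊕ ℕ → (extPt E i).M) =>
          χ.Realize (Sum.elim (extPt E i).c fun _ => v (Sum.inl p))) := by
      intro χ p
      refine (UDf.formula χ (Sum.elim Sum.inl fun _ => Sum.inr (Sum.inl p))).congr fun i v => ?_
      refine iff_of_eq (congrArg _ ?_)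
      funext x
      rcases x with x | x <;> rfl
    refine ⟨fun σ hσ => ?_, fun σ hσ => ?_, fun σ j c h0 hj => ?_, fun σ τ hσ hτ => ?_,
      fun t b u c => ?_, fun m => ?_, fun j => ?_, fun k χ j c => ?_⟩
    · exact tr (uψ ψ (σ, false)) ((Filter.eventually_ge_atTop σ.length).mono fun n hn =>
        (hG n).ψ σ hσ hn)
    · exact tr (uψ θ (σ, false)).not ((Filter.eventually_ge_atTop σ.length).mono fun n hn =>
        (hG n).θ σ hσ hn)
    · refine tr (UDf.eq_var (Sum.inl (σ, false)) (Sum.inl (σ.take j, c))).not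
        ((Filter.eventually_ge_atTop σ.length).mono fun n hn => ?_)
      obtain ⟨j, rfl⟩ := Nat.exists_eq_add_of_le' h0
      have hc : c.toNat ≤ 1 := by cases c <;> simp
      have := (hG n).path σ (by rintro rfl; simp at hj) hn (2 * j + c.toNat) (by omega)
      rw [path_eq _ _ _ _ _ hj] at this
      exact this
    · exact tr ((uψ θ (σ, true)).imp (UDf.eq_var (Sum.inl (τ, true)) (Sum.inl (σ, true))))
        ((Filter.eventually_ge_atTop σ.length).mono fun n hn => (hG n).eq σ τ hσ hn hτ)
    · exact tr (UDf.eq_var (Sum.inl (t ++ [b], false)) (Sum.inl (t ++ (!b) :: u, c))).not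
        ((Filter.eventually_ge_atTop (t.length + 1 + u.length)).mono fun n hn =>
          (hG n).ne t b u c hn)
    · refine ⟨Nat.pair (Nat.pair 0 m) 0, fun σ hσ => ?_⟩
      refine tr (UDf.eq_const (Sum.inl (σ, true)) m)
        ((Filter.eventually_ge_atTop σ.length).mono fun n hn => ?_)
      have := (hG n).V σ (by rintro rfl; simp at hσ) hn
      refine Subtype.ext ?_
      refine (this.1 ?_ ?_).trans ?_ <;> simp [hσ]
      rfl
    · refine ⟨Nat.pair (Nat.pair 1 j) 0, fun σ hσ => ?_⟩
      refine tr (UDf.eq_var (Sum.inl (σ, true)) (Sum.inr j))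
        ((Filter.eventually_ge_atTop σ.length).mono fun n hn => ?_)
      have := (hG n).V σ (by rintro rfl; simp at hσ) hn
      refine Subtype.ext ?_
      refine (this.2.1 ?_).trans ?_ <;> simp [hσ]
      rfl
    · let l : List ℕ := List.ofFn fun i => 2 * j i + (c i).toNat
      obtain ⟨B, hB⟩ := (Set.finite_range j).bddAbove
      have hB : ∀ i, j i ≤ B := fun i => hB ⟨i, rfl⟩
      let r := Nat.pair (Nat.pair 2 (Nat.pair (fc g χ) (Encodable.encode l))) (B + 1)
      have hr : ∀ i, j i < r := fun i =>
        (Nat.lt_succ_of_le (hB i)).trans_le (Nat.right_le_pair _ _)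
      refine ⟨r, hr, fun σ hσ => ?_⟩
      let t : (k : Fin k) → (List Bool × Bool) := fun i => (σ.take (j i + 1), c i)
      have u1 : UDf (extPt E) fun i (v : (List Bool × Bool) ⊕ ℕ → (extPt E i).M) =>
          χ.Realize (Fin.cons (v (Sum.inl (σ, true))) (fun i => v (Sum.inl (t i))) :
            Fin (k + 1) → _) := by
        refine (UDf.formula χ (fun i => Sum.inr (Sum.inl ((Fin.cons (σ, true) t :
          Fin (k + 1) → (List Bool × Bool)) i)))).congr fun i v => iff_of_eq (congrArg _ ?_)
        funext x
        refine Fin.cases ?_ (fun x => ?_) x <;> simp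
      have u2 : UDf (extPt E) fun i (v : (List Bool × Bool) ⊕ ℕ → (extPt E i).M) => ∀ x,
          χ.Realize (Fin.cons x (fun i => v (Sum.inl (t i))) : Fin (k + 1) → _) →
          χ.Realize (Fin.cons (v (Sum.inl (σ, true))) (fun i => v (Sum.inl (t i))) :
            Fin (k + 1) → _) := by
        refine UDf.all1 (P := fun i (v : (List Bool × Bool) ⊕ ℕ → (extPt E i).M) x =>
          χ.Realize (Fin.cons x (fun i => v (Sum.inl (t i))) : Fin (k + 1) → _) →
          χ.Realize (Fin.cons (v (Sum.inl (σ, true))) (fun i => v (Sum.inl (t i))) :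
            Fin (k + 1) → _)) (UDf.imp ?_ (UDf.comp u1 Sum.inl))
        refine (UDf.formula χ (fun i => Sum.inr ((Fin.cons (Sum.inr ())
          (fun i => Sum.inl (Sum.inl (t i))) :
          Fin (k + 1) → ((List Bool × Bool) ⊕ ℕ) ⊕ Unit) i))).congr
          fun i v => iff_of_eq (congrArg _ ?_)
        funext x
        refine Fin.cases ?_ (fun x => ?_) x <;> simp
      refine tr u2 ((Filter.eventually_ge_atTop σ.length).mono fun n hn (x : M₀.carrier) hx => ?_)
      have := ((hG n).V σ (by rintro rfl; simp at hσ) hn).2.2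
      have hl : ∀ d' : List Bool × Bool → M₀.carrier, l.map (fun i =>
          ((TreeSpec.path (fun _ => m₀) d' σ i : M₀.carrier) : ℕ)) = vals fun i => d' (t i) := by
        intro d'
        unfold vals
        rw [List.map_ofFn]
        congr 1
        funext i
        simp only [Function.comp]
        rw [path_eq _ _ _ _ _ (by have := hr i; omega)]
      simp only [hσ, Nat.add_sub_cancel, r, Nat.unpair_pair, Denumerable.ofNat_encode, hl] at this
      have h2 := this trivial ⟨x, by rw [← vals_cons]; exact sat_iff.2 hx⟩
      rw [← vals_cons] at h2
      exact sat_iff.1 h2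
  · rintro φ hφ'
    have u : UDf (extPt E) fun i (v : (List Bool × Bool) ⊕ ℕ → (extPt E i).M) =>
        φ.Realize (Sum.elim (extPt E i).c fun j => v (Sum.inr j)) := by
      refine (UDf.formula φ (Sum.elim Sum.inl fun j => Sum.inr (Sum.inr j))).congr fun i v => ?_
      refine iff_of_eq (congrArg _ ?_)
      funext x
      rcases x with x | x <;> rfl
    exact tr u hφ'

theorem FullTree.eq_br {N : CodedStructure L} {E : ElemSub M₀ N}
    {ψ θ : L.Formula (M₀.carrier ⊕ Unit)} {α : ℕ → N.carrier} {d : List Bool × Bool → N.carrier}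
    (h : FullTree E ψ θ α d) (S : Set ℕ) (s : List Bool)
    (hs : ∀ j < s.length, ∃ k c, (d (s.take (j + 1), false)) = d (br S (k + 1), c)) :
    s = br S s.length := by
  classical
  have key : ∀ j ≤ s.length, s.take j = br S j := by
    intro j
    induction j with
    | zero => intro _; simp [br]
    | succ j ih =>
      intro hj
      have hj' : j < s.length := hj
      have e1 : s.take (j + 1) = br S j ++ [(s[j])] := by
        rw [← ih hj'.le, List.take_succ_eq_append_getElem hj']
      by_cases hb : s[j] = decide (j ∈ S)
      · rw [e1, br_succ, hb]
      · exfalso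
        have hb' : decide (j ∈ S) = !s[j] := by
          revert hb
          cases s[j] <;> cases decide (j ∈ S) <;> simp
        obtain ⟨k, c, hk⟩ := hs j hj'
        rw [e1] at hk
        rcases Nat.lt_or_ge k j with hkj | hkj
        · have := h.path (br S j ++ [(s[j])]) (k + 1) c (by omega) (by simp; omega)
          rw [List.take_append_of_le_length (by simp; omega), br_take S hkj] at this
          exact this hk
        · obtain ⟨u, hu⟩ : ∃ u, br S (k + 1) = br S j ++ (!s[j]) :: u := by
            refine ⟨(br S (k + 1)).drop (j + 1), ?_⟩
            have := (List.take_append_drop (j + 1) (br S (k + 1))).symm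
            rw [br_take S (by omega), br_succ S j, hb'] at this
            simpa using this
          rw [hu] at hk
          exact h.ne _ _ _ _ hk
  have := key _ le_rfl
  rwa [List.take_length] at this

/-- The tree theorem. -/
theorem exists_tree (h₀ : ArithDecidable g M₀) (ψ θ : L.Formula (M₀.carrier ⊕ Unit))
    (hne : ∃ m, θ.Realize (Sum.elim (fun x => x) fun _ => m))
    (hs : ¬ Small L (fun m : M₀.carrier => θ.Realize (Sum.elim (fun x => x) fun _ => m))
      {m | ψ.Realize (Sum.elim (fun x => x) fun _ => m)})
    (e : ℕ → ℕ → M₀.carrier) (he : ArF ∅ fun x : ℕ × ℕ => (e x.1 x.2 : ℕ)) :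
    ∃ (N : CodedStructure L) (E : ElemSub M₀ N) (α : ℕ → N.carrier), ArithDecidable g N ∧
      (∀ S : Set ℕ, ∃ M : CodedStructure L, ElemSub M₀ M ∧ ElemSub M N ∧
        (∀ j, (α j : ℕ) ∈ M.carrier) ∧ ArEquiv M.carrier S ∧
        ArEquiv {x | x ∈ M.carrier ∧ ∃ hx : x ∈ N.carrier,
          ψ.Realize (Sum.elim E.inc fun _ => ⟨x, hx⟩)} S ∧
        IsArithmetical {x | x ∈ M.carrier ∧ ∃ hx : x ∈ N.carrier,
          θ.Realize (Sum.elim E.inc fun _ => ⟨x, hx⟩)}) ∧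
      ∀ φ : L.Formula (M₀.carrier ⊕ ℕ),
        (∀ᶠ n in Filter.atTop, φ.Realize (Sum.elim (fun x => x) fun j => e j n)) →
        φ.Realize (Sum.elim E.inc α) := by
  classical
  obtain ⟨N, E, α, d, hN, hd, hT, hφ⟩ := exists_fullTree h₀ ψ θ hne hs e he
  refine ⟨N, E, α, hN, ?_, hφ⟩
  have hdef : ∀ χ : L.Formula (M₀.carrier ⊕ Unit), Ar ∅ fun x => ∃ hx : x ∈ N.carrier,
      χ.Realize (Sum.elim E.inc fun _ => ⟨x, hx⟩) := by
    intro χ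
    refine (hN.definable1 (χ.relabel (Sum.map E.inc id))).congr fun x => ?_
    refine exists_congr fun hx => ?_
    rw [Formula.realize_relabel]
    refine iff_of_eq (congrArg _ ?_)
    funext y
    rcases y with y | y <;> rfl
  let A : Set ℕ → Set ℕ := fun S => {x | ∃ k c, x = d (br S (k + 1), c)}
  have hA : ∀ S, A S ⊆ N.carrier := by
    rintro S x ⟨k, c, rfl⟩
    exact Subtype.coe_prop _
  have hbr : ∀ (S : Set ℕ) k, br S (k + 1) ≠ [] := by
    intro S k h
    have := congrArg List.length h
    simp at this
  have hArA : ∀ S, Ar S fun x => x ∈ A S := by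
    intro S
    have hb := ArF.br S
    have hd' : ArF S fun p => (d p : ℕ) := hd.mono
    refine Ar.ex (p := fun x k => ∃ c, x = (d (br S (k + 1), c) : ℕ)) (Ar.ex (p :=
      fun (x : ℕ × ℕ) c => x.1 = (d (br S (x.2 + 1), c) : ℕ)) (Ar.eq (by fun_prop) ?_))
    exact hd'.comp (f := fun x : (ℕ × ℕ) × Bool => (br S (x.1.2 + 1), x.2))
      ((hb.comp (f := fun x : (ℕ × ℕ) × Bool => x.1.2 + 1) (by fun_prop)).prodMk (by fun_prop))
  have hback : ∀ (S Z : Set ℕ), Z ⊆ A S → (∀ k, (d (br S (k + 1), false) : ℕ) ∈ Z) →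
      ArReducible S Z := by
    intro S Z hZ hZ'
    have hd' : ArF Z fun p => (d p : ℕ) := hd.mono
    have h1 : Ar Z fun n : ℕ => ∃ s : List Bool, s.length = n + 1 ∧ s[n]? = some true ∧
        ∀ j, j ≤ n → (d (s.take (j + 1), false) : ℕ) ∈ Z := by
      refine Ar.ex (p := fun n (s : List Bool) => s.length = n + 1 ∧ s[n]? = some true ∧
        ∀ j, j ≤ n → (d (s.take (j + 1), false) : ℕ) ∈ Z) (Ar.and (Ar.eq (by fun_prop)
          (by fun_prop)) (Ar.and (Ar.eq (by fun_prop) (by fun_prop)) (Ar.all (p := fun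
            (x : ℕ × List Bool) j => j ≤ x.1 → (d (x.2.take (j + 1), false) : ℕ) ∈ Z)
            (Ar.imp (Ar.le (by fun_prop) (by fun_prop)) (Ar.compF Ar.oracle ?_)))))
      exact hd'.comp (f := fun x : (ℕ × List Bool) × ℕ => (x.1.2.take (x.2 + 1), false))
        (by fun_prop)
    refine Ar.arReducible.1 (h1.congr fun n => ?_)
    constructor
    · rintro ⟨s, hl, hn, hj⟩
      have := hT.eq_br S s fun j hj' => by
        obtain ⟨k, c, hk⟩ := hZ (hj j (by omega))
        exact ⟨k, c, Subtype.ext hk⟩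
      rw [this, hl, br_succ] at hn
      simpa using hn
    · intro hn
      refine ⟨br S (n + 1), by simp, ?_, fun j hj => ?_⟩
      · rw [br_succ]
        simpa using hn
      · rw [br_take S (by omega)]
        exact hZ' j
  intro S
  obtain ⟨M, hMA, hMN⟩ := exists_elemSub N (A S) (hA S) (by
    intro k χ t x ht hx
    choose j c hj using ht
    have hj : ∀ i, t i = d (br S (j i + 1), c i) := fun i => Subtype.ext (hj i)
    obtain ⟨r, hr, hw⟩ := hT.wit k χ j c
    have ht : (fun i => d ((br S (r + 1)).take (j i + 1), c i)) = t := by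
      funext i
      rw [br_take S (by have := hr i; omega), hj]
    have := hw (br S (r + 1)) (by simp) x
    rw [ht] at this
    exact ⟨_, ⟨r, true, rfl⟩, this hx⟩)
  have hMe : ArEquiv M.carrier S := by
    rw [hMA]
    exact ⟨Ar.arReducible.1 (hArA S), hback S _ subset_rfl fun k => ⟨k, _, rfl⟩⟩
  refine ⟨M, E.of_subset hMN ?_, hMN, ?_, hMe, ?_, ?_⟩
  · intro x hx
    obtain ⟨r, hr⟩ := hT.base ⟨x, hx⟩
    rw [hMA]
    exact ⟨r, true, by rw [hr _ (by simp)]; rfl⟩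
  · intro j
    obtain ⟨r, hr⟩ := hT.seq j
    rw [hMA]
    exact ⟨r, true, by rw [hr _ (by simp)]⟩
  · refine ⟨Ar.arReducible.1 (Ar.and ?_ (hdef ψ).mono), hback S _ ?_ fun k => ⟨?_, ?_⟩⟩
    · rw [hMA]
      exact hArA S
    · rw [hMA]
      exact fun x hx => hx.1
    · rw [hMA]
      exact ⟨k, _, rfl⟩
    · exact ⟨Subtype.coe_prop _, hT.hψ _ (hbr S k)⟩
  · refine Ar.arReducible.1 (((hArA ∅).and (hdef θ)).congr fun x => and_congr_left ?_)
    have key : ∀ S S' x, (∃ hx : x ∈ N.carrier, θ.Realize (Sum.elim E.inc fun _ => ⟨x, hx⟩)) →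
        x ∈ A S → x ∈ A S' := by
      rintro S S' x ⟨hx, hθ⟩ ⟨k, c, rfl⟩
      cases c with
      | false => exact (hT.hθ _ (hbr S k) hθ).elim
      | true => exact ⟨k, true, congrArg _ (hT.eq _ (br S' (k + 1)) (hbr S k) (by simp) hθ).symm⟩
    intro hx
    rw [hMA]
    exact ⟨key _ _ x hx, key _ _ x hx⟩

end Tree

/-! ## Coverings by finitely many points over tuples -/

section CovBy

variable {L : FirstOrder.Language}

/-- Every element of `X` is one of at most `k` solutions of `ψ(y, b, ·)` with `y` from `η`. -/
def CovBy {M : Type} [L.Structure M] {p m : ℕ} (ψ : L.Formula (Fin p ⊕ Fin m ⊕ Unit)) (k : ℕ)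
    (b : Fin m → M) (η X : M → Prop) : Prop :=
  (∀ y : Fin p → M, AtMost k fun x => ψ.Realize (Sum.elim y (Sum.elim b fun _ => x))) ∧
    ∀ x, X x → ∃ y : Fin p → M, (∀ i, η (y i)) ∧
      ψ.Realize (Sum.elim y (Sum.elim b fun _ => x))

theorem Small.exists_covBy {M : Type} [S : L.Structure M] [Nonempty M] {θ : M → Prop} {X : Set M}
    (h : Small L θ X) : ∃ (p m : ℕ) (ψ : L.Formula (Fin p ⊕ Fin m ⊕ Unit)) (k : ℕ) (b : Fin m → M),
      CovBy ψ k b θ (· ∈ X) := by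
  obtain ⟨χ, ⟨φ, hφ⟩, k, h2, h3⟩ := h
  obtain ⟨m, ψ, b, -, hψ⟩ := exists_finite_support φ
  obtain ⟨p, ψ', b', hb', hψ'⟩ := exists_finite_support
    (ψ.relabel (Sum.elim (fun i => Sum.inr (Sum.inl i))
      (Sum.elim Sum.inl (fun _ => Sum.inr (Sum.inr ()))) : _ → ℕ ⊕ (Fin m ⊕ Unit)))
  have key : ∀ (y : ℕ → M) (x : M),
      ψ'.Realize (Sum.elim (fun i => y (b' i)) (Sum.elim b fun _ => x)) ↔ χ y x := by
    intro y x
    rw [← hψ' M S y, Formula.realize_relabel]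
    refine Iff.trans (Iff.trans (iff_of_eq (congrArg _ ?_)) (hψ M S (fun x => x)
      (Sum.elim y fun _ => x)).symm) (hφ () (Sum.elim y fun _ => x))
    funext z
    rcases z with z | z | z <;> rfl
  have key' : ∀ (y : Fin p → M) (x : M),
      ψ'.Realize (Sum.elim y (Sum.elim b fun _ => x)) ↔
        χ (Function.extend b' y (fun _ => Classical.arbitrary M)) x := by
    intro y x
    rw [← key]
    simp only [hb'.extend_apply]
  refine ⟨p, m, ψ', k, b, fun y => (h2 _).mono le_rfl fun x hx => (key' y x).1 hx, fun x hx => ?_⟩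
  obtain ⟨y, hy, hc⟩ := h3 x hx
  exact ⟨fun i => y (b' i), fun i => hy _, (key y x).2 hc⟩

theorem CovBy.mono {M : Type} [L.Structure M] {p m : ℕ} {ψ : L.Formula (Fin p ⊕ Fin m ⊕ Unit)}
    {k : ℕ} {b : Fin m → M} {η η' X : M → Prop} (h : CovBy ψ k b η X) (hη : ∀ x, η x → η' x) :
    CovBy ψ k b η' X :=
  ⟨h.1, fun x hx => let ⟨y, hy, hc⟩ := h.2 x hx; ⟨y, fun i => hη _ (hy i), hc⟩⟩

theorem CovBy.finite {M : Type} [L.Structure M] {p m : ℕ} {ψ : L.Formula (Fin p ⊕ Fin m ⊕ Unit)}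
    {k : ℕ} {b : Fin m → M} {η X : M → Prop} (h : CovBy ψ k b η X) (hη : {x | η x}.Finite) :
    {x | X x}.Finite := by
  have h1 : {y : Fin p → M | ∀ i, η (y i)}.Finite := by
    refine (Set.Finite.pi' (fun _ : Fin p => hη)).subset fun y hy i => hy i
  refine (h1.biUnion fun y _ => (h.1 y).finite).subset fun x hx => ?_
  obtain ⟨y, hy, hc⟩ := h.2 x hx
  exact Set.mem_biUnion (show y ∈ {y : Fin p → M | ∀ i, η (y i)} from hy) hc

/-- Covering is a first-order property. -/
theorem UDf.covBy {C I : Type} {A : I → Pt L C} {α : Type} {p m : ℕ}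
    (ψ : L.Formula (Fin p ⊕ Fin m ⊕ Unit)) (k : ℕ) (b : Fin m → C ⊕ α)
    {η X : ∀ i, (α → (A i).M) → (A i).M → Prop}
    (hη : UDf (α := α ⊕ Unit) A fun i v => η i (fun a => v (Sum.inl a)) (v (Sum.inr ())))
    (hX : UDf (α := α ⊕ Unit) A fun i v => X i (fun a => v (Sum.inl a)) (v (Sum.inr ()))) :
    UDf A fun i v => @CovBy L (A i).M (A i).S p m ψ k
      (fun j => Sum.elim (A i).c v (b j)) (η i v) (X i v) := by
  have hc : UDf (α := (α ⊕ Fin p) ⊕ Unit) A fun i v => @Formula.Realize L _ (A i).S _ ψ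
      (Sum.elim (fun j => v (Sum.inl (Sum.inr j))) (Sum.elim (fun j => Sum.elim (A i).c
        (fun a => v (Sum.inl (Sum.inl a))) (b j)) fun _ => v (Sum.inr ()))) := by
    refine (UDf.formula (A := A) ψ (Sum.elim (fun j => Sum.inr (Sum.inl (Sum.inr j)))
      (Sum.elim (fun j => Sum.map id (fun a => Sum.inl (Sum.inl a)) (b j))
        fun _ => Sum.inr (Sum.inr ())))).congr fun i v => iff_of_eq (congrArg _ ?_)
    funext x
    rcases x with x | x | x
    · rfl
    · simp only [Sum.elim_inr, Sum.elim_inl]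
      rcases b x with z | z <;> rfl
    · rfl
  refine UDf.and ?_ ?_
  · refine UDf.all (β := Fin p) (P := fun i v => AtMost k fun x => @Formula.Realize L _ (A i).S _ ψ
      (Sum.elim (fun j => v (Sum.inr j)) (Sum.elim (fun j => Sum.elim (A i).c
        (fun a => v (Sum.inl a)) (b j)) fun _ => x))) ?_
    exact UDf.atMost k hc
  · refine UDf.all1 (hX.imp ?_)
    refine UDf.ex (β := Fin p) (P := fun i v => (∀ j, η i (fun a => v (Sum.inl (Sum.inl a)))
      (v (Sum.inr j))) ∧ @Formula.Realize L _ (A i).S _ ψ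
      (Sum.elim (fun j => v (Sum.inr j)) (Sum.elim (fun j => Sum.elim (A i).c
        (fun a => v (Sum.inl (Sum.inl a))) (b j)) fun _ => v (Sum.inl (Sum.inr ()))))) ?_
    refine UDf.and (UDf.iInf fun j => ?_) ?_
    · exact hη.comp (Sum.elim (fun a => Sum.inl (Sum.inl a)) fun _ => Sum.inr j)
    · exact hc.comp (Sum.elim (Sum.elim (fun a => Sum.inl (Sum.inl a)) (fun j => Sum.inr j))
        fun _ => Sum.inl (Sum.inr ()))

end CovBy

section Coded

variable {L : FirstOrder.Language} {g : GoedelCoding L} {M N : CodedStructure L}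

/-- Properties definable in both structures transfer. -/
theorem UDf.ext_iff {E : ElemSub M N} {α : Type} {P : ∀ i, (α → (extPt E i).M) → Prop}
    (h : UDf (extPt E) P) (v : α → M.carrier) :
    P Bool.false v ↔ P Bool.true (fun a => E.inc (v a)) :=
  h.transfer (i := Bool.false) (j := Bool.true) E.inc (fun _ φ v => E.realize φ v) (fun _ => rfl) v

theorem ElemSub.covBy (E : ElemSub M N) {p m : ℕ} (ψ : L.Formula (Fin p ⊕ Fin m ⊕ Unit)) (k : ℕ)
    (b : Fin m → M.carrier) (φ : L.Formula (M.carrier ⊕ Unit)) :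
    CovBy ψ k b (fun x => φ.Realize (Sum.elim (fun x => x) fun _ => x)) (fun _ => True) ↔
      CovBy ψ k (fun j => E.inc (b j)) (fun x => φ.Realize (Sum.elim E.inc fun _ => x))
        (fun _ => True) := by
  have h := UDf.covBy (A := extPt E) (α := Empty) ψ k (fun j => Sum.inl (b j))
    (η := fun i _ x => @Formula.Realize L _ (extPt E i).S _ φ
      (Sum.elim (extPt E i).c fun _ => x)) (X := fun _ _ _ => True)
    ((UDf.formula (A := extPt E) φ (Sum.map id fun _ => Sum.inr ())).congr fun i v =>
      iff_of_eq (congrArg _ (by funext x; rcases x with x | x <;> rfl))) UDf.true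
  exact h.ext_iff (fun a => a.elim)

/-- Finite definable sets have no new points in elementary extensions. -/
theorem ElemSub.no_new_points (E : ElemSub M N) (φ : L.Formula (M.carrier ⊕ Unit))
    (hf : {x : M.carrier | φ.Realize (Sum.elim (fun x => x) fun _ => x)}.Finite) {x : N.carrier}
    (hx : φ.Realize (Sum.elim E.inc fun _ => x)) :
    ∃ y : M.carrier, E.inc y = x ∧ φ.Realize (Sum.elim (fun x => x) fun _ => y) := by
  set k := {x : M.carrier | φ.Realize (Sum.elim (fun x => x) fun _ => x)}.ncard with hk
  have h1 := (UDf.atMost (A := extPt E) (α := Empty) k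
    (P := fun i _ x => @Formula.Realize L _ (extPt E i).S _ φ (Sum.elim (extPt E i).c fun _ => x))
    ((UDf.formula (A := extPt E) φ (Sum.map id fun _ => Sum.inr ())).congr fun i v =>
      iff_of_eq (congrArg _ (by funext x; rcases x with x | x <;> rfl)))).ext_iff
        (fun a => a.elim)
  have h2 := atMost_iff.1 (h1.1 (atMost_iff.2 ⟨hf, hk.ge⟩))
  have hinj : Function.Injective E.inc := fun a b e => by
    have := congrArg Subtype.val e
    exact Subtype.ext this
  have h3 : E.inc '' {x : M.carrier | φ.Realize (Sum.elim (fun x => x) fun _ => x)} =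
      {x : N.carrier | φ.Realize (Sum.elim E.inc fun _ => x)} := by
    refine Set.eq_of_subset_of_ncard_le ?_ ?_ h2.1
    · rintro _ ⟨y, hy, rfl⟩
      rw [Set.mem_ofPred_eq, ← E.realize] at hy
      rw [Set.mem_ofPred_eq]
      convert hy using 1
      funext z
      rcases z with z | z <;> rfl
    · rw [Set.ncard_image_of_injective _ hinj]
      exact h2.2
  have h4 : x ∈ {x : N.carrier | φ.Realize (Sum.elim E.inc fun _ => x)} := hx
  rw [← h3] at h4
  obtain ⟨y, hy, e⟩ := h4
  exact ⟨y, e, hy⟩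

/-- A model covered by a set is arithmetical in it, inside a decidable extension. -/
theorem CovBy.arReducible (hN : ArithDecidable g N) (E : ElemSub M N) {p m : ℕ}
    {ψ : L.Formula (Fin p ⊕ Fin m ⊕ Unit)} {k : ℕ} {b : Fin m → M.carrier}
    {η : M.carrier → Prop} (h : CovBy ψ k b η (fun _ => True)) :
    ArReducible M.carrier {x | ∃ hx : x ∈ M.carrier, η ⟨x, hx⟩} := by
  let ψ' : L.Formula (Fin (p + (m + 1))) := ψ.relabel
    (Sum.elim (fun i => Fin.castAdd _ i) (Sum.elim (fun i => Fin.natAdd p (Fin.castSucc i))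
      fun _ => Fin.natAdd p (Fin.last m)))
  have key : ∀ (K : CodedStructure L) (y : Fin p → K.carrier) (c : Fin m → K.carrier)
      (x : K.carrier), Sat g K (fc g ψ') (vals y ++ vals (Fin.snoc c x : Fin (m + 1) → K.carrier)) ↔
        ψ.Realize (Sum.elim y (Sum.elim c fun _ => x)) := by
    intro K y c x
    rw [← vals_append, sat_iff]
    simp only [ψ']
    rw [Formula.realize_relabel]
    refine iff_of_eq (congrArg _ ?_)
    funext z
    rcases z with z | z | z
    · exact Fin.append_left ..
    · exact (Fin.append_right ..).trans (Fin.snoc_castSucc ..)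
    · exact (Fin.append_right ..).trans (Fin.snoc_last ..)
  have hsn : ∀ (K : CodedStructure L) (c : Fin m → K.carrier) (x : K.carrier),
      vals (Fin.snoc c x : Fin (m + 1) → K.carrier) = vals c ++ [(x : ℕ)] := by
    intro K c x
    rw [vals, List.ofFn_succ_last]
    simp only [Fin.snoc_castSucc, Fin.snoc_last, vals]
  simp only [hsn] at key
  set Z := {x | ∃ hx : x ∈ M.carrier, η ⟨x, hx⟩} with hZ
  rw [← Ar.arReducible]
  have hA : Ar Z (fun x : ℕ => ∃ l : List ℕ, (l.length = p ∧ ∀ z ∈ l, z ∈ Z) ∧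
      Sat g N (fc g ψ') (l ++ (vals b ++ [x]))) := by
    refine Ar.ex (p := fun x l => (l.length = p ∧ ∀ z ∈ l, z ∈ Z) ∧
      Sat g N (fc g ψ') (l ++ (vals b ++ [x]))) (Ar.and (Ar.and ?_ ?_) ?_)
    · exact Ar.eq (by fun_prop) (by fun_prop)
    · refine Ar.all (p := fun (x : ℕ × List ℕ) z => z ∈ x.2 → z ∈ Z) (Ar.imp ?_ ?_)
      · exact Ar.memList (by fun_prop) (by fun_prop)
      · exact Ar.oracle.comp Primrec.snd
    · exact hN.sat.mono.compF (f := fun x : ℕ × List ℕ => (fc g ψ', x.2 ++ (vals b ++ [x.1])))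
        (by fun_prop)
  refine hA.congr fun x => ?_
  have hb : vals b = vals (fun j => E.inc (b j)) := rfl
  constructor
  · rintro ⟨l, ⟨hl, hlZ⟩, hs⟩
    obtain ⟨y, rfl⟩ := exists_vals' (A := M.carrier) l hl (fun z hz => (hlZ z hz).1)
    have hxN : x ∈ N.carrier := hs.mem (by simp)
    have hr : ψ.Realize (Sum.elim (fun j => E.inc (y j))
        (Sum.elim (fun j => E.inc (b j)) fun _ => (⟨x, hxN⟩ : N.carrier))) :=
      (key N (fun j => E.inc (y j)) (fun j => E.inc (b j)) ⟨x, hxN⟩).1 hs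
    have hfin : {x : M.carrier | (ψ.relabel (Sum.elim (fun i => Sum.inl (y i))
        (Sum.elim (fun i => Sum.inl (b i)) Sum.inr)) : L.Formula (M.carrier ⊕ Unit)).Realize
        (Sum.elim (fun x => x) fun _ => x)}.Finite := by
      refine (h.1 y).finite.subset fun z hz => ?_
      rw [Set.mem_ofPred_eq, Formula.realize_relabel] at hz
      rw [Set.mem_ofPred_eq]
      convert hz using 1
      funext z
      rcases z with z | z | z <;> rfl
    obtain ⟨z, hz, -⟩ := E.no_new_points _ hfin (x := ⟨x, hxN⟩) (by
      rw [Formula.realize_relabel]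
      convert hr using 1
      funext z
      rcases z with z | z | z <;> rfl)
    have : (z : ℕ) = x := congrArg Subtype.val hz
    rw [← this]
    exact z.2
  · intro hx
    obtain ⟨y, hy, hc⟩ := h.2 ⟨x, hx⟩ trivial
    refine ⟨vals y, ⟨vals_length y, fun z hz => ?_⟩, ?_⟩
    · obtain ⟨i, rfl⟩ := (List.mem_ofFn ..).1 hz
      exact ⟨(y i).2, hy i⟩
    · rw [← key M y b ⟨x, hx⟩, ← E.sat] at hc
      · exact hc
      · intro z hz
        rw [← hsn, ← vals_append] at hz
        obtain ⟨i, rfl⟩ := (List.mem_ofFn ..).1 hz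
        exact Subtype.mem _

theorem mem_tupleSetCode {A : Set ℕ} {n : ℕ} {X : Set (Fin n → A)} {l : List ℕ} :
    Encodable.encode l ∈ tupleSetCode X ↔ ∃ v ∈ X, vals v = l := by
  constructor
  · rintro ⟨v, hv, e⟩
    exact ⟨v, hv, (Encodable.encode_injective e).symm⟩
  · rintro ⟨v, hv, rfl⟩
    exact ⟨v, hv, rfl⟩

theorem ar_tupleSetCode {A : Set ℕ} {n : ℕ} {X : Set (Fin n → A)} :
    Ar (tupleSetCode X) (fun l : List ℕ => ∃ v ∈ X, vals v = l) :=
  (Ar.oracle.compF (f := fun l : List ℕ => Encodable.encode l) (by fun_prop)).congr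
    fun _ => mem_tupleSetCode

theorem arReducible_tupleSetCode {A Y : Set ℕ} {n : ℕ} {X : Set (Fin n → A)}
    (h : Ar Y (fun l : List ℕ => ∃ v ∈ X, vals v = l)) : ArReducible (tupleSetCode X) Y := by
  rw [← Ar.arReducible]
  refine (Ar.ex (p := fun n (l : List ℕ) => n = Encodable.encode l ∧ ∃ v ∈ X, vals v = l)
    ((Ar.eq (by fun_prop) (by fun_prop)).and (h.comp Primrec.snd))).congr fun x => ?_
  constructor
  · rintro ⟨l, rfl, v, hv, rfl⟩
    exact ⟨v, hv, rfl⟩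
  · rintro ⟨v, hv, rfl⟩
    exact ⟨_, rfl, v, hv, rfl⟩

theorem arEquiv_tupleSetCode_one {A : Set ℕ} {P : A → Prop} :
    ArEquiv (tupleSetCode {v : Fin 1 → A | P (v 0)}) {x | ∃ hx : x ∈ A, P ⟨x, hx⟩} := by
  have key : ∀ x : ℕ, (∃ v ∈ {v : Fin 1 → A | P (v 0)}, vals v = [x]) ↔ ∃ hx : x ∈ A, P ⟨x, hx⟩ := by
    intro x
    constructor
    · rintro ⟨v, hv, e⟩
      have : (v 0 : ℕ) = x := by simpa [vals] using e
      subst this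
      exact ⟨(v 0).2, hv⟩
    · rintro ⟨hx, hp⟩
      exact ⟨fun _ => ⟨x, hx⟩, hp, by simp [vals]⟩
  constructor
  · refine arReducible_tupleSetCode ((Ar.ex (p := fun (l : List ℕ) x => l = [x] ∧
      x ∈ {x | ∃ hx : x ∈ A, P ⟨x, hx⟩}) (Ar.and (Ar.eq (by fun_prop) (by fun_prop))
        (Ar.oracle.comp Primrec.snd))).congr fun l => ?_)
    constructor
    · rintro ⟨x, rfl, hx⟩
      exact (key x).2 hx
    · rintro ⟨v, hv, rfl⟩
      refine ⟨v 0, by simp [vals], (v 0).2, hv⟩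
  · rw [← Ar.arReducible]
    exact (ar_tupleSetCode.compF (f := fun x : ℕ => [x]) (by fun_prop)).congr key

end Coded

/-! ## Consequences of categoricity in one degree -/

section Iso

variable {L : FirstOrder.Language} {g : GoedelCoding L} {M₀ M N : CodedStructure L}

/-- A coded isomorphism as an isomorphism of structures. -/
def CodedIso.toEquiv (f : CodedIso M N) : M.carrier ≃[L] N.carrier where
  toFun := f.toFun
  invFun := f.invFun
  left_inv := f.left_inv
  right_inv := f.right_inv
  map_fun' h v := f.map_fun h v
  map_rel' r v := (f.map_rel r v).symm

theorem CodedIso.realize (f : CodedIso M N) {α : Type} (φ : L.Formula α) (v : α → M.carrier) :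
    φ.Realize (fun a => f.toFun (v a)) ↔ φ.Realize v :=
  (f.toEquiv.toElementaryEmbedding.map_formula φ v)

theorem definableIn_of_formula {n : ℕ} (φ : L.Formula (M.carrier ⊕ Fin n)) :
    DefinableIn M {v | φ.Realize (Sum.elim (fun x => x) v)} := by
  obtain ⟨m, ψ, b, -, hψ⟩ := exists_finite_support φ
  refine ⟨m, ψ.relabel Sum.swap, b, fun _ => trivial, ?_⟩
  ext v
  rw [Set.mem_ofPred_eq, Set.mem_ofPred_eq, hψ M.carrier M.struc (fun x => x) v]
  refine Iff.trans (iff_of_eq (congrArg _ ?_)) Formula.realize_relabel.symm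
  funext x
  rcases x with x | x <;> rfl

theorem ArReducible.trans {X Y Z : Set ℕ} (h : ArReducible X Y) (h' : ArReducible Y Z) :
    ArReducible X Z := by
  rw [← Ar.arReducible] at h ⊢
  exact Ar.trans h' h

theorem ArEquiv.symm {X Y : Set ℕ} (h : ArEquiv X Y) : ArEquiv Y X := ⟨h.2, h.1⟩

theorem ArEquiv.trans {X Y Z : Set ℕ} (h : ArEquiv X Y) (h' : ArEquiv Y Z) : ArEquiv X Z :=
  ⟨h.1.trans h'.1, h'.2.trans h.2⟩

theorem arEquiv_tupleSetCode_formula {P : Set ℕ} (hM : ElemSub M₀ M) (hN : ElemSub M N)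
    (E : ElemSub M₀ N) (φ : L.Formula (M₀.carrier ⊕ Unit))
    (h : P = {x | x ∈ M.carrier ∧ ∃ hx : x ∈ N.carrier,
      φ.Realize (Sum.elim E.inc fun _ => ⟨x, hx⟩)}) :
    ArEquiv (tupleSetCode {v : Fin 1 → M.carrier |
      φ.Realize (Sum.elim hM.inc fun _ => v 0)}) P := by
  have e : P = {x | ∃ hx : x ∈ M.carrier, φ.Realize (Sum.elim hM.inc fun _ => ⟨x, hx⟩)} := by
    rw [h]
    ext x
    constructor
    · rintro ⟨hx, hx', hr⟩
      refine ⟨hx, (hN.realize φ _).1 ?_⟩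
      convert hr using 1
      funext z
      rcases z with z | z <;> rfl
    · rintro ⟨hx, hr⟩
      refine ⟨hx, hN.subset hx, ?_⟩
      have := (hN.realize φ _).2 hr
      convert this using 1
      funext z
      rcases z with z | z <;> rfl
  rw [e]
  exact arEquiv_tupleSetCode_one (P := fun x : M.carrier => φ.Realize (Sum.elim hM.inc fun _ => x))

end Iso

section Categorical

variable {L : FirstOrder.Language} {g : GoedelCoding L} {T : L.Theory} {D : Set ℕ}
  {M₀ : CodedStructure L}

theorem infinite_of_models (hnf : NoFiniteModels L T) (hT : M₀.Models T) :
    Infinite M₀.carrier := hnf _ M₀.struc hT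

/-- The formula `x = m`. -/
def eqParam {M : Type} (m : M) : L.Formula (M ⊕ Unit) :=
  Term.equal (Term.var (Sum.inr ())) (Term.var (Sum.inl m))

theorem realize_eqParam {M N : Type} [L.Structure N] (m : M) (f : M → N) (x : N) :
    (eqParam m : L.Formula (M ⊕ Unit)).Realize (Sum.elim f fun _ => x) ↔ x = f m := by
  rw [eqParam, Formula.realize_equal]
  rfl

theorem not_small_eqParam (m : M₀.carrier) {X : Set M₀.carrier} (hX : X.Infinite) :
    ¬ Small L (fun x : M₀.carrier => (eqParam m : L.Formula _).Realize
      (Sum.elim (fun x => x) fun _ => x)) X := by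
  intro h
  have : Nonempty M₀.carrier := ⟨m⟩
  obtain ⟨p, k, ψ, n, b, hc⟩ := h.exists_covBy
  refine hX ((hc.finite ((Set.finite_singleton m).subset fun x hx => ?_)).subset fun x hx => hx)
  exact (realize_eqParam m _ x).1 hx

/-- Infinite definable sets cover decidable models. -/
theorem exists_covBy_of_infinite (hnf : NoFiniteModels L T) (hD : ¬ IsArithmetical D)
    (hcat : DCategorical g T D) (h₀ : ArithDecidable g M₀) (hT : M₀.Models T)
    (φ : L.Formula (M₀.carrier ⊕ Unit))
    (hinf : {x : M₀.carrier | φ.Realize (Sum.elim (fun x => x) fun _ => x)}.Infinite) :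
    ∃ (p m : ℕ) (ψ : L.Formula (Fin p ⊕ Fin m ⊕ Unit)) (k : ℕ) (b : Fin m → M₀.carrier),
      CovBy ψ k b (fun x => φ.Realize (Sum.elim (fun x => x) fun _ => x)) (fun _ => True) := by
  by_contra hno
  have := infinite_of_models hnf hT
  obtain ⟨m⟩ : Nonempty M₀.carrier := inferInstance
  have he : ArF ∅ fun _ : ℕ × ℕ => (m : ℕ) := by fun_prop
  obtain ⟨N₁, E₁, _, hN₁, h₁, -⟩ := exists_tree h₀ φ (eqParam m)
    ⟨m, (realize_eqParam m _ m).2 rfl⟩ (not_small_eqParam m hinf) (fun _ _ => m) he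
  obtain ⟨N₂, E₂, _, hN₂, h₂, -⟩ := exists_tree h₀ ⊤ φ hinf.nonempty (fun h => by
    obtain ⟨p, k, ψ, n, b, hc⟩ := h.exists_covBy
    exact hno ⟨p, k, ψ, n, b, hc.1, fun x _ => hc.2 x (Formula.realize_top.2 trivial)⟩)
    (fun _ _ => m) he
  obtain ⟨M₁, hM₁, hMN₁, -, hD₁, hφ₁, -⟩ := h₁ D
  obtain ⟨M₂, hM₂, hMN₂, -, hD₂, -, hφ₂⟩ := h₂ D
  obtain ⟨f, hf, hfix⟩ := hcat M₀ M₁ M₂ h₀ hT (hM₁.models.1 hT)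
    ⟨N₁, hN₁, E₁.models.1 hT, hMN₁⟩ (hM₂.models.1 hT) ⟨N₂, hN₂, E₂.models.1 hT, hMN₂⟩
    hM₁ hM₂ hD₁ hD₂
  have hfix' : ∀ x : M₀.carrier, f.toFun (hM₁.inc x) = hM₂.inc x := fun x =>
    Subtype.ext (hfix x x.2 _)
  have hdef : DefinableIn M₁ {v : Fin 1 → M₁.carrier |
      φ.Realize (Sum.elim hM₁.inc fun _ => v 0)} := by
    convert definableIn_of_formula (φ.relabel (Sum.map hM₁.inc fun _ => 0)) using 3 with v
    rw [Formula.realize_relabel]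
    refine iff_of_eq (congrArg _ ?_)
    funext z
    rcases z with z | z <;> rfl
  have key := hf.2.2.1 1 _ hdef
    ((arEquiv_tupleSetCode_formula hM₁ hMN₁ E₁ φ rfl).trans hφ₁)
  have himg : ((fun v => f.toFun ∘ v) '' {v : Fin 1 → M₁.carrier |
      φ.Realize (Sum.elim hM₁.inc fun _ => v 0)}) = {v : Fin 1 → M₂.carrier |
      φ.Realize (Sum.elim hM₂.inc fun _ => v 0)} := by
    have hr : ∀ x : M₁.carrier, φ.Realize (Sum.elim hM₂.inc fun _ => f.toFun x) ↔
        φ.Realize (Sum.elim hM₁.inc fun _ => x) := by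
      intro x
      rw [← f.realize]
      refine iff_of_eq (congrArg _ ?_)
      funext z
      rcases z with z | z
      · exact (hfix' z).symm
      · rfl
    ext v
    constructor
    · rintro ⟨w, hw, rfl⟩
      exact (hr _).2 hw
    · intro hv
      refine ⟨f.invFun ∘ v, (hr _).1 ?_, ?_⟩
      · simp only [Function.comp, f.right_inv _]
        exact hv
      · funext i
        exact f.right_inv _
  rw [himg] at key
  exact hD ((key.symm.trans (arEquiv_tupleSetCode_formula hM₂ hMN₂ E₂ φ rfl)).1.trans hφ₂)

end Categorical

section Minimal

variable {L : FirstOrder.Language} {g : GoedelCoding L} {T : L.Theory} {D : Set ℕ}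
  {M₀ : CodedStructure L}

theorem dfn_sat_cons (c : ℕ) (l : List ℕ) :
    Dfn L (fun v : Unit → M₀.carrier => Sat g M₀ c ((v () : ℕ) :: l)) := by
  by_cases h : ∀ x ∈ l, x ∈ M₀.carrier
  · refine ((dfn_sat (g := g) c (Sum.inr () :: l.attach.map fun x =>
      (Sum.inl ⟨x.1, h x.1 x.2⟩ : M₀.carrier ⊕ Unit))).subst
      (Sum.elim (fun x => Sum.inl x) fun _ => Sum.inr ())).congr fun _ v => ?_
    refine iff_of_eq (congrArg _ ?_)
    simp
  · refine UDf.false.congr fun _ v => ?_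
    simp only [false_iff]
    exact fun hs => h fun x hx => hs.mem (List.mem_cons_of_mem _ hx)

theorem dfn_sat_list (l : List (ℕ × List ℕ)) :
    Dfn L (fun v : Unit → M₀.carrier => ∀ b ∈ l, Sat g M₀ b.1 ((v () : ℕ) :: b.2)) := by
  induction l with
  | nil => exact UDf.true.congr fun _ v => by simp
  | cons a l ih =>
    exact ((dfn_sat_cons (g := g) a.1 a.2).and ih).congr fun _ v => by simp

/-- Realizing a formula with parameters, in terms of codes. -/
theorem exists_sat_iff (φ : L.Formula (M₀.carrier ⊕ Unit)) :
    ∃ (c : ℕ) (l : List ℕ), (∀ x ∈ l, x ∈ M₀.carrier) ∧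
      ∀ (N : CodedStructure L) (E : ElemSub M₀ N) (x : N.carrier),
        Sat g N c ((x : ℕ) :: l) ↔ φ.Realize (Sum.elim E.inc fun _ => x) := by
  obtain ⟨m, ψ, b, -, hψ⟩ := exists_finite_support φ
  refine ⟨fc g (ψ.relabel (Sum.elim Fin.succ fun _ => 0) : L.Formula (Fin (m + 1))), vals b, ?_, ?_⟩
  · intro x hx
    obtain ⟨i, rfl⟩ := (List.mem_ofFn ..).1 hx
    exact Subtype.mem _
  · intro N E x
    have : (x : ℕ) :: vals b = vals (Fin.cons x fun i => E.inc (b i) : Fin (m + 1) → N.carrier) := by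
      rw [vals_cons]
      rfl
    rw [this, sat_iff, hψ N.carrier N.struc E.inc, Formula.realize_relabel]
    refine iff_of_eq (congrArg _ ?_)
    funext z
    rcases z with z | z <;> simp

/-- There is a minimal formula over every decidable model. -/
theorem exists_minimal (hnf : NoFiniteModels L T)
    (hcat : DCategorical g T D) (h₀ : ArithDecidable g M₀) (hT : M₀.Models T) :
    ∃ φ : L.Formula (M₀.carrier ⊕ Unit),
      {x : M₀.carrier | φ.Realize (Sum.elim (fun x => x) fun _ => x)}.Infinite ∧
      ∀ ψ : L.Formula (M₀.carrier ⊕ Unit),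
        {x : M₀.carrier | φ.Realize (Sum.elim (fun x => x) fun _ => x) ∧
          ψ.Realize (Sum.elim (fun x => x) fun _ => x)}.Finite ∨
        {x : M₀.carrier | φ.Realize (Sum.elim (fun x => x) fun _ => x) ∧
          ¬ ψ.Realize (Sum.elim (fun x => x) fun _ => x)}.Finite := by
  by_contra hno
  push Not at hno
  have hinf := infinite_of_models hnf hT
  obtain ⟨m⟩ : Nonempty M₀.carrier := inferInstance
  have he : ArF ∅ fun _ : ℕ × ℕ => (m : ℕ) := by fun_prop
  have htree := fun e he => exists_tree h₀ ⊤ (eqParam m)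
    ⟨m, (realize_eqParam m _ m).2 rfl⟩ (not_small_eqParam m (by simpa using Set.infinite_univ)) e he
  obtain ⟨N₁, E₁, _, hN₁, h₁, -⟩ := htree (fun _ _ => m) he
  obtain ⟨M₁, hM₁, hMN₁, -, hD₁, -⟩ := h₁ D
  let cond : List (ℕ × List ℕ) → ℕ → Prop := fun l x =>
    x ∈ M₀.carrier ∧ ∀ b, b ∈ l → Sat g M₀ b.1 (x :: b.2)
  have hcond : Ar ∅ fun x : List (ℕ × List ℕ) × ℕ => cond x.1 x.2 := by
    refine Ar.and (h₀.carrier.comp Primrec.snd) (Ar.all (p := fun (x : List (ℕ × List ℕ) × ℕ) b =>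
      b ∈ x.1 → Sat g M₀ b.1 (x.2 :: b.2)) (Ar.imp (Ar.memList (by fun_prop) (by fun_prop)) ?_))
    exact h₀.sat.compF (f := fun x : (List (ℕ × List ℕ) × ℕ) × (ℕ × List ℕ) =>
      (x.2.1, x.1.2 :: x.2.2)) (by fun_prop)
  obtain ⟨F, -, hF, hstep⟩ := Ar.recursion (α := Unit) (Y := ∅)
    (p := fun _ (l : List (ℕ × List ℕ)) b => ¬ {x | cond (l ++ [b]) x}.Finite ∧
      (∀ z, z ∈ b.2 → z ∈ M₀.carrier) ∧ ¬ Sat g N₁ b.1 (l.length :: b.2)) (by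
    refine Ar.and (Ar.not (Ar.finite (p := fun (x : (Unit × List (ℕ × List ℕ)) × (ℕ × List ℕ)) n =>
      cond (x.1.2 ++ [x.2]) n) ?_)) (Ar.and ?_ (Ar.not ?_))
    · exact hcond.compF (f := fun x : ((Unit × List (ℕ × List ℕ)) × (ℕ × List ℕ)) × ℕ =>
        (x.1.1.2 ++ [x.1.2], x.2)) (by fun_prop)
    · exact Ar.all (p := fun (x : (Unit × List (ℕ × List ℕ)) × (ℕ × List ℕ)) z =>
        z ∈ x.2.2 → z ∈ M₀.carrier) (Ar.imp (Ar.memList (by fun_prop) (by fun_prop))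
          (h₀.carrier.comp Primrec.snd))
    · exact hN₁.sat.compF (f := fun x : (Unit × List (ℕ × List ℕ)) × (ℕ × List ℕ) =>
        (x.2.1, x.1.2.length :: x.2.2)) (by fun_prop))
  set H : ℕ → List (ℕ × List ℕ) := fun n => (List.range n).map (F ()) with hH
  have hsucc : ∀ n, H (n + 1) = H n ++ [F () n] := fun n => by simp [hH, List.range_succ]
  have hlen : ∀ n, (H n).length = n := fun n => by simp [hH]
  have hinj : Function.Injective (Subtype.val : M₀.carrier → ℕ) := Subtype.val_injective
  have himg : ∀ l (P : M₀.carrier → Prop), (∀ x, P x ↔ cond l x) →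
      ({x | cond l x}.Finite ↔ {x | P x}.Finite) := by
    intro l P hP
    have : {x | cond l x} = Subtype.val '' {x | P x} := by
      ext x
      constructor
      · intro hx
        exact ⟨⟨x, hx.1⟩, (hP _).2 hx, rfl⟩
      · rintro ⟨y, hy, rfl⟩
        exact (hP _).1 hy
    rw [this, Set.finite_image_iff hinj.injOn]
  have hex : ∀ n, ¬ {x | cond (H n) x}.Finite → ∃ b, ¬ {x | cond (H n ++ [b]) x}.Finite ∧
      (∀ z, z ∈ b.2 → z ∈ M₀.carrier) ∧ ¬ Sat g N₁ b.1 ((H n).length :: b.2) := by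
    intro n hn
    obtain ⟨φ, hφ⟩ := dfn_sat_list (g := g) (M₀ := M₀) (H n)
    have hφ' : ∀ x : M₀.carrier, φ.Realize (Sum.elim (fun x => x) fun _ => x) ↔ cond (H n) x :=
      fun x => (hφ () (fun _ => x)).trans ⟨fun h => ⟨x.2, h⟩, fun h => h.2⟩
    rw [himg _ _ hφ'] at hn
    obtain ⟨ψ, hψ1, hψ2⟩ := hno φ hn
    have key : ∀ ψ' : L.Formula (M₀.carrier ⊕ Unit),
        {x : M₀.carrier | φ.Realize (Sum.elim (fun x => x) fun _ => x) ∧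
          ψ'.Realize (Sum.elim (fun x => x) fun _ => x)}.Infinite →
        (∀ h : n ∈ N₁.carrier, ¬ ψ'.Realize (Sum.elim E₁.inc fun _ => ⟨n, h⟩)) →
        ∃ b, ¬ {x | cond (H n ++ [b]) x}.Finite ∧
      (∀ z, z ∈ b.2 → z ∈ M₀.carrier) ∧ ¬ Sat g N₁ b.1 ((H n).length :: b.2) := by
      intro ψ' hi hN
      obtain ⟨c, l, hl, hc⟩ := exists_sat_iff (g := g) ψ'
      refine ⟨(c, l), ?_, hl, ?_⟩
      · rw [himg _ _ (fun x => ?_)]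
        · exact hi
        · have h2 := hc M₀ ⟨le_rfl, fun _ _ _ => Iff.rfl⟩ x
          simp only [cond, List.mem_append, List.mem_singleton, or_imp, forall_and, forall_eq] at hφ' ⊢
          rw [h2, hφ']
          exact and_assoc
      · intro hs
        rw [hlen] at hs
        have hn : n ∈ N₁.carrier := hs.mem (by simp)
        exact hN hn ((hc N₁ E₁ ⟨n, hn⟩).1 hs)
    by_cases hN : ∀ h : n ∈ N₁.carrier, ¬ ψ.Realize (Sum.elim E₁.inc fun _ => ⟨n, h⟩)
    · exact key ψ hψ1 hN
    · push Not at hN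
      obtain ⟨h, hr⟩ := hN
      refine key (∼ψ) ?_ fun h' hr' => ?_
      · refine hψ2.mono fun x hx => ⟨hx.1, Formula.realize_not.2 hx.2⟩
      · exact (Formula.realize_not.1 hr') hr
  have hall : ∀ n, ¬ {x | cond (H n) x}.Finite := by
    intro n
    induction n with
    | zero =>
      rw [himg _ (fun _ => True) (fun x => ⟨fun _ => ⟨x.2, by simp [hH]⟩, fun _ => trivial⟩)]
      exact Set.infinite_univ
    | succ n ih =>
      rw [hsucc]
      exact (hstep () n (hex n ih)).1
  obtain ⟨d, hd, hdc⟩ := Ar.choose (Y := ∅) (p := fun n x => cond (H (n + 1)) x)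
    (hcond.compF (f := fun x : ℕ × ℕ => (H (x.1 + 1), x.2))
      ((hF.comp (f := fun x : ℕ × ℕ => ((), x.1 + 1)) (by fun_prop)).prodMk (by fun_prop)))
  have hdc' : ∀ n, cond (H (n + 1)) (d n) := fun n => hdc n (Set.Infinite.nonempty (hall (n + 1)))
  obtain ⟨N₂, E₂, α, hN₂, h₂, hα⟩ := htree (fun _ n => ⟨d n, (hdc' n).1⟩)
    (hd.comp (f := fun x : ℕ × ℕ => x.2) (by fun_prop))
  obtain ⟨M₂, hM₂, hMN₂, hαM, hD₂, -⟩ := h₂ D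
  obtain ⟨f, hf, hfix⟩ := hcat M₀ M₁ M₂ h₀ hT (hM₁.models.1 hT)
    ⟨N₁, hN₁, E₁.models.1 hT, hMN₁⟩ (hM₂.models.1 hT) ⟨N₂, hN₂, E₂.models.1 hT, hMN₂⟩
    hM₁ hM₂ hD₁ hD₂
  set y := f.invFun ⟨α 0, hαM 0⟩ with hy
  set n := (y : ℕ) with hn
  obtain ⟨-, hl, hns⟩ := hstep () n (hex n (hall n))
  have hmem : ∀ k, n ≤ k → F () n ∈ H (k + 1) := fun k hk =>
    List.mem_map.2 ⟨n, by simp; omega, rfl⟩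
  replace hns : ¬ Sat g N₁ (F () n).1 ((H n).length :: (F () n).2) := hns
  obtain ⟨b, hb⟩ := exists_vals (A := M₀.carrier) (F () n).2 hl
  obtain ⟨k, φ, a, hc, hla, -⟩ := (hdc' n).2 _ (hmem n le_rfl)
  obtain rfl : k = (F () n).2.length + 1 := by simpa using (congrArg List.length hla).symm
  have hs : ∀ᶠ i in Filter.atTop, (φ.relabel (Fin.cases (Sum.inr 0) fun j => Sum.inl (b j)) :
      L.Formula (M₀.carrier ⊕ ℕ)).Realize (Sum.elim (fun x => x)
        fun j => (fun _ n => ⟨d n, (hdc' n).1⟩ : ℕ → ℕ → M₀.carrier) j i) := by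
    filter_upwards [Filter.eventually_ge_atTop n] with i hi
    have h3 := (hdc' i).2 _ (hmem i hi)
    rw [← hb, hc] at h3
    have : d i :: vals b = vals (Fin.cons (⟨d i, (hdc' i).1⟩ : M₀.carrier) b :
        Fin ((F () n).2.length + 1) → M₀.carrier) := by
      rw [vals_cons]
    rw [this, sat_iff] at h3
    rw [Formula.realize_relabel]
    convert h3 using 1
    funext z
    refine Fin.cases ?_ (fun j => ?_) z <;> rfl
  have h4 := hα _ hs
  rw [Formula.realize_relabel] at h4
  have h5 : φ.Realize (Fin.cons (⟨α 0, hαM 0⟩ : M₂.carrier) fun j => hM₂.inc (b j)) := by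
    rw [← hMN₂.realize]
    convert h4 using 1
    funext z
    refine Fin.cases ?_ (fun j => ?_) z <;> rfl
  have h6 : φ.Realize (Fin.cons y fun j => hM₁.inc (b j)) := by
    rw [← f.realize]
    convert h5 using 1
    funext z
    refine Fin.cases ?_ (fun j => ?_) z
    · exact f.right_inv _
    · exact Subtype.ext (hfix (b j) (b j).2 _)
  rw [← sat_iff (g := g), ← hc, vals_cons] at h6
  have e : (y : ℕ) :: vals (fun j => hM₁.inc (b j)) = n :: (F () n).2 := congrArg _ hb
  have h8 := (congrArg (Sat g M₁ (F () n).1) e).mp h6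
  rw [hlen] at hns
  exact hns ((hMN₁.sat fun x hx => h8.mem hx).2 h8)

end Minimal

section Bound

variable {L : FirstOrder.Language} {g : GoedelCoding L} {T : L.Theory} {D : Set ℕ}
  {M₀ : CodedStructure L}

theorem sat_cons_vals {N : CodedStructure L} {k : ℕ} (φ : L.Formula (Fin k ⊕ Unit))
    (e : Fin k → N.carrier) (x : N.carrier) :
    Sat g N (fc g (φ.relabel (Sum.elim Fin.succ fun _ => 0) : L.Formula (Fin (k + 1))))
      ((x : ℕ) :: vals e) ↔ φ.Realize (Sum.elim e fun _ => x) := by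
  rw [← vals_cons, sat_iff, Formula.realize_relabel]
  refine iff_of_eq (congrArg _ ?_)
  funext z
  rcases z with z | z <;> simp

theorem not_atMost_iff_forall_list {X : Type} {k : ℕ} {p : X → Prop} :
    ¬ AtMost k p ↔ ∀ s : List X, s.length ≤ k → ∃ x, p x ∧ x ∉ s := by
  classical
  constructor
  · intro h s hs
    by_contra hc
    push Not at hc
    refine h (atMost_iff.2 ⟨s.toFinset.finite_toSet.subset fun x hx => by simpa using hc x hx, ?_⟩)
    refine (Set.ncard_le_ncard (t := (s.toFinset : Set X)) (fun x hx => by simpa using hc x hx)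
      s.toFinset.finite_toSet).trans ?_
    rw [Set.ncard_coe_finset]
    exact s.toFinset_card_le.trans hs
  · intro h hc
    obtain ⟨h1, h2⟩ := atMost_iff.1 hc
    obtain ⟨x, hx, hn⟩ := h h1.toFinset.toList (by
      rw [Finset.length_toList, ← Set.ncard_eq_toFinset_card _ h1]
      exact h2)
    exact hn (by simpa using hx)

/-- Finite definable sets in a uniform family have bounded size. -/
theorem exists_bound (hnf : NoFiniteModels L T) (hD : ¬ IsArithmetical D)
    (hcat : DCategorical g T D) (h₀ : ArithDecidable g M₀) (hT : M₀.Models T) {k : ℕ}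
    (φ : L.Formula (Fin k ⊕ Unit)) :
    ∃ K, ∀ e : Fin k → M₀.carrier, {x | φ.Realize (Sum.elim e fun _ => x)}.Finite →
      AtMost K (fun x => φ.Realize (Sum.elim e fun _ => x)) := by
  by_contra hno
  push Not at hno
  have hinf := infinite_of_models hnf hT
  obtain ⟨m⟩ : Nonempty M₀.carrier := inferInstance
  set c := fc g (φ.relabel (Sum.elim Fin.succ fun _ => 0) : L.Formula (Fin (k + 1))) with hc
  have himg : ∀ e : Fin k → M₀.carrier, {x : ℕ | Sat g M₀ c (x :: vals e)} =
      Subtype.val '' {x : M₀.carrier | φ.Realize (Sum.elim e fun _ => x)} := by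
    intro e
    ext x
    constructor
    · intro hx
      exact ⟨⟨x, hx.mem (by simp)⟩, (sat_cons_vals (g := g) φ e ⟨x, _⟩).1 hx, rfl⟩
    · rintro ⟨y, hy, rfl⟩
      exact (sat_cons_vals (g := g) φ e y).2 hy
  obtain ⟨f, hf, hq⟩ := Ar.choose (Y := ∅) (p := fun (n : ℕ) (l : List ℕ) => l.length = k ∧
      (∀ z, z ∈ l → z ∈ M₀.carrier) ∧ {x | Sat g M₀ c (x :: l)}.Finite ∧
      ∀ s : List ℕ, s.length ≤ n → ∃ x, Sat g M₀ c (x :: l) ∧ x ∉ s) (by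
    refine Ar.and (Ar.eq (by fun_prop) (by fun_prop)) (Ar.and ?_ (Ar.and ?_ ?_))
    · exact Ar.all (p := fun (x : ℕ × List ℕ) z => z ∈ x.2 → z ∈ M₀.carrier)
        (Ar.imp (Ar.memList (by fun_prop) (by fun_prop)) (h₀.carrier.comp Primrec.snd))
    · exact Ar.finite (p := fun (x : ℕ × List ℕ) z => Sat g M₀ c (z :: x.2))
        (h₀.sat.compF (f := fun x : (ℕ × List ℕ) × ℕ => (c, x.2 :: x.1.2)) (by fun_prop))
    · refine Ar.all (p := fun (x : ℕ × List ℕ) (s : List ℕ) => s.length ≤ x.1 →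
        ∃ z, Sat g M₀ c (z :: x.2) ∧ z ∉ s) (Ar.imp (Ar.le (by fun_prop) (by fun_prop)) ?_)
      refine Ar.ex (p := fun (x : (ℕ × List ℕ) × List ℕ) z => Sat g M₀ c (z :: x.1.2) ∧ z ∉ x.2)
        (Ar.and ?_ (Ar.not (Ar.memList (by fun_prop) (by fun_prop))))
      exact h₀.sat.compF (f := fun x : ((ℕ × List ℕ) × List ℕ) × ℕ => (c, x.2 :: x.1.1.2))
        (by fun_prop))
  replace hq := fun n => hq n (by
    obtain ⟨e, he, hn⟩ := hno n
    refine ⟨vals e, vals_length e, ?_, ?_, ?_⟩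
    · intro z hz
      obtain ⟨i, rfl⟩ := (List.mem_ofFn ..).1 hz
      exact Subtype.mem _
    · rw [himg]
      exact he.image _
    · intro s hs
      obtain ⟨x, hx, hxs⟩ := not_atMost_iff_forall_list.1 hn
        (s.filterMap fun z => by classical exact if h : z ∈ M₀.carrier then some ⟨z, h⟩ else none)
        ((List.length_filterMap_le _ _).trans hs)
      refine ⟨x, (sat_cons_vals (g := g) φ e x).2 hx, fun hs => hxs ?_⟩
      exact List.mem_filterMap.2 ⟨x, hs, by simp⟩)
  have hex : ∀ n, ∃ e : Fin k → M₀.carrier, vals e = f n := fun n =>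
    exists_vals' _ (hq n).1 (hq n).2.1
  choose e he using hex
  let d : ℕ → ℕ → M₀.carrier := fun i n => if h : i < k then e n ⟨i, h⟩ else m
  obtain ⟨N, E, ν, hN, -, hν⟩ := exists_ultra h₀ d ((ArF.congr (f := fun x : ℕ × ℕ =>
    (f x.2).getD x.1 m) (by fun_prop) fun x => by
      rw [← he]
      by_cases h : x.1 < k
      · simp [d, h, vals, List.getD]
      · simp [d, h, vals, List.getD]))
  have hφ : ∀ {α : Type} (w : Fin k → α), UDf (extPt E) (α := α ⊕ Unit) fun i v =>
      @Formula.Realize L _ (extPt E i).S _ φ (Sum.elim (fun j => v (Sum.inl (w j)))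
        fun _ => v (Sum.inr ())) := by
    intro α w
    refine (UDf.formula (A := extPt E) φ (Sum.elim (fun j => Sum.inr (Sum.inl (w j)))
      fun _ => Sum.inr (Sum.inr ()))).congr fun i v => iff_of_eq (congrArg _ ?_)
    funext x
    rcases x with x | x <;> rfl
  have hbig : ∀ K, ¬ AtMost K fun x : N.carrier => φ.Realize (Sum.elim (fun j => ν j) fun _ => x) := by
    intro K
    obtain ⟨χ, hχ⟩ := (UDf.atMost (A := extPt E) (α := ℕ) K
      (P := fun i v x => @Formula.Realize L _ (extPt E i).S _ φ
        (Sum.elim (fun j => v ((j : Fin k) : ℕ)) fun _ => x)) (hφ fun j => (j : ℕ))).not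
    refine (hχ Bool.true ν).1 (hν χ ?_)
    filter_upwards [Filter.eventually_ge_atTop K] with n hn
    refine (hχ Bool.false fun i => d i n).2 fun hs => ?_
    have hd : (fun j : Fin k => d j n) = e n := by
      funext j
      simp [d]
    change AtMost K (fun x : M₀.carrier =>
      φ.Realize (Sum.elim (fun j : Fin k => d j n) fun _ => x)) at hs
    rw [hd] at hs
    refine not_atMost_iff_forall_list.2 (fun s hsl => ?_) (hs.mono hn fun _ h => h)
    obtain ⟨x, hx, hxs⟩ := (hq n).2.2.2 (s.map Subtype.val) (by simpa using hsl)
    rw [← he] at hx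
    refine ⟨⟨x, hx.mem (by simp)⟩, (sat_cons_vals (g := g) φ (e n) ⟨x, _⟩).1 hx, fun h => hxs ?_⟩
    exact List.mem_map.2 ⟨_, h, rfl⟩
  have hinfN : {x : N.carrier | (φ.relabel (Sum.map (fun j : Fin k => ν j) id)).Realize
      (Sum.elim (fun x => x) fun _ => x)}.Infinite := by
    intro hfin
    refine hbig _ (atMost_iff.2 ⟨hfin.subset fun x hx => ?_, le_rfl⟩)
    rw [Set.mem_ofPred_eq, Formula.realize_relabel]
    refine (iff_of_eq (congrArg _ ?_)).1 (Set.mem_ofPred_eq ▸ hx)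
    funext z
    rcases z with z | z <;> rfl
  obtain ⟨p, m', ψ, K, b, hcov⟩ := exists_covBy_of_infinite hnf hD hcat hN (E.models.1 hT) _ hinfN
  obtain ⟨χ, hχ⟩ := UDf.ex (A := extPt E) (α := ℕ) (β := Fin m') (P := fun i (v : ℕ ⊕ Fin m' → (extPt E i).M) => @CovBy L _
      (extPt E i).S p m' ψ K (fun j => v (Sum.inr j)) (fun x => @Formula.Realize L _ (extPt E i).S _ φ
        (Sum.elim (fun j => v (Sum.inl ((j : Fin k) : ℕ))) fun _ => x)) (fun _ => True))
    (UDf.covBy (A := extPt E) ψ K (fun j => Sum.inr (Sum.inr j))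
      (η := fun i v x => @Formula.Realize L _ (extPt E i).S _ φ
        (Sum.elim (fun j => v (Sum.inl ((j : Fin k) : ℕ))) fun _ => x)) (X := fun _ _ _ => True)
      (hφ fun j => Sum.inl (j : ℕ)) UDf.true)
  have htop : χ.Realize (Sum.elim E.inc ν) := by
    refine (hχ Bool.true ν).2 ⟨b, hcov.mono fun x hx => ?_⟩
    rw [Formula.realize_relabel] at hx
    refine (iff_of_eq (congrArg _ ?_)).1 hx
    funext z
    rcases z with z | z <;> rfl
  have hlow : ∃ n, χ.Realize (Sum.elim (fun x => x) fun i => d i n) := by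
    by_contra hn
    push Not at hn
    have := hν (∼χ) (Filter.Eventually.of_forall fun n => Formula.realize_not.2 (hn n))
    exact Formula.realize_not.1 this htop
  obtain ⟨n, hn⟩ := hlow
  obtain ⟨b', hb'⟩ := (hχ Bool.false fun i => d i n).1 hn
  have hd : (fun j : Fin k => d j n) = e n := by
    funext j
    simp [d]
  have hfin : {x : M₀.carrier | φ.Realize (Sum.elim (e n) fun _ => x)}.Finite := by
    refine Set.Finite.of_finite_image ?_ Subtype.val_injective.injOn
    rw [← himg, he]
    exact (hq n).2.2.1
  rw [← hd] at hfin
  exact hinf.not_finite (Set.finite_univ_iff.1 (CovBy.finite hb' hfin))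

end Bound

/-! ## Extending partial elementary maps -/

section Extend

variable {L : FirstOrder.Language} {C I : Type} {A : I → Pt L C} {i j : I} {α β : Type}

/-- Realization of a formula with named parameters. -/
def Pt.Holds (p : Pt L C) (χ : L.Formula (C ⊕ α)) (v : α → p.M) : Prop :=
  @Formula.Realize L _ p.S _ χ (Sum.elim p.c v)

theorem UDf.holds (χ : L.Formula (C ⊕ α)) : UDf A fun i v => (A i).Holds χ v :=
  ⟨χ, fun _ _ => Iff.rfl⟩

theorem UDf.holds1 (χ : L.Formula (C ⊕ (α ⊕ Unit))) :
    UDf (α := α ⊕ Unit) A fun i v => (A i).Holds χ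
      (Sum.elim (fun a => v (Sum.inl a)) fun _ => v (Sum.inr ())) :=
  (UDf.holds χ).congr fun i v => iff_of_eq (congrArg _ (by funext z; rcases z with z | z <;> rfl))

/-- Tuples with the same type over the named elements. -/
def SameType (A : I → Pt L C) (i j : I) (a : α → (A i).M) (b : α → (A j).M) : Prop :=
  ∀ χ : L.Formula (C ⊕ α), (A i).Holds χ a ↔ (A j).Holds χ b

theorem SameType.udf {a : α → (A i).M} {b : α → (A j).M} (h : SameType A i j a b)
    {P : ∀ i, (α → (A i).M) → Prop} (hP : UDf A P) : P i a ↔ P j b := by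
  obtain ⟨χ, hχ⟩ := hP
  exact (hχ i a).symm.trans ((h χ).trans (hχ j b))

theorem SameType.symm {a : α → (A i).M} {b : α → (A j).M} (h : SameType A i j a b) :
    SameType A j i b a := fun χ => (h χ).symm

theorem SameType.comp {a : α → (A i).M} {b : α → (A j).M} (h : SameType A i j a b)
    (f : β → α) : SameType A i j (fun x => a (f x)) fun x => b (f x) :=
  fun χ => h.udf ((UDf.holds χ).comp f)

theorem SameType.of_imp {a : α → (A i).M} {b : α → (A j).M}
    (h : ∀ χ : L.Formula (C ⊕ α), (A i).Holds χ a → (A j).Holds χ b) : SameType A i j a b := by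
  refine fun χ => ⟨h χ, fun hb => ?_⟩
  by_contra ha
  obtain ⟨χ', hχ'⟩ := UDf.not (UDf.holds (A := A) χ)
  exact (hχ' j b).1 (h χ' ((hχ' i a).2 ha)) hb

/-- The element `x` is algebraic over `a`. -/
def IsAlg (p : Pt L C) (a : α → p.M) (x : p.M) : Prop :=
  ∃ Q : L.Formula (C ⊕ (α ⊕ Unit)), p.Holds Q (Sum.elim a fun _ => x) ∧
    {z | p.Holds Q (Sum.elim a fun _ => z)}.Finite

theorem IsAlg.of_udf {a : α → (A i).M} {x : (A i).M} {P : ∀ i, (α → (A i).M) → (A i).M → Prop}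
    (hP : UDf (α := α ⊕ Unit) A fun i v => P i (fun a => v (Sum.inl a)) (v (Sum.inr ())))
    (hx : P i a x) (hf : {z | P i a z}.Finite) : IsAlg (A i) a x := by
  obtain ⟨χ, hχ⟩ := hP
  refine ⟨χ, (hχ i _).2 hx, hf.subset fun z hz => (hχ i _).1 hz⟩

theorem SameType.extend_isAlg {a : α → (A i).M} {b : α → (A j).M} (h : SameType A i j a b)
    {x : (A i).M} (hx : IsAlg (A i) a x) :
    ∃ y, SameType A i j (Sum.elim a fun _ : Unit => x) (Sum.elim b fun _ => y) := by
  classical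
  have hex : ∃ k, ∃ Q : L.Formula (C ⊕ (α ⊕ Unit)), (A i).Holds Q (Sum.elim a fun _ => x) ∧
      AtMost k fun z => (A i).Holds Q (Sum.elim a fun _ => z) := by
    obtain ⟨Q, hQ, hf⟩ := hx
    exact ⟨_, Q, hQ, atMost_iff.2 ⟨hf, le_rfl⟩⟩
  obtain ⟨Q, hQ, hk⟩ := Nat.find_spec hex
  have hmin := fun m => Nat.find_min hex (m := m)
  obtain ⟨y, hy⟩ := (h.udf (UDf.ex1 (P := fun i v z => (A i).Holds Q (Sum.elim v fun _ => z))
    (UDf.holds1 Q))).1 ⟨x, hQ⟩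
  refine ⟨y, SameType.of_imp fun χ hχ => ?_⟩
  refine (h.udf (UDf.all1 (P := fun i v z => (A i).Holds Q (Sum.elim v fun _ => z) →
    (A i).Holds χ (Sum.elim v fun _ => z)) ((UDf.holds1 Q).imp (UDf.holds1 χ)))).1 ?_ y hy
  intro z hz
  by_contra hzχ
  obtain ⟨χ', hχ'⟩ := (UDf.holds1 (A := A) Q).and (UDf.holds1 χ)
  obtain ⟨hf, hc⟩ := atMost_iff.1 hk
  have hlt : {z | (A i).Holds Q (Sum.elim a fun _ => z) ∧
      (A i).Holds χ (Sum.elim a fun _ => z)}.ncard <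
      {z | (A i).Holds Q (Sum.elim a fun _ => z)}.ncard :=
    Set.ncard_lt_ncard ⟨fun z hz => hz.1, fun hs => hzχ (hs hz).2⟩ hf
  refine hmin _ (hlt.trans_le hc) ⟨χ', (hχ' i _).2 ⟨hQ, hχ⟩, ?_⟩
  refine (atMost_iff.2 ⟨hf.subset fun z hz => hz.1, le_rfl⟩ : AtMost _ fun z =>
    (A i).Holds Q (Sum.elim a fun _ => z) ∧ (A i).Holds χ (Sum.elim a fun _ => z)).mono le_rfl
      fun z hz => (hχ' i _).1 hz

/-- A formula which is minimal, over which the structures are algebraic in a uniform way, and which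
has transcendental elements over finite sets. -/
structure Geometry (A : I → Pt L C) (φ : L.Formula (C ⊕ Unit)) : Prop where
  minimal : ∀ {α : Type} [Finite α] (Q : L.Formula (C ⊕ (α ⊕ Unit))), ∃ K, ∀ i (v : α → (A i).M),
    (AtMost K fun x => (A i).Holds φ (fun _ => x) ∧ (A i).Holds Q (Sum.elim v fun _ => x)) ∨
    (AtMost K fun x => (A i).Holds φ (fun _ => x) ∧ ¬ (A i).Holds Q (Sum.elim v fun _ => x))
  cover : ∃ (p m : ℕ) (ψ : L.Formula (Fin p ⊕ Fin m ⊕ Unit)) (k : ℕ) (b : Fin m → C),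
    ∀ i, @CovBy L (A i).M (A i).S p m ψ k (fun j => (A i).c (b j))
      (fun x => (A i).Holds φ fun _ => x) fun _ => True
  transcendental : ∀ {α : Type} [Finite α] i (v : α → (A i).M),
    ∃ y, (A i).Holds φ (fun _ => y) ∧ ¬ IsAlg (A i) v y

variable {φ : L.Formula (C ⊕ Unit)}

theorem UDf.holds_snd (φ : L.Formula (C ⊕ Unit)) :
    UDf (α := α ⊕ Unit) A fun i v => (A i).Holds φ fun _ => v (Sum.inr ()) :=
  (UDf.holds φ).comp fun _ => Sum.inr ()

theorem SameType.extend_mem (hA : Geometry A φ) [Finite α] {a : α → (A i).M} {b : α → (A j).M}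
    (h : SameType A i j a b) {x : (A i).M} (hx : (A i).Holds φ fun _ => x) :
    ∃ y, SameType A i j (Sum.elim a fun _ : Unit => x) (Sum.elim b fun _ => y) := by
  by_cases halg : IsAlg (A i) a x
  · exact h.extend_isAlg halg
  obtain ⟨y, hy, hny⟩ := hA.transcendental j b
  refine ⟨y, SameType.of_imp fun χ hχ => ?_⟩
  obtain ⟨K, hK⟩ := hA.minimal χ
  rcases hK i a with h1 | h1
  · exact absurd (IsAlg.of_udf (P := fun i v x => (A i).Holds φ (fun _ => x) ∧
      (A i).Holds χ (Sum.elim v fun _ => x)) ((UDf.holds_snd φ).and (UDf.holds1 χ)) ⟨hx, hχ⟩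
      h1.finite) halg
  · have hd := (UDf.holds_snd (A := A) (α := α) φ).and (UDf.holds1 χ).not
    have h2 := (h.udf (UDf.atMost K (P := fun i v x => (A i).Holds φ (fun _ => x) ∧
      ¬ (A i).Holds χ (Sum.elim v fun _ => x)) hd)).1 h1
    by_contra hn
    exact hny (IsAlg.of_udf (P := fun i v x => (A i).Holds φ (fun _ => x) ∧
      ¬ (A i).Holds χ (Sum.elim v fun _ => x)) hd ⟨hy, hn⟩ h2.finite)

theorem SameType.extend_tuple (hA : Geometry A φ) [Finite α] {a : α → (A i).M} {b : α → (A j).M}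
    (h : SameType A i j a b) {n : ℕ} (y : Fin n → (A i).M)
    (hy : ∀ k, (A i).Holds φ fun _ => y k) :
    ∃ z, SameType A i j (Sum.elim a y) (Sum.elim b z) := by
  induction n with
  | zero =>
    refine ⟨fun k => k.elim0, ?_⟩
    have := h.comp (Sum.elim id fun k : Fin 0 => k.elim0)
    convert this using 1
    · funext z
      rcases z with z | z
      · rfl
      · exact z.elim0
    · funext z
      rcases z with z | z
      · rfl
      · exact z.elim0
  | succ n ih =>
    obtain ⟨z, hz⟩ := ih (fun k => y k.castSucc) fun k => hy _
    obtain ⟨w, hw⟩ := hz.extend_mem hA (hy (Fin.last n))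
    refine ⟨Fin.snoc z w, ?_⟩
    have := hw.comp (Sum.elim (fun a => Sum.inl (Sum.inl a))
      (Fin.lastCases (Sum.inr ()) fun k => Sum.inl (Sum.inr k)) : α ⊕ Fin (n + 1) → _)
    convert this using 1
    · funext z
      rcases z with z | z
      · rfl
      · refine Fin.lastCases ?_ (fun k => ?_) z <;> simp
    · funext z
      rcases z with z | z
      · rfl
      · refine Fin.lastCases ?_ (fun k => ?_) z <;> simp

/-- Partial elementary maps between geometries extend. -/
theorem SameType.extend (hA : Geometry A φ) [Finite α] {a : α → (A i).M} {b : α → (A j).M}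
    (h : SameType A i j a b) (x : (A i).M) :
    ∃ y, SameType A i j (Sum.elim a fun _ : Unit => x) (Sum.elim b fun _ => y) := by
  obtain ⟨p, m, ψ, k, e, hc⟩ := hA.cover
  obtain ⟨y, hy, hψ⟩ := (hc i).2 x trivial
  obtain ⟨z, hz⟩ := h.extend_tuple hA y hy
  obtain ⟨w, hw⟩ := hz.extend_isAlg (x := x) (IsAlg.of_udf (A := A)
    (P := fun i v x => @Formula.Realize L _ (A i).S _ ψ (Sum.elim (fun k => v (Sum.inr k))
      (Sum.elim (fun j => (A i).c (e j)) fun _ => x)))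
    ((UDf.formula (A := A) ψ (Sum.elim (fun k => Sum.inr (Sum.inl (Sum.inr k)))
      (Sum.elim (fun j => Sum.inl (e j)) fun _ => Sum.inr (Sum.inr ())))).congr fun i v =>
        iff_of_eq (congrArg _ (by funext x; rcases x with x | x | x <;> rfl))) hψ
    ((hc i).1 y).finite)
  refine ⟨w, ?_⟩
  have := hw.comp (Sum.map Sum.inl id)
  convert this using 1 <;> (funext x; rcases x with x | x <;> rfl)

end Extend

section ModelGeometry

variable {L : FirstOrder.Language} {g : GoedelCoding L} {T : L.Theory} {D : Set ℕ}
  {M₀ M N : CodedStructure L}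

/-- An elementary extension, with the elements of the base model named. -/
abbrev ptOf (E : ElemSub M₀ M) : Pt L M₀.carrier := ⟨M.carrier, M.struc, E.inc⟩

theorem ElemSub.refl (M : CodedStructure L) : ElemSub M M := ⟨le_rfl, fun _ _ _ => Iff.rfl⟩

theorem exists_bound_holds (hnf : NoFiniteModels L T) (hD : ¬ IsArithmetical D)
    (hcat : DCategorical g T D) (h₀ : ArithDecidable g M₀) (hT : M₀.Models T) {α : Type}
    (Q : L.Formula (M₀.carrier ⊕ (α ⊕ Unit))) :
    ∃ K, ∀ v : α → M₀.carrier, {x | (selfPt L M₀.carrier ()).Holds Q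
      (Sum.elim v fun _ => x)}.Finite →
      AtMost K (fun x => (selfPt L M₀.carrier ()).Holds Q (Sum.elim v fun _ => x)) := by
  obtain ⟨m, ψ, b, -, hψ⟩ := exists_finite_support
    (Q.relabel (Equiv.sumAssoc M₀.carrier α Unit).symm)
  obtain ⟨K, hK⟩ := exists_bound hnf hD hcat h₀ hT ψ
  refine ⟨K, fun v => ?_⟩
  have key : ∀ x : M₀.carrier, (selfPt L M₀.carrier ()).Holds Q (Sum.elim v fun _ => x) ↔
      ψ.Realize (Sum.elim (fun i => Sum.elim (fun x => x) v (b i)) fun _ => x) := by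
    intro x
    rw [← hψ M₀.carrier M₀.struc (Sum.elim (fun x => x) v) fun _ => x, Formula.realize_relabel, Pt.Holds]
    refine iff_of_eq (congrArg _ ?_)
    funext z
    rcases z with z | z | z <;> rfl
  simp only [key]
  exact hK _

theorem exists_bound_minimal (hnf : NoFiniteModels L T) (hD : ¬ IsArithmetical D)
    (hcat : DCategorical g T D) (h₀ : ArithDecidable g M₀) (hT : M₀.Models T)
    {φ : L.Formula (M₀.carrier ⊕ Unit)}
    (hmin : ∀ ψ : L.Formula (M₀.carrier ⊕ Unit),
        {x : M₀.carrier | φ.Realize (Sum.elim (fun x => x) fun _ => x) ∧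
          ψ.Realize (Sum.elim (fun x => x) fun _ => x)}.Finite ∨
        {x : M₀.carrier | φ.Realize (Sum.elim (fun x => x) fun _ => x) ∧
          ¬ ψ.Realize (Sum.elim (fun x => x) fun _ => x)}.Finite) {α : Type} [Finite α]
    (Q : L.Formula (M₀.carrier ⊕ (α ⊕ Unit))) :
    ∃ K, ∀ (M : CodedStructure L) (E : ElemSub M₀ M) (v : α → M.carrier),
      (AtMost K fun x => (ptOf E).Holds φ (fun _ => x) ∧
        (ptOf E).Holds Q (Sum.elim v fun _ => x)) ∨
      (AtMost K fun x => (ptOf E).Holds φ (fun _ => x) ∧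
        ¬ (ptOf E).Holds Q (Sum.elim v fun _ => x)) := by
  obtain ⟨Q₁, hQ₁⟩ := (UDf.holds_snd (A := selfPt L M₀.carrier) (α := α) φ).and (UDf.holds1 Q)
  obtain ⟨Q₂, hQ₂⟩ := (UDf.holds_snd (A := selfPt L M₀.carrier) (α := α) φ).and (UDf.holds1 Q).not
  obtain ⟨K₁, hK₁⟩ := exists_bound_holds hnf hD hcat h₀ hT Q₁
  obtain ⟨K₂, hK₂⟩ := exists_bound_holds hnf hD hcat h₀ hT Q₂
  refine ⟨max K₁ K₂, fun M E => ?_⟩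
  have hP := UDf.all (A := extPt E) (α := Empty) (β := α) (P := fun i v =>
    (AtMost (max K₁ K₂) fun x => (extPt E i).Holds φ (fun _ => x) ∧
        (extPt E i).Holds Q (Sum.elim (fun a => v (Sum.inr a)) fun _ => x)) ∨
      (AtMost (max K₁ K₂) fun x => (extPt E i).Holds φ (fun _ => x) ∧
        ¬ (extPt E i).Holds Q (Sum.elim (fun a => v (Sum.inr a)) fun _ => x))) (by
    have h1 : UDf (α := (Empty ⊕ α) ⊕ Unit) (extPt E) fun i v => (extPt E i).Holds Q
        (Sum.elim (fun a => v (Sum.inl (Sum.inr a))) fun _ => v (Sum.inr ())) :=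
      (UDf.holds1 Q).comp (Sum.map Sum.inr id)
    exact (UDf.atMost _ (P := fun i v x => (extPt E i).Holds φ (fun _ => x) ∧
        (extPt E i).Holds Q (Sum.elim (fun a => v (Sum.inr a)) fun _ => x))
          ((UDf.holds_snd φ).and h1)).or
      (UDf.atMost _ (P := fun i v x => (extPt E i).Holds φ (fun _ => x) ∧
        ¬ (extPt E i).Holds Q (Sum.elim (fun a => v (Sum.inr a)) fun _ => x))
          ((UDf.holds_snd φ).and h1.not)))
  refine (hP.ext_iff fun a => a.elim).1 fun v => ?_
  have key : ∀ x : M₀.carrier, (selfPt L M₀.carrier ()).Holds Q (Sum.elim v fun _ => x) ↔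
      (Q.relabel (Sum.elim Sum.inl (Sum.elim (fun a => Sum.inl (v a)) Sum.inr)) :
        L.Formula (M₀.carrier ⊕ Unit)).Realize (Sum.elim (fun x => x) fun _ => x) := by
    intro x
    rw [Formula.realize_relabel, Pt.Holds]
    refine iff_of_eq (congrArg _ ?_)
    funext z
    rcases z with z | z | z <;> rfl
  have h1 := hmin (Q.relabel (Sum.elim Sum.inl (Sum.elim (fun a => Sum.inl (v a)) Sum.inr)))
  simp only [← key] at h1
  refine h1.imp (fun h => ?_) fun h => ?_
  · exact (hK₁ v (h.subset fun x hx => (hQ₁ () _).1 hx)).mono (le_max_left _ _)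
      fun x hx => (hQ₁ () (Sum.elim v fun _ => x)).2 hx
  · exact (hK₂ v (h.subset fun x hx => (hQ₂ () _).1 hx)).mono (le_max_right _ _)
      fun x hx => (hQ₂ () (Sum.elim v fun _ => x)).2 hx

/-- The formula given by a code and parameters. -/
theorem exists_formula_of_sat {c : ℕ} {l : List ℕ} (hl : ∀ z ∈ l, z ∈ M.carrier) {y : ℕ}
    (h : Sat g N c (y :: l)) : ∃ χ : L.Formula (M.carrier ⊕ Unit),
      ∀ (K : CodedStructure L) (E : ElemSub M K) (x : K.carrier),
        χ.Realize (Sum.elim E.inc fun _ => x) ↔ Sat g K c ((x : ℕ) :: l) := by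
  obtain ⟨b, hb⟩ := exists_vals l hl
  obtain ⟨k, χ, a, hc, hla, -⟩ := h
  obtain rfl : k = l.length + 1 := by simpa using (congrArg List.length hla).symm
  refine ⟨χ.relabel (Fin.cases (Sum.inr ()) fun j => Sum.inl (b j)), fun K E x => ?_⟩
  have e : (x : ℕ) :: l = vals (Fin.cons x fun j => E.inc (b j) : Fin (l.length + 1) → K.carrier) := by
    rw [vals_cons]
    exact congrArg _ hb.symm
  rw [e, hc, sat_iff, Formula.realize_relabel]
  refine iff_of_eq (congrArg _ ?_)
  funext z
  refine Fin.cases ?_ (fun j => ?_) z <;> rfl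

/-- Algebraic elements over an elementary substructure belong to it. -/
theorem mem_of_sat_finite (E : ElemSub M N) {c : ℕ} {l : List ℕ} (hl : ∀ z ∈ l, z ∈ M.carrier)
    (hf : {z : M.carrier | Sat g M c ((z : ℕ) :: l)}.Finite) {y : ℕ} (h : Sat g N c (y :: l)) :
    y ∈ M.carrier := by
  obtain ⟨χ, hχ⟩ := exists_formula_of_sat hl h
  obtain ⟨x, hx, -⟩ := E.no_new_points χ (hf.subset fun z hz => (hχ M (ElemSub.refl M) z).1 hz)
    ((hχ N E ⟨y, h.mem (by simp)⟩).2 h)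
  have e : (x : ℕ) = y := congrArg Subtype.val hx
  exact e ▸ x.2

theorem exists_transcendental (hN : ArithDecidable g N) (h₀ : ArithDecidable g M₀)
    (E : ElemSub M₀ M) (E' : ElemSub M N) (hM : ¬ IsArithmetical M.carrier)
    {φ : L.Formula (M₀.carrier ⊕ Unit)} {p m : ℕ} {ψ : L.Formula (Fin p ⊕ Fin m ⊕ Unit)} {k : ℕ}
    {b : Fin m → M.carrier} (h : CovBy ψ k b (fun x => (ptOf E).Holds φ fun _ => x) fun _ => True)
    {α : Type} [Finite α] (v : α → M.carrier) :
    ∃ y, (ptOf E).Holds φ (fun _ => y) ∧ ¬ IsAlg (ptOf E) v y := by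
  by_contra hno
  push Not at hno
  obtain ⟨w, hw⟩ : ∃ w : List ℕ, ∀ x, x ∈ w ↔ ∃ a, (v a : ℕ) = x := by
    have hf : (Set.range fun a => (v a : ℕ)).Finite := Set.finite_range _
    exact ⟨hf.toFinset.toList, fun x => by simp⟩
  let Z : Set ℕ := {y | ∃ b : ℕ × List ℕ, (∀ z, z ∈ b.2 → z ∈ M₀.carrier ∨ z ∈ w) ∧
    Sat g N b.1 (y :: b.2) ∧ {z | Sat g N b.1 (z :: b.2)}.Finite}
  have hpar : ∀ z, z ∈ M₀.carrier ∨ z ∈ w → z ∈ M.carrier := by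
    rintro z (hz | hz)
    · exact E.subset hz
    · obtain ⟨a, rfl⟩ := (hw z).1 hz
      exact (v a).2
  have hZM : ∀ y ∈ Z, y ∈ M.carrier := by
    rintro y ⟨⟨c, l⟩, hl, hs, hf⟩
    have hl' : ∀ z ∈ l, z ∈ M.carrier := fun z hz => hpar z (hl z hz)
    refine mem_of_sat_finite E' hl' ?_ hs
    refine Set.Finite.of_finite_image (f := Subtype.val) (hf.subset ?_) Subtype.val_injective.injOn
    rintro _ ⟨x, hx, rfl⟩
    refine (E'.sat fun z hz => ?_).2 hx
    rcases List.mem_cons.1 hz with rfl | hz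
    · exact x.2
    · exact hl' z hz
  have hZ : Ar ∅ (· ∈ Z) := by
    refine Ar.ex (p := fun y (b : ℕ × List ℕ) => (∀ z, z ∈ b.2 → z ∈ M₀.carrier ∨ z ∈ w) ∧
      Sat g N b.1 (y :: b.2) ∧ {z | Sat g N b.1 (z :: b.2)}.Finite) (Ar.and ?_ (Ar.and ?_ ?_))
    · exact Ar.all (p := fun (x : ℕ × ℕ × List ℕ) z => z ∈ x.2.2 → z ∈ M₀.carrier ∨ z ∈ w)
        (Ar.imp (Ar.memList (by fun_prop) (by fun_prop))
          (Ar.or (h₀.carrier.comp Primrec.snd) (Ar.memList (by fun_prop) (by fun_prop))))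
    · exact hN.sat.compF (f := fun x : ℕ × ℕ × List ℕ => (x.2.1, x.1 :: x.2.2)) (by fun_prop)
    · exact Ar.finite (p := fun (x : ℕ × ℕ × List ℕ) z => Sat g N x.2.1 (z :: x.2.2))
        (hN.sat.compF (f := fun x : (ℕ × ℕ × List ℕ) × ℕ => (x.1.2.1, x.2 :: x.1.2.2))
          (by fun_prop))
  have hφZ : ∀ y : M.carrier, (ptOf E).Holds φ (fun _ => y) → (y : ℕ) ∈ Z := by
    intro y hy
    obtain ⟨Q, hQ, hf⟩ := hno y hy
    obtain ⟨m', χ, e, -, hχ⟩ := exists_finite_support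
      (Q.relabel (Equiv.sumAssoc M₀.carrier α Unit).symm)
    have key : ∀ x : M.carrier, (ptOf E).Holds Q (Sum.elim v fun _ => x) ↔
        χ.Realize (Sum.elim (fun i => Sum.elim E.inc v (e i)) fun _ => x) := by
      intro x
      rw [← hχ M.carrier M.struc (Sum.elim E.inc v) fun _ => x, Formula.realize_relabel, Pt.Holds]
      refine iff_of_eq (congrArg _ ?_)
      funext z
      rcases z with z | z | z <;> rfl
    replace key := fun x => (key x).trans (sat_cons_vals (g := g) _ _ x).symm
    have hl : ∀ z ∈ vals (fun i => Sum.elim E.inc v (e i)), z ∈ M₀.carrier ∨ z ∈ w := by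
      intro z hz
      obtain ⟨i, rfl⟩ := (List.mem_ofFn ..).1 hz
      dsimp only
      rcases e i with x | a
      · exact Or.inl x.2
      · exact Or.inr ((hw _).2 ⟨a, rfl⟩)
    have hl' := fun z hz => hpar z (hl z hz)
    have hcons : ∀ x : M.carrier, ∀ z ∈ (x : ℕ) :: vals (fun i => Sum.elim E.inc v (e i)),
        z ∈ M.carrier := by
      intro x z hz
      rcases List.mem_cons.1 hz with rfl | hz
      · exact x.2
      · exact hl' z hz
    rw [key] at hQ
    simp only [key] at hf
    refine ⟨(_, _), hl, (E'.sat (hcons y)).2 hQ, (hf.image Subtype.val).subset fun z hz => ?_⟩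
    have hzM := mem_of_sat_finite E' hl' hf hz
    exact ⟨⟨z, hzM⟩, (E'.sat (hcons ⟨z, hzM⟩)).1 hz, rfl⟩
  have h1 := CovBy.arReducible hN E' (h.mono (η' := fun x : M.carrier => (x : ℕ) ∈ Z) hφZ)
  have h2 : {x | ∃ hx : x ∈ M.carrier, ((⟨x, hx⟩ : M.carrier) : ℕ) ∈ Z} = Z := by
    ext x
    exact ⟨fun ⟨_, h⟩ => h, fun h => ⟨hZM x h, h⟩⟩
  rw [h2] at h1
  exact hM (h1.trans (Ar.arReducible.1 hZ))

end ModelGeometry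

/-! ## Back and forth -/

section MapPairs

variable {Y : Set ℕ} {α β γ : Type} [Primcodable α] [Primcodable β] [Primcodable γ]

@[fun_prop]
theorem ArF.mapFst {l : α → List (β × γ)} (hl : ArF Y l) :
    ArF Y (fun a => (l a).map Prod.fst) :=
  ArF.map (f := fun (_ : α) (z : β × γ) => z.1) (by fun_prop) hl

@[fun_prop]
theorem ArF.mapSnd {l : α → List (β × γ)} (hl : ArF Y l) :
    ArF Y (fun a => (l a).map Prod.snd) :=
  ArF.map (f := fun (_ : α) (z : β × γ) => z.2) (by fun_prop) hl

end MapPairs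

section BackAndForth

variable {L : FirstOrder.Language} {g : GoedelCoding L} {T : L.Theory} {D : Set ℕ}
  {M₀ M₁ M₂ M N₁ N₂ : CodedStructure L}

/-- Two elementary extensions of the same structure. -/
def pairPt (E₁ : ElemSub M₀ M₁) (E₂ : ElemSub M₀ M₂) : Bool → Pt L M₀.carrier
  | Bool.false => ptOf E₁
  | Bool.true => ptOf E₂

theorem covBy_ptOf (E : ElemSub M₀ M) {p m : ℕ} {ψ : L.Formula (Fin p ⊕ Fin m ⊕ Unit)} {k : ℕ}
    {b : Fin m → M₀.carrier} {φ : L.Formula (M₀.carrier ⊕ Unit)}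
    (h : CovBy ψ k b (fun x => φ.Realize (Sum.elim (fun x => x) fun _ => x)) fun _ => True) :
    CovBy ψ k (fun j => E.inc (b j)) (fun x => (ptOf E).Holds φ fun _ => x) fun _ => True :=
  (E.covBy ψ k b φ).1 h

theorem exists_geometry (hnf : NoFiniteModels L T) (hD : ¬ IsArithmetical D)
    (hcat : DCategorical g T D) (h₀ : ArithDecidable g M₀) (hT : M₀.Models T)
    (E₁ : ElemSub M₀ M₁) (E₂ : ElemSub M₀ M₂) (h₁ : ArithExtendible g T M₁)
    (h₂ : ArithExtendible g T M₂) (hM₁ : ¬ IsArithmetical M₁.carrier)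
    (hM₂ : ¬ IsArithmetical M₂.carrier) :
    ∃ φ : L.Formula (M₀.carrier ⊕ Unit), Geometry (pairPt E₁ E₂) φ := by
  obtain ⟨φ, hinf, hmin⟩ := exists_minimal hnf hcat h₀ hT
  obtain ⟨p, m, ψ, k, b, hc⟩ := exists_covBy_of_infinite hnf hD hcat h₀ hT φ hinf
  obtain ⟨N₁, hN₁, -, F₁⟩ := h₁
  obtain ⟨N₂, hN₂, -, F₂⟩ := h₂
  refine ⟨φ, fun Q => ?_, ⟨p, m, ψ, k, b, fun i => ?_⟩, fun i v => ?_⟩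
  · obtain ⟨K, hK⟩ := exists_bound_minimal hnf hD hcat h₀ hT hmin Q
    refine ⟨K, fun i => ?_⟩
    cases i
    · exact hK M₁ E₁
    · exact hK M₂ E₂
  · cases i
    · exact covBy_ptOf E₁ hc
    · exact covBy_ptOf E₂ hc
  · cases i
    · exact exists_transcendental hN₁ h₀ E₁ F₁ hM₁ (covBy_ptOf E₁ hc) v
    · exact exists_transcendental hN₂ h₀ E₂ F₂ hM₂ (covBy_ptOf E₂ hc) v

theorem ElemSub.sat_append (E : ElemSub M₀ M) {n m : ℕ} (φ : L.Formula (Fin (n + m)))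
    (a : Fin n → M.carrier) (e : Fin m → M₀.carrier) :
    Sat g M (fc g φ) (vals a ++ vals e) ↔ φ.Realize (Fin.append a fun j => E.inc (e j)) := by
  rw [← sat_iff (g := g), vals_append]
  rfl

/-- Having the same type, in terms of coded satisfaction. -/
theorem sameType_iff_sat (E₁ : ElemSub M₀ M₁) (E₂ : ElemSub M₀ M₂) {n : ℕ}
    (a : Fin n → M₁.carrier) (b : Fin n → M₂.carrier) :
    SameType (pairPt E₁ E₂) Bool.false Bool.true a b ↔
      ∀ (c : ℕ) (m : List ℕ), (∀ z ∈ m, z ∈ M₀.carrier) →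
        (Sat g M₁ c (vals a ++ m) ↔ Sat g M₂ c (vals b ++ m)) := by
  constructor
  · intro h c m hm
    by_cases hc : ∃ φ : L.Formula (Fin (n + m.length)), c = fc g φ
    · obtain ⟨φ, rfl⟩ := hc
      obtain ⟨e, he⟩ := exists_vals m hm
      have h1 := E₁.sat_append (g := g) φ a e
      have h2 := E₂.sat_append (g := g) φ b e
      rw [he] at h1 h2
      rw [h1, h2]
      have hU := h.udf (UDf.formula (A := pairPt E₁ E₂) φ
        (Fin.addCases Sum.inr fun j => Sum.inl (e j)))
      refine Iff.trans (iff_of_eq (congrArg _ ?_)) (hU.trans (iff_of_eq (congrArg _ ?_)))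
      · funext z
        refine Fin.addCases (fun j => ?_) (fun j => ?_) z
        · simp only [Fin.append_left, Fin.addCases_left]
          rfl
        · simp only [Fin.append_right, Fin.addCases_right]
          rfl
      · funext z
        refine Fin.addCases (fun j => ?_) (fun j => ?_) z
        · simp only [Fin.append_left, Fin.addCases_left]
          rfl
        · simp only [Fin.append_right, Fin.addCases_right]
          rfl
    · have key : ∀ (K : CodedStructure L) (d : Fin n → K.carrier), ¬ Sat g K c (vals d ++ m) := by
        rintro K d ⟨k, φ, a', e, e', -⟩
        obtain rfl : n + m.length = k := by simpa using congrArg List.length e'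
        exact hc ⟨φ, e⟩
      exact iff_of_false (key M₁ a) (key M₂ b)
  · intro h χ
    obtain ⟨m, ψ, e, -, hψ⟩ := exists_finite_support χ
    have h1 := h (fc g (ψ.relabel (Sum.elim (Fin.natAdd n) (Fin.castAdd m)))) (vals e) (by
      intro z hz
      obtain ⟨i, rfl⟩ := (List.mem_ofFn ..).1 hz
      exact (e i).2)
    rw [E₁.sat_append, E₂.sat_append, Formula.realize_relabel, Formula.realize_relabel] at h1
    refine ((hψ M₁.carrier M₁.struc E₁.inc a).trans ?_).trans
      (h1.trans (Iff.trans ?_ (hψ M₂.carrier M₂.struc E₂.inc b).symm))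
    · refine iff_of_eq (congrArg _ ?_)
      funext z
      rcases z with z | z <;> simp
    · refine iff_of_eq (congrArg _ ?_)
      funext z
      rcases z with z | z <;> simp

theorem vals_snoc {A : Set ℕ} {k : ℕ} (a : Fin k → A) (x : A) :
    vals (Fin.snoc a x : Fin (k + 1) → A) = vals a ++ [(x : ℕ)] := by
  unfold vals
  rw [List.ofFn_succ_last]
  simp

/-- A finite partial elementary map, as a list of pairs. -/
def Good (E₁ : ElemSub M₀ M₁) (E₂ : ElemSub M₀ M₂) (l : List (ℕ × ℕ)) : Prop :=
  ∃ (n : ℕ) (a : Fin n → M₁.carrier) (b : Fin n → M₂.carrier), vals a = l.map Prod.fst ∧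
    vals b = l.map Prod.snd ∧ SameType (pairPt E₁ E₂) Bool.false Bool.true a b

theorem good_iff (E₁ : ElemSub M₀ M₁) (E₂ : ElemSub M₀ M₂) {F₁ : ElemSub M₁ N₁}
    {F₂ : ElemSub M₂ N₂} {l : List (ℕ × ℕ)} :
    Good E₁ E₂ l ↔ (∀ z, z ∈ l.map Prod.fst → z ∈ M₁.carrier) ∧
      (∀ z, z ∈ l.map Prod.snd → z ∈ M₂.carrier) ∧
      ∀ x : ℕ × List ℕ, (∀ z, z ∈ x.2 → z ∈ M₀.carrier) →
        (Sat g N₁ x.1 (l.map Prod.fst ++ x.2) ↔ Sat g N₂ x.1 (l.map Prod.snd ++ x.2)) := by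
  have happ : ∀ {A : Set ℕ} {s m : List ℕ}, (∀ z, z ∈ s → z ∈ A) → (∀ z, z ∈ m → z ∈ A) →
      ∀ z ∈ s ++ m, z ∈ A := by
    intro A s m h h' z hz
    rcases List.mem_append.1 hz with hz | hz
    · exact h z hz
    · exact h' z hz
  have hmem : ∀ {A : Set ℕ} {n : ℕ} {v : Fin n → A} {z : ℕ}, z ∈ vals v → z ∈ A := by
    intro A n v z hz
    obtain ⟨i, rfl⟩ := (List.mem_ofFn ..).1 hz
    exact (v i).2
  constructor
  · rintro ⟨n, a, b, ha, hb, h⟩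
    rw [← ha, ← hb]
    refine ⟨fun z => hmem, fun z => hmem, fun x hx => ?_⟩
    rw [F₁.sat (happ (fun z => hmem) fun z hz => E₁.subset (hx z hz)),
      F₂.sat (happ (fun z => hmem) fun z hz => E₂.subset (hx z hz))]
    exact (sameType_iff_sat E₁ E₂ a b).1 h x.1 x.2 hx
  · rintro ⟨h1, h2, h⟩
    obtain ⟨a, ha⟩ := exists_vals' (k := l.length) (l.map Prod.fst) (by simp) h1
    obtain ⟨b, hb⟩ := exists_vals' (k := l.length) (l.map Prod.snd) (by simp) h2
    refine ⟨_, a, b, ha, hb, (sameType_iff_sat (g := g) E₁ E₂ a b).2 fun c m hm => ?_⟩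
    rw [ha, hb, ← F₁.sat (happ h1 fun z hz => E₁.subset (hm z hz)),
      ← F₂.sat (happ h2 fun z hz => E₂.subset (hm z hz))]
    exact h (c, m) hm

theorem ar_good (hN₁ : ArithDecidable g N₁) (hN₂ : ArithDecidable g N₂)
    (h₀ : ArithDecidable g M₀) (E₁ : ElemSub M₀ M₁) (E₂ : ElemSub M₀ M₂) (F₁ : ElemSub M₁ N₁)
    (F₂ : ElemSub M₂ N₂) (h₁ : ArReducible M₁.carrier D) (h₂ : ArReducible M₂.carrier D) :
    Ar D (Good E₁ E₂) := by
  refine Ar.congr (Ar.and ?_ (Ar.and ?_ ?_)) fun l => (good_iff (g := g) E₁ E₂ (F₁ := F₁) (F₂ := F₂)).symm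
  · refine Ar.all (p := fun (l : List (ℕ × ℕ)) z => z ∈ l.map Prod.fst → z ∈ M₁.carrier)
      (Ar.imp (Ar.memList (by fun_prop) (by fun_prop))
        ((Ar.arReducible.2 h₁).comp Primrec.snd))
  · refine Ar.all (p := fun (l : List (ℕ × ℕ)) z => z ∈ l.map Prod.snd → z ∈ M₂.carrier)
      (Ar.imp (Ar.memList (by fun_prop) (by fun_prop))
        ((Ar.arReducible.2 h₂).comp Primrec.snd))
  · refine Ar.all (p := fun (l : List (ℕ × ℕ)) (x : ℕ × List ℕ) =>
      (∀ z, z ∈ x.2 → z ∈ M₀.carrier) →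
        (Sat g N₁ x.1 (l.map Prod.fst ++ x.2) ↔ Sat g N₂ x.1 (l.map Prod.snd ++ x.2)))
      (Ar.imp ?_ (Ar.iff ?_ ?_))
    · exact Ar.all (p := fun (x : List (ℕ × ℕ) × ℕ × List ℕ) z => z ∈ x.2.2 → z ∈ M₀.carrier)
        (Ar.imp (Ar.memList (by fun_prop) (by fun_prop)) (h₀.carrier.mono.comp Primrec.snd))
    · exact hN₁.sat.mono.compF
        (f := fun x : List (ℕ × ℕ) × ℕ × List ℕ => (x.2.1, x.1.map Prod.fst ++ x.2.2))
        (by fun_prop)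
    · exact hN₂.sat.mono.compF
        (f := fun x : List (ℕ × ℕ) × ℕ × List ℕ => (x.2.1, x.1.map Prod.snd ++ x.2.2))
        (by fun_prop)

theorem good_nil (E₁ : ElemSub M₀ M₁) (E₂ : ElemSub M₀ M₂) : Good E₁ E₂ [] := by
  refine ⟨0, fun j => j.elim0, fun j => j.elim0, rfl, rfl, fun χ => ?_⟩
  have h1 := E₁.realize χ (Sum.elim (fun x => x) fun j : Fin 0 => j.elim0)
  have h2 := E₂.realize χ (Sum.elim (fun x => x) fun j : Fin 0 => j.elim0)
  change χ.Realize (Sum.elim E₁.inc _) ↔ χ.Realize (Sum.elim E₂.inc _)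
  refine Iff.trans (iff_of_eq (congrArg _ ?_)) (h1.trans (h2.symm.trans
    (iff_of_eq (congrArg _ ?_))))
  · funext z
    rcases z with z | z
    · rfl
    · exact z.elim0
  · funext z
    rcases z with z | z
    · rfl
    · exact z.elim0

variable {φ : L.Formula (M₀.carrier ⊕ Unit)}

theorem SameType.snoc {E₁ : ElemSub M₀ M₁} {E₂ : ElemSub M₀ M₂} {n : ℕ} {a : Fin n → M₁.carrier}
    {b : Fin n → M₂.carrier} {x : M₁.carrier} {y : M₂.carrier}
    (h : SameType (pairPt E₁ E₂) Bool.false Bool.true (Sum.elim a fun _ : Unit => x)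
      (Sum.elim b fun _ => y)) :
    SameType (pairPt E₁ E₂) Bool.false Bool.true (Fin.snoc a x : Fin (n + 1) → M₁.carrier)
      (Fin.snoc b y : Fin (n + 1) → M₂.carrier) := by
  have := h.comp (Fin.lastCases (Sum.inr ()) Sum.inl : Fin (n + 1) → _)
  refine (iff_of_eq (congrArg₂ (SameType (pairPt E₁ E₂) Bool.false Bool.true) ?_ ?_)).1 this
  · funext z
    refine Fin.lastCases ?_ (fun k => ?_) z
    · simp only [Fin.lastCases_last, Fin.snoc_last]
      rfl
    · simp only [Fin.lastCases_castSucc, Fin.snoc_castSucc]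
      rfl
  · funext z
    refine Fin.lastCases ?_ (fun k => ?_) z
    · simp only [Fin.lastCases_last, Fin.snoc_last]
      rfl
    · simp only [Fin.lastCases_castSucc, Fin.snoc_castSucc]
      rfl

theorem Good.extend_left {E₁ : ElemSub M₀ M₁} {E₂ : ElemSub M₀ M₂}
    (hG : Geometry (pairPt E₁ E₂) φ) {l : List (ℕ × ℕ)} (h : Good E₁ E₂ l) {x : ℕ}
    (hx : x ∈ M₁.carrier) : ∃ y, Good E₁ E₂ (l ++ [(x, y)]) := by
  obtain ⟨n, a, b, ha, hb, hs⟩ := h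
  obtain ⟨y, hy⟩ : ∃ y : M₂.carrier, SameType (pairPt E₁ E₂) Bool.false Bool.true
      (Sum.elim a fun _ : Unit => (⟨x, hx⟩ : M₁.carrier)) (Sum.elim b fun _ => y) :=
    hs.extend hG (⟨x, hx⟩ : M₁.carrier)
  exact ⟨y, n + 1, Fin.snoc a ⟨x, hx⟩, Fin.snoc b y, by simp [vals_snoc, ha],
    by simp [vals_snoc, hb], SameType.snoc hy⟩

theorem Good.extend_right {E₁ : ElemSub M₀ M₁} {E₂ : ElemSub M₀ M₂}
    (hG : Geometry (pairPt E₁ E₂) φ) {l : List (ℕ × ℕ)} (h : Good E₁ E₂ l) {y : ℕ}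
    (hy : y ∈ M₂.carrier) : ∃ x, Good E₁ E₂ (l ++ [(x, y)]) := by
  obtain ⟨n, a, b, ha, hb, hs⟩ := h
  obtain ⟨x, hx⟩ : ∃ x : M₁.carrier, SameType (pairPt E₁ E₂) Bool.true Bool.false
      (Sum.elim b fun _ : Unit => (⟨y, hy⟩ : M₂.carrier)) (Sum.elim a fun _ => x) :=
    hs.symm.extend hG (⟨y, hy⟩ : M₂.carrier)
  exact ⟨x, n + 1, Fin.snoc a x, Fin.snoc b ⟨y, hy⟩, by simp [vals_snoc, ha],
    by simp [vals_snoc, hb], SameType.snoc hx.symm⟩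

end BackAndForth

section Enumeration

variable {L : FirstOrder.Language} {g : GoedelCoding L} {T : L.Theory} {D : Set ℕ}
  {M₀ M₁ M₂ N₁ N₂ : CodedStructure L} {φ : L.Formula (M₀.carrier ⊕ Unit)}

/-- The back-and-forth construction, carried out arithmetically in `D`. -/
theorem exists_enumeration (hN₁ : ArithDecidable g N₁) (hN₂ : ArithDecidable g N₂)
    (h₀ : ArithDecidable g M₀) {E₁ : ElemSub M₀ M₁} {E₂ : ElemSub M₀ M₂} (F₁ : ElemSub M₁ N₁)
    (F₂ : ElemSub M₂ N₂) (h₁ : ArReducible M₁.carrier D) (h₂ : ArReducible M₂.carrier D)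
    (hG : Geometry (pairPt E₁ E₂) φ) (hM₁ : M₁.carrier.Nonempty) :
    ∃ F : ℕ → ℕ × ℕ, ArF D F ∧ (∀ n, Good E₁ E₂ ((List.range n).map F)) ∧
      (∀ n ∈ M₁.carrier, (F (2 * n)).1 = n) ∧ ∀ n ∈ M₂.carrier, (F (2 * n + 1)).2 = n := by
  have hgood := ar_good hN₁ hN₂ h₀ E₁ E₂ F₁ F₂ h₁ h₂
  obtain ⟨F, hF, -, hp⟩ := Ar.recursion (Y := D) (α := Unit) (β := ℕ × ℕ)
    (p := fun _ s b => Good E₁ E₂ (s ++ [b]) ∧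
      (∀ k, s.length = 2 * k → k ∈ M₁.carrier → b.1 = k) ∧
      (∀ k, s.length = 2 * k + 1 → k ∈ M₂.carrier → b.2 = k)) (by
    refine Ar.and ?_ (Ar.and ?_ ?_)
    · exact hgood.compF (f := fun x : (Unit × List (ℕ × ℕ)) × ℕ × ℕ => x.1.2 ++ [x.2])
        (by fun_prop)
    · exact Ar.all (p := fun (x : (Unit × List (ℕ × ℕ)) × ℕ × ℕ) k =>
        x.1.2.length = 2 * k → k ∈ M₁.carrier → x.2.1 = k)
        (Ar.imp (Ar.eq (by fun_prop) (by fun_prop)) (Ar.imp ((Ar.arReducible.2 h₁).comp Primrec.snd)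
          (Ar.eq (by fun_prop) (by fun_prop))))
    · exact Ar.all (p := fun (x : (Unit × List (ℕ × ℕ)) × ℕ × ℕ) k =>
        x.1.2.length = 2 * k + 1 → k ∈ M₂.carrier → x.2.2 = k)
        (Ar.imp (Ar.eq (by fun_prop) (by fun_prop)) (Ar.imp ((Ar.arReducible.2 h₂).comp Primrec.snd)
          (Ar.eq (by fun_prop) (by fun_prop)))))
  have hex : ∀ s, Good E₁ E₂ s → ∃ b : ℕ × ℕ, Good E₁ E₂ (s ++ [b]) ∧
      (∀ k, s.length = 2 * k → k ∈ M₁.carrier → b.1 = k) ∧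
      (∀ k, s.length = 2 * k + 1 → k ∈ M₂.carrier → b.2 = k) := by
    intro s hs
    obtain ⟨x₁, hx₁⟩ := hM₁
    by_cases he : ∃ k, s.length = 2 * k ∧ k ∈ M₁.carrier
    · obtain ⟨k, hk, hk'⟩ := he
      obtain ⟨y, hy⟩ := hs.extend_left hG hk'
      exact ⟨(k, y), hy, fun j hj _ => by dsimp only; omega, fun j hj _ => by omega⟩
    by_cases ho : ∃ k, s.length = 2 * k + 1 ∧ k ∈ M₂.carrier
    · obtain ⟨k, hk, hk'⟩ := ho
      obtain ⟨x, hx⟩ := hs.extend_right hG hk'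
      exact ⟨(x, k), hx, fun j hj _ => by omega, fun j hj _ => by dsimp only; omega⟩
    · obtain ⟨y, hy⟩ := hs.extend_left hG hx₁
      exact ⟨(x₁, y), hy, fun j hj hj' => (he ⟨j, hj, hj'⟩).elim,
        fun j hj hj' => (ho ⟨j, hj, hj'⟩).elim⟩
  have hall : ∀ n, Good E₁ E₂ ((List.range n).map (F ())) := by
    intro n
    induction n with
    | zero => exact good_nil E₁ E₂
    | succ n ih =>
      rw [List.range_succ, List.map_append]
      exact (hp () n (hex _ ih)).1
  refine ⟨F (), hF.comp (f := fun n : ℕ => ((), n)) (by fun_prop), hall, fun n hn => ?_,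
    fun n hn => ?_⟩
  · exact (hp () _ (hex _ (hall _))).2.1 n (by simp) hn
  · exact (hp () _ (hex _ (hall _))).2.2 n (by simp) hn

theorem exists_sameType_nat {E₁ : ElemSub M₀ M₁} {E₂ : ElemSub M₀ M₂} {F : ℕ → ℕ × ℕ}
    (h : ∀ n, Good E₁ E₂ ((List.range n).map F)) :
    ∃ (u : ℕ → M₁.carrier) (w : ℕ → M₂.carrier), (∀ i, (u i : ℕ) = (F i).1) ∧
      (∀ i, (w i : ℕ) = (F i).2) ∧ SameType (pairPt E₁ E₂) Bool.false Bool.true u w := by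
  have key : ∀ n, ∃ (a : Fin n → M₁.carrier) (b : Fin n → M₂.carrier),
      (∀ i, (a i : ℕ) = (F i).1) ∧ (∀ i, (b i : ℕ) = (F i).2) ∧
      SameType (pairPt E₁ E₂) Bool.false Bool.true a b := by
    intro n
    obtain ⟨n', a, b, ha, hb, hs⟩ := h n
    obtain rfl : n' = n := by simpa using congrArg List.length ha
    refine ⟨a, b, fun i => ?_, fun i => ?_, hs⟩
    · have := congrArg (fun l => l[(i : ℕ)]?) ha
      simpa [vals] using this
    · have := congrArg (fun l => l[(i : ℕ)]?) hb
      simpa [vals] using this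
  have hu : ∀ i, (F i).1 ∈ M₁.carrier := fun i => by
    obtain ⟨a, b, ha, -⟩ := key (i + 1)
    exact ha (Fin.last i) ▸ (a (Fin.last i)).2
  have hw : ∀ i, (F i).2 ∈ M₂.carrier := fun i => by
    obtain ⟨a, b, -, hb, -⟩ := key (i + 1)
    exact hb (Fin.last i) ▸ (b (Fin.last i)).2
  refine ⟨fun i => ⟨_, hu i⟩, fun i => ⟨_, hw i⟩, fun _ => rfl, fun _ => rfl, fun χ => ?_⟩
  obtain ⟨m, ψ, b', -, hψ⟩ := exists_finite_support (χ.relabel Sum.swap : L.Formula (ℕ ⊕ M₀.carrier))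
  obtain ⟨n, hn⟩ : ∃ n, ∀ i, b' i < n := by
    obtain ⟨n, hn⟩ := (Set.finite_range b').bddAbove
    exact ⟨n + 1, fun i => Nat.lt_succ_of_le (hn ⟨i, rfl⟩)⟩
  obtain ⟨a, b, ha, hb, hs⟩ := key n
  have h1 := hs.udf (UDf.formula (A := pairPt E₁ E₂) ψ
    (Sum.elim (fun i => Sum.inr ⟨b' i, hn i⟩) Sum.inl))
  have e1 := hψ M₁.carrier M₁.struc (fun i => ⟨_, hu i⟩) E₁.inc
  have e2 := hψ M₂.carrier M₂.struc (fun i => ⟨_, hw i⟩) E₂.inc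
  rw [Formula.realize_relabel] at e1 e2
  refine Iff.trans (Iff.trans (iff_of_eq ?_) (e1.trans (iff_of_eq ?_)))
    (h1.trans (Iff.trans (iff_of_eq ?_) (e2.symm.trans (iff_of_eq ?_))))
  · refine congrArg (@Formula.Realize L M₁.carrier _ _ χ) ?_
    funext z
    rcases z with z | z <;> rfl
  · refine congrArg ψ.Realize ?_
    funext z
    rcases z with z | z
    · exact Subtype.ext (ha ⟨b' z, hn z⟩).symm
    · rfl
  · refine congrArg (@Formula.Realize L M₂.carrier _ _ ψ) ?_
    funext z
    rcases z with z | z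
    · exact Subtype.ext (hb ⟨b' z, hn z⟩)
    · rfl
  · refine congrArg (@Formula.Realize L M₂.carrier _ _ χ) ?_
    funext z
    rcases z with z | z <;> rfl

/-- A map between elementary extensions preserving the type of all elements. -/
theorem exists_codedIso {E₁ : ElemSub M₀ M₁} {E₂ : ElemSub M₀ M₂} {F : ℕ → ℕ × ℕ}
    (h : ∀ n, Good E₁ E₂ ((List.range n).map F)) (hF₁ : ∀ n ∈ M₁.carrier, (F (2 * n)).1 = n)
    (hF₂ : ∀ n ∈ M₂.carrier, (F (2 * n + 1)).2 = n) :
    ∃ f : CodedIso M₁ M₂, (∀ x, (f.toFun x : ℕ) = (F (2 * x)).2) ∧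
      (∀ y, (f.invFun y : ℕ) = (F (2 * y + 1)).1) ∧ ∀ x : M₀.carrier,
        f.toFun (E₁.inc x) = E₂.inc x := by
  obtain ⟨u, w, hu, hw, hs⟩ := exists_sameType_nat h
  have hu' : ∀ x : M₁.carrier, u (2 * x) = x := fun x => Subtype.ext ((hu _).trans (hF₁ x x.2))
  have hw' : ∀ y : M₂.carrier, w (2 * y + 1) = y := fun y => Subtype.ext ((hw _).trans (hF₂ y y.2))
  have huw : ∀ i j, u i = u j ↔ w i = w j := fun i j =>
    hs.udf (UDf.eq_var (A := pairPt E₁ E₂) i j)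
  have hf : SameType (pairPt E₁ E₂) Bool.false Bool.true (fun x : M₁.carrier => x)
      fun x : M₁.carrier => w (2 * x) := by
    have h1 := hs.comp fun x : M₁.carrier => 2 * (x : ℕ)
    simp only [hu'] at h1
    exact h1
  have hform : ∀ {k : ℕ} (χ : L.Formula (Fin k)) (v : Fin k → M₁.carrier),
      χ.Realize v ↔ χ.Realize fun i => w (2 * (v i : ℕ)) := fun χ v =>
    hf.udf (UDf.formula (A := pairPt E₁ E₂) χ fun i => Sum.inr (v i))
  refine ⟨⟨fun x => w (2 * x), fun y => u (2 * y + 1), fun x => ?_, fun y => ?_, fun {k} f v => ?_,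
    fun {k} r v => ?_⟩, fun x => hw _, fun y => hu _, fun x => ?_⟩
  · refine Eq.trans ((huw _ _).2 ?_) (hu' x)
    exact hw' _
  · refine Eq.trans ((huw _ _).1 ?_) (hw' y)
    exact hu' _
  · have h1 := hform (Term.equal (Term.var 0) (Term.func f fun i => Term.var i.succ) :
      L.Formula (Fin (k + 1))) (Fin.cons (M₁.struc.funMap f v) v)
    rw [Formula.realize_equal, Formula.realize_equal] at h1
    exact h1.1 rfl
  · have h1 := hform (Relations.formula r fun i => Term.var i) v
    rw [Formula.realize_rel, Formula.realize_rel] at h1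
    exact h1
  · exact (hf.udf (UDf.eq_const (A := pairPt E₁ E₂) (E₁.inc x) x)).1 rfl

end Enumeration

section Preservation

variable {L : FirstOrder.Language} {g : GoedelCoding L} {T : L.Theory} {D D' : Set ℕ}
  {M N : CodedStructure L}

theorem arReducible_graphCode {A B : Set ℕ} {f : A → B} (hA : ArReducible A D) {h : ℕ → ℕ}
    (hh : ArF D h) (e : ∀ x, (f x : ℕ) = h x) : ArReducible (graphCode f) D := by
  rw [← Ar.arReducible]
  refine (Ar.ex (p := fun c a => a ∈ A ∧ c = Nat.pair a (h a)) (Ar.and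
    ((Ar.arReducible.2 hA).comp Primrec.snd) (Ar.eq (by fun_prop) (by fun_prop)))).congr fun c => ?_
  constructor
  · rintro ⟨a, ha, rfl⟩
    exact ⟨⟨a, ha⟩, by rw [e]⟩
  · rintro ⟨a, rfl⟩
    exact ⟨a, a.2, by rw [e]⟩

theorem arReducible_image {A B : Set ℕ} {f : A → B} {h : ℕ → ℕ} (hh : ArF D h)
    (e : ∀ x, (f x : ℕ) = h x) {n : ℕ} {X : Set (Fin n → A)}
    (hX : ArReducible (tupleSetCode X) D) :
    ArReducible (tupleSetCode ((fun v => f ∘ v) '' X)) D := by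
  refine arReducible_tupleSetCode ((Ar.ex (p := fun l s => (∃ v ∈ X, vals v = s) ∧ l = s.map h)
    (Ar.and ((Ar.trans hX ar_tupleSetCode).comp Primrec.snd) (Ar.eq (by fun_prop)
      (ArF.map (f := fun (_ : List ℕ × List ℕ) z => h z) (by fun_prop) (by fun_prop))))).congr
        fun l => ?_)
  have key : ∀ v : Fin n → A, vals (f ∘ v) = (vals v).map h := fun v => by
    simp [vals, List.map_ofFn, Function.comp_def, e]
  constructor
  · rintro ⟨_, ⟨v, hv, rfl⟩, rfl⟩
    exact ⟨_, ⟨v, hv, rfl⟩, key v⟩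
  · rintro ⟨_, ⟨v, hv, rfl⟩, rfl⟩
    exact ⟨_, ⟨v, hv, rfl⟩, key v⟩

theorem isArithmetical_of_finite {A : Set ℕ} {n : ℕ} {X : Set (Fin n → A)} (hX : X.Finite) :
    IsArithmetical (tupleSetCode X) := by
  have hf : (vals '' X).Finite := hX.image _
  refine arReducible_tupleSetCode ((Ar.memList (f := fun l => l)
    (l := fun _ : List ℕ => hf.toFinset.toList) (by fun_prop) (by fun_prop)).congr fun l => ?_)
  simp

/-- An infinite definable set computes the model. -/
theorem arReducible_of_infinite (hnf : NoFiniteModels L T) (hD : ¬ IsArithmetical D)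
    (hcat : DCategorical g T D) (hN : ArithDecidable g N) (hT : N.Models T) (E : ElemSub M N)
    {n : ℕ} {Y : Set (Fin n → M.carrier)} (hY : DefinableIn M Y) (hinf : Y.Infinite) :
    ArReducible M.carrier (tupleSetCode Y) := by
  obtain ⟨i, hi⟩ : ∃ i, ((fun v : Fin n → M.carrier => v i) '' Y).Infinite := by
    by_contra hno
    push Not at hno
    refine hinf ((Set.Finite.pi' hno).subset fun v hv i => ⟨v, hv, rfl⟩)
  obtain ⟨m, ψ, b, -, hY'⟩ := hY
  obtain ⟨χ, hχ⟩ := UDf.ex (A := extPt E) (α := Unit) (β := Fin n)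
    (P := fun j v => @Formula.Realize L _ (extPt E j).S _ ψ
      (Sum.elim (fun a => v (Sum.inr a)) fun a => (extPt E j).c (b a)) ∧
        v (Sum.inr i) = v (Sum.inl ()))
    (((UDf.formula (A := extPt E) ψ (Sum.elim (fun a => Sum.inr (Sum.inr a))
      fun a => Sum.inl (b a))).congr fun j v => iff_of_eq (congrArg _ (by
        funext z; rcases z with z | z <;> rfl))).and (UDf.eq_var _ _))
  have hχM : ∀ x : M.carrier, χ.Realize (Sum.elim (fun x => x) fun _ => x) ↔
      ∃ v ∈ Y, v i = x := by
    intro x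
    rw [hY']
    exact hχ Bool.false fun _ => x
  have hinfN : {x : N.carrier | (χ.relabel (Sum.map E.inc id)).Realize
      (Sum.elim (fun x => x) fun _ => x)}.Infinite := by
    refine (hi.image (f := E.inc) fun x _ y _ e => Subtype.ext (congrArg Subtype.val e :)).mono ?_
    rintro _ ⟨_, ⟨v, hv, rfl⟩, rfl⟩
    have h1 := (E.realize χ _).2 ((hχM (v i)).2 ⟨v, hv, rfl⟩)
    rw [Set.mem_ofPred_eq, Formula.realize_relabel]
    refine (iff_of_eq (congrArg _ ?_)).1 h1
    funext z
    rcases z with z | z <;> rfl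
  obtain ⟨p, m', ψ', k, b', hc⟩ := exists_covBy_of_infinite hnf hD hcat hN hT _ hinfN
  have hU : UDf (α := Empty) (extPt E) fun j _ => ∃ d : Fin m' → (extPt E j).M,
      @CovBy L (extPt E j).M (extPt E j).S p m' ψ' k d
        (fun x => (extPt E j).Holds χ fun _ => x) fun _ => True :=
    UDf.ex (P := fun j v => @CovBy L (extPt E j).M (extPt E j).S p m' ψ' k
        (fun a => v (Sum.inr a)) (fun x => (extPt E j).Holds χ fun _ => x) fun _ => True)
      ((UDf.covBy (A := extPt E) ψ' k (fun a => Sum.inr (Sum.inr a))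
        (η := fun j _ x => (extPt E j).Holds χ fun _ => x) (X := fun _ _ _ => True)
        (UDf.holds_snd χ) UDf.true))
  have hM := (hU.ext_iff fun a => a.elim).2 ⟨b', by
    refine CovBy.mono (M := N.carrier) hc fun x hx => ?_
    rw [Formula.realize_relabel] at hx
    refine (iff_of_eq (congrArg (@Formula.Realize L N.carrier _ _ χ) ?_)).1 hx
    funext z
    rcases z with z | z <;> rfl⟩
  obtain ⟨d, hd⟩ := hM
  have h1 := CovBy.arReducible (M := M) hN E hd
  refine h1.trans (Ar.arReducible.1 ?_)
  refine (Ar.ex (p := fun x (l : List ℕ) => (∃ v ∈ Y, vals v = l) ∧ l[(i : ℕ)]? = some x)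
    (Ar.and (ar_tupleSetCode.comp Primrec.snd) (Ar.eq (by fun_prop) (by fun_prop)))).congr
      fun x => ?_
  have hv : ∀ v : Fin n → M.carrier, (vals v)[(i : ℕ)]? = some (v i : ℕ) := fun v => by simp [vals]
  constructor
  · rintro ⟨_, ⟨v, hvY, rfl⟩, e⟩
    obtain rfl : (v i : ℕ) = x := Option.some_injective _ ((hv v).symm.trans e)
    exact ⟨(v i).2, (hχM (v i)).2 ⟨v, hvY, rfl⟩⟩
  · rintro ⟨hx, h⟩
    obtain ⟨v, hvY, e⟩ := (hχM ⟨x, hx⟩).1 h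
    exact ⟨_, ⟨v, hvY, rfl⟩, by rw [hv, e]⟩

/-- An isomorphism which is arithmetical in `D'` preserves the degree of definable sets. -/
theorem arEquiv_image (hnf : NoFiniteModels L T) (hD : ¬ IsArithmetical D)
    (hcat : DCategorical g T D) (hN : ArithExtendible g T N) (hD' : ¬ IsArithmetical D')
    (hND : ArReducible D' N.carrier) {f : M.carrier → N.carrier} (hf : Function.Injective f)
    {h : ℕ → ℕ} (hh : ArF D' h) (e : ∀ x, (f x : ℕ) = h x) {n : ℕ} {X : Set (Fin n → M.carrier)}
    (hX : ArEquiv (tupleSetCode X) D') (hY : DefinableIn N ((fun v => f ∘ v) '' X)) :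
    ArEquiv (tupleSetCode ((fun v => f ∘ v) '' X)) D' := by
  obtain ⟨K, hK, hKT, E⟩ := hN
  have hinf : X.Infinite := fun hfin => hD' (hX.2.trans (isArithmetical_of_finite hfin))
  refine ⟨arReducible_image hh e hX.1, hND.trans
    (arReducible_of_infinite hnf hD hcat hK hKT E hY (hinf.image ?_))⟩
  exact fun v _ w _ hvw => funext fun j => hf (congrFun hvw j)

/-- The inverse of an isomorphism. -/
def CodedIso.symm (f : CodedIso M N) : CodedIso N M where
  toFun := f.invFun
  invFun := f.toFun
  left_inv := f.right_inv
  right_inv := f.left_inv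
  map_fun h v := f.toEquiv.symm.map_fun' h v
  map_rel r v := (f.toEquiv.symm.map_rel' r v).symm

theorem CodedIso.definableIn_image (f : CodedIso M N) {n : ℕ} {X : Set (Fin n → M.carrier)}
    (hX : DefinableIn M X) : DefinableIn N ((fun v => f.toFun ∘ v) '' X) := by
  obtain ⟨m, ψ, b, -, rfl⟩ := hX
  have key : ∀ v : Fin n → M.carrier, ψ.Realize (Sum.elim (f.toFun ∘ v) (f.toFun ∘ b)) ↔
      ψ.Realize (Sum.elim v b) := by
    intro v
    rw [← f.realize]
    refine iff_of_eq (congrArg _ ?_)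
    funext z
    rcases z with z | z <;> rfl
  refine ⟨m, ψ, f.toFun ∘ b, fun _ => trivial, ?_⟩
  ext v
  constructor
  · rintro ⟨w, hw, rfl⟩
    exact (key w).2 hw
  · intro hv
    have e : f.toFun ∘ f.invFun ∘ v = v := funext fun j => f.right_inv _
    exact ⟨f.invFun ∘ v, (key _).1 (by rw [e]; exact hv), e⟩

end Preservation

/-- **Arithmetic Morley theorem.** Let `T` be a complete arithmetically definable theory in
a countable arithmetically definable language with no finite models.  If `T` is
`D₁`-categorical for some nonzero arithmetic degree `D₁`, then `T` is `D₂`-categorical for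
every nonzero arithmetic degree `D₂`.  Arithmetic degrees are represented by sets
`D₁ D₂ : Set ℕ`; nonzero means non-arithmetical. -/
theorem arithmetic_morley
    (L : FirstOrder.Language) (g : GoedelCoding L) (hL : ArithLang g)
    (T : L.Theory) (hT : ArithTheory g T) (hcomp : T.IsComplete)
    (hnf : NoFiniteModels L T)
    (D₁ : Set ℕ) (hD₁ : ¬ IsArithmetical D₁) (hcat : DCategorical g T D₁)
    (D₂ : Set ℕ) (hD₂ : ¬ IsArithmetical D₂) :
    DCategorical g T D₂ := by
  intro M₀ M₁ M₂ h₀ hM₀ hT₁ hx₁ hT₂ hx₂ E₁ E₂ e₁ e₂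
  obtain ⟨φ, hG⟩ := exists_geometry hnf hD₁ hcat h₀ hM₀ E₁ E₂ hx₁ hx₂
    (fun h => hD₂ (e₁.2.trans h)) (fun h => hD₂ (e₂.2.trans h))
  obtain ⟨N₁, hN₁, hNT₁, F₁⟩ := id hx₁
  obtain ⟨N₂, hN₂, hNT₂, F₂⟩ := id hx₂
  have : Infinite M₁.carrier := infinite_of_models hnf hT₁
  obtain ⟨F, hF, hgood, hF₁, hF₂⟩ := exists_enumeration hN₁ hN₂ h₀ F₁ F₂ e₁.1 e₂.1 hG
    (Set.nonempty_coe_sort.1 inferInstance)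
  obtain ⟨f, hf₁, hf₂, hfix⟩ := exists_codedIso hgood hF₁ hF₂
  have a₁ : ArF D₂ fun n => (F (2 * n)).2 := by
    have := hF.comp (f := fun n => 2 * n) (by fun_prop)
    fun_prop
  have a₂ : ArF D₂ fun n => (F (2 * n + 1)).1 := by
    have := hF.comp (f := fun n => 2 * n + 1) (by fun_prop)
    fun_prop
  exact ⟨f, ⟨arReducible_graphCode e₁.1 a₁ hf₁, arReducible_graphCode e₂.1 a₂ hf₂,
    fun n X hX hXD => arEquiv_image hnf hD₁ hcat hx₂ hD₂ e₂.2 f.left_inv.injective a₁ hf₁ hXD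
      (f.definableIn_image hX),
    fun n X hX hXD => arEquiv_image hnf hD₁ hcat hx₁ hD₂ e₁.2 f.right_inv.injective a₂ hf₂ hXD
      (f.symm.definableIn_image hX)⟩, fun x hx h₁ => congrArg Subtype.val (hfix ⟨x, hx⟩)⟩

end ArMorley
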